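/- (Spectral inequality for power-growth potentials.) Let ω ⊂ ℝ^d be (L,γ)-equidistributed. Let V : ℝ^d → [0,∞) be continuous with V = V₁+V₂, V₁ ∈ C¹(ℝ^d), V₂ continuous, and suppose there are constants c₀,c₁,c₂>0 and β₂ ≥ β₁ > 0 such that V(x) ≥ c₀|x|^{β₁} and c₁|x|^{β₁} ≤ |∇V₁(x)|+|V₁(x)|+|V₂(x)|^{4/3} ≤ c₂|x|^{β₂} for all x. Then there exist C>0, ε₀>0, h₀>0, depending only on d, ω (i.e. on L and γ) and c₀,c₁,c₂,β₁,β₂, such that for every 0<h<h₀, every 0<μ<ε₀·h^{−2β₂/β₁}, every finite orthonormal family (φ_k)_{k∈F} in ℓ²(hℤ^d) satisfying −Δ_h φ_k + V·φ_k = λ_k φ_k pointwise on hℤ^d with λ_k ≤ μ, and every v = Σ_{k∈F} c_k φ_k with c_k ∈ ℂ, one has ‖v‖²_{ℓ²(hℤ^d)} ≤ C·e^{C μ^{β₂/(2β₁)}}·‖v‖²_{ℓ²(ω)}. -/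

import Mathlib

open scoped BigOperators
open MeasureTheory

noncomputable section

/-- The canonical basis vector `e j` of `ℤ^d`. -/
def latE (d : ℕ) (j : Fin d) : Fin d → ℤ := fun i => if i = j then 1 else 0

/-- The point `h•k ∈ hℤ^d ⊂ ℝ^d` associated with `k ∈ ℤ^d`. -/
def pt (d : ℕ) (h : ℝ) (k : Fin d → ℤ) : Fin d → ℝ := fun i => h * (k i : ℝ)

/-- Forward difference operator `D_{j,h}^+`. -/
def Dp (d : ℕ) (h : ℝ) (j : Fin d) (u : (Fin d → ℤ) → ℂ) (k : Fin d → ℤ) : ℂ :=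
  (u (k + latE d j) - u k) / (h : ℂ)

/-- Backward difference operator `D_{j,h}^-`. -/
def Dm (d : ℕ) (h : ℝ) (j : Fin d) (u : (Fin d → ℤ) → ℂ) (k : Fin d → ℤ) : ℂ :=
  (u k - u (k - latE d j)) / (h : ℂ)

/-- The discrete Laplacian `Δ_h` on `hℤ^d`. -/
def discLap (d : ℕ) (h : ℝ) (u : (Fin d → ℤ) → ℂ) (k : Fin d → ℤ) : ℂ :=
  ∑ j : Fin d, (u (k + latE d j) + u (k - latE d j) - 2 * u k) / ((h : ℂ)) ^ 2

/-- The averaging operator `M_j^-`. -/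
def Mminus (d : ℕ) (h : ℝ) (j : Fin d) (u : (Fin d → ℤ) → ℂ) (k : Fin d → ℤ) : ℂ :=
  (u (k - latE d j) + u k) / 2
/-- Euclidean norm on `ℝ^d`. -/
def eucNorm (d : ℕ) (x : Fin d → ℝ) : ℝ := Real.sqrt (∑ i, x i ^ 2)

/-- An open set `ω ⊂ ℝ^d` is `(L,γ)`-equidistributed if each cube `Lk+[−L/2,L/2]^d`
contains a cube `z_k+[−γL/2,γL/2]^d` included in `ω`. -/
def Equidistributed (d : ℕ) (L γ : ℝ) (ω : Set (Fin d → ℝ)) : Prop :=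
  0 < L ∧ 0 < γ ∧ γ ≤ 1 ∧
    ∃ z : (Fin d → ℤ) → Fin d → ℝ, ∀ k : Fin d → ℤ,
      {x : Fin d → ℝ | ∀ i, |x i - z k i| ≤ γ * L / 2}
        ⊆ ω ∩ {x : Fin d → ℝ | ∀ i, |x i - L * (k i : ℝ)| ≤ L / 2}


set_option linter.all false
namespace Carl

lemma sinh_sub_le {x : ℝ} (hx : |x| ≤ 1) : |Real.sinh x - x| ≤ x ^ 2 := by
  have h1 := Real.abs_exp_sub_one_sub_id_le hx
  have h2 := Real.abs_exp_sub_one_sub_id_le (x := -x) (by simpa using hx)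
  rw [Real.sinh_eq, abs_le]
  rw [abs_le] at h1 h2
  constructor <;> nlinarith

lemma cosh_sub_le {x : ℝ} (hx : |x| ≤ 1) : |Real.cosh x - 1 - x ^ 2 / 2| ≤ |x| ^ 3 := by
  have h1 := Real.exp_bound hx (n := 3) (by norm_num)
  have h2 := Real.exp_bound (x := -x) (by simpa using hx) (n := 3) (by norm_num)
  simp [Finset.sum_range_succ, Nat.factorial] at h1 h2
  have h3 : 0 ≤ |x| ^ 3 := by positivity
  rw [Real.cosh_eq, abs_le]
  rw [abs_le] at h1 h2
  constructor <;> nlinarith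

lemma sinh_abs_le {x : ℝ} (hx : |x| ≤ 1) : |Real.sinh x| ≤ 2 * |x| := by
  have h := sinh_sub_le hx
  have h2 : x ^ 2 ≤ |x| := by rw [← sq_abs]; nlinarith [abs_nonneg x]
  calc |Real.sinh x| = |(Real.sinh x - x) + x| := by ring_nf
    _ ≤ |Real.sinh x - x| + |x| := abs_add_le _ _
    _ ≤ _ := by linarith

lemma cosh_quad {K σ h κ : ℝ} (hK : 1 ≤ K) (hσ : 0 < σ) (hh : 0 < h) (hσκ : σ ≤ κ) (hκ : 8 * K * κ ≤ 1)
    (hhσ : h ≤ κ * σ) {b a : ℝ} (ha : |a| ≤ 2 * K) (hb : |b - σ * a| ≤ 2 * K * σ * h) :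
    |Real.cosh b - 1 - σ ^ 2 * a ^ 2 / 2| ≤ 100 * K ^ 3 * κ * σ ^ 2 := by
  have hκ0 : 0 < κ := by linarith
  have hκ1 : κ ≤ 1 := by nlinarith
  have hh1 : h ≤ 1 := by nlinarith
  have hhκ : h ≤ κ := by nlinarith
  have hbn : |b| ≤ 4 * K * σ := by
    calc |b| = |(b - σ * a) + σ * a| := by ring_nf
      _ ≤ |b - σ * a| + |σ * a| := abs_add_le _ _
      _ ≤ 2 * K * σ * h + σ * (2 * K) := by rw [abs_mul, abs_of_pos hσ]; gcongr
      _ ≤ 2 * K * σ * 1 + σ * (2 * K) := by gcongr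
      _ = _ := by ring
  have hb1 : |b| ≤ 1 := by nlinarith
  have h1 := cosh_sub_le hb1
  have h2 : |b ^ 2 / 2 - σ ^ 2 * a ^ 2 / 2| ≤ 6 * K ^ 2 * σ ^ 2 * h := by
    have : b ^ 2 / 2 - σ ^ 2 * a ^ 2 / 2 = (b - σ * a) * ((b + σ * a) / 2) := by ring
    rw [this, abs_mul]
    have h3 : |(b + σ * a) / 2| ≤ 3 * K * σ := by
      rw [abs_div, abs_two]
      have : |b + σ * a| ≤ 4 * K * σ + σ * (2 * K) := by
        refine (abs_add_le _ _).trans ?_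
        rw [abs_mul, abs_of_pos hσ]; gcongr
      linarith
    calc _ ≤ (2 * K * σ * h) * (3 * K * σ) := by gcongr
      _ = _ := by ring
  calc |Real.cosh b - 1 - σ ^ 2 * a ^ 2 / 2|
      = |(Real.cosh b - 1 - b ^ 2 / 2) + (b ^ 2 / 2 - σ ^ 2 * a ^ 2 / 2)| := by ring_nf
    _ ≤ _ := abs_add_le _ _
    _ ≤ (4 * K * σ) ^ 3 + 6 * K ^ 2 * σ ^ 2 * h := by
        refine add_le_add (h1.trans ?_) h2
        gcongr
    _ ≤ 64 * K ^ 3 * κ * σ ^ 2 + 6 * K ^ 3 * κ * σ ^ 2 := by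
        have e1 : (4 * K * σ) ^ 3 = 64 * K ^ 3 * σ * σ ^ 2 := by ring
        have e2 : 6 * K ^ 2 * σ ^ 2 * h = 6 * K ^ 2 * h * σ ^ 2 := by ring
        have e3 : K ^ 2 ≤ K ^ 3 := pow_le_pow_right₀ hK (by norm_num)
        rw [e1, e2]
        gcongr
    _ ≤ _ := by
        have : 0 ≤ K ^ 3 * κ * σ ^ 2 := by positivity
        nlinarith

/-- local energy on a square -/
def YY (σ w0 wj wk wjk : ℝ) : ℝ :=
  σ ^ 2 * (w0 ^ 2 + wj ^ 2 + wk ^ 2 + wjk ^ 2) + (wj - w0) ^ 2 + (wk - w0) ^ 2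
    + (wjk - wj) ^ 2 + (wjk - wk) ^ 2

lemma YY_nonneg (σ w0 wj wk wjk : ℝ) : 0 ≤ YY σ w0 wj wk wjk := by unfold YY; positivity

lemma amgm (σ a b : ℝ) : σ * (|a| * |b|) ≤ (σ ^ 2 * a ^ 2 + b ^ 2) / 2 := by
  rw [← sq_abs a, ← sq_abs b]
  nlinarith [sq_nonneg (σ * |a| - |b|)]

lemma YY_diff {σ : ℝ} (hσ : 0 < σ) (w0 wj wk wjk : ℝ) :
    σ * |wj * wk - w0 * wjk| ≤ YY σ w0 wj wk wjk := by
  have e : wj * wk - w0 * wjk = wj * (wk - w0) - w0 * (wjk - wj) := by ring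
  have h1 := amgm σ wj (wk - w0)
  have h2 := amgm σ w0 (wjk - wj)
  have h3 : |wj * wk - w0 * wjk| ≤ |wj| * |wk - w0| + |w0| * |wjk - wj| := by
    rw [e, ← abs_mul, ← abs_mul]; exact abs_sub _ _
  have h4 : σ * |wj * wk - w0 * wjk| ≤ σ * (|wj| * |wk - w0|) + σ * (|w0| * |wjk - wj|) := by
    rw [← mul_add]; gcongr
  unfold YY
  have := sq_nonneg σ
  nlinarith [sq_nonneg (σ * w0), sq_nonneg (σ * wj), sq_nonneg (σ * wk), sq_nonneg (σ * wjk),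
    sq_nonneg (wj - w0), sq_nonneg (wk - w0), sq_nonneg (wjk - wj), sq_nonneg (wjk - wk)]

lemma YY_d2 {σ : ℝ} (hσ : 0 < σ) (w0 wj wk wjk : ℝ) :
    σ * |wj * wk - w0 ^ 2| ≤ YY σ w0 wj wk wjk := by
  have e : wj * wk - w0 ^ 2 = wj * (wk - w0) + w0 * (wj - w0) := by ring
  have h1 := amgm σ wj (wk - w0)
  have h2 := amgm σ w0 (wj - w0)
  have h3 : |wj * wk - w0 ^ 2| ≤ |wj| * |wk - w0| + |w0| * |wj - w0| := by
    rw [e, ← abs_mul, ← abs_mul]; exact abs_add_le _ _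
  have h4 : σ * |wj * wk - w0 ^ 2| ≤ σ * (|wj| * |wk - w0|) + σ * (|w0| * |wj - w0|) := by
    rw [← mul_add]; gcongr
  unfold YY
  nlinarith [sq_nonneg (σ * w0), sq_nonneg (σ * wj), sq_nonneg (σ * wk), sq_nonneg (σ * wjk),
    sq_nonneg (wj - w0), sq_nonneg (wk - w0), sq_nonneg (wjk - wj), sq_nonneg (wjk - wk)]

lemma YY_d3 {σ : ℝ} (hσ : 0 < σ) (w0 wj wk wjk : ℝ) :
    σ * |w0 * wjk - w0 ^ 2| ≤ YY σ w0 wj wk wjk := by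
  have e : w0 * wjk - w0 ^ 2 = w0 * (wjk - wj) + w0 * (wj - w0) := by ring
  have h1 := amgm σ w0 (wjk - wj)
  have h2 := amgm σ w0 (wj - w0)
  have h3 : |w0 * wjk - w0 ^ 2| ≤ |w0| * |wjk - wj| + |w0| * |wj - w0| := by
    rw [e, ← abs_mul, ← abs_mul]; exact abs_add_le _ _
  have h4 : σ * |w0 * wjk - w0 ^ 2| ≤ σ * (|w0| * |wjk - wj|) + σ * (|w0| * |wj - w0|) := by
    rw [← mul_add]; gcongr
  unfold YY
  nlinarith [sq_nonneg (σ * w0), sq_nonneg (σ * wj), sq_nonneg (σ * wk), sq_nonneg (σ * wjk),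
    sq_nonneg (wj - w0), sq_nonneg (wk - w0), sq_nonneg (wjk - wj), sq_nonneg (wjk - wk)]

lemma YY_p1 (σ w0 wj wk wjk : ℝ) : σ ^ 2 * |wj * wk| ≤ YY σ w0 wj wk wjk := by
  have h : |wj * wk| ≤ wj ^ 2 + wk ^ 2 := by
    rw [abs_le]; constructor <;> nlinarith [sq_nonneg (wj + wk), sq_nonneg (wj - wk)]
  have h2 := mul_le_mul_of_nonneg_left h (sq_nonneg σ)
  unfold YY
  nlinarith [sq_nonneg (σ * w0), sq_nonneg (σ * wj), sq_nonneg (σ * wk), sq_nonneg (σ * wjk),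
    sq_nonneg (wj - w0), sq_nonneg (wk - w0), sq_nonneg (wjk - wj), sq_nonneg (wjk - wk)]

lemma YY_p2 (σ w0 wj wk wjk : ℝ) : σ ^ 2 * |w0 * wjk| ≤ YY σ w0 wj wk wjk := by
  have h : |w0 * wjk| ≤ w0 ^ 2 + wjk ^ 2 := by
    rw [abs_le]; constructor <;> nlinarith [sq_nonneg (w0 + wjk), sq_nonneg (w0 - wjk)]
  have h2 := mul_le_mul_of_nonneg_left h (sq_nonneg σ)
  unfold YY
  nlinarith [sq_nonneg (σ * w0), sq_nonneg (σ * wj), sq_nonneg (σ * wk), sq_nonneg (σ * wjk),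
    sq_nonneg (wj - w0), sq_nonneg (wk - w0), sq_nonneg (wjk - wj), sq_nonneg (wjk - wk)]

lemma YY_p0 (σ w0 wj wk wjk : ℝ) : σ ^ 2 * w0 ^ 2 ≤ YY σ w0 wj wk wjk := by
  unfold YY
  nlinarith [sq_nonneg (σ * w0), sq_nonneg (σ * wj), sq_nonneg (σ * wk), sq_nonneg (σ * wjk),
    sq_nonneg (wj - w0), sq_nonneg (wk - w0), sq_nonneg (wjk - wj), sq_nonneg (wjk - wk)]

set_option maxHeartbeats 1000000 in
lemma R1 {K σ h κ : ℝ} (hK : 1 ≤ K) (hσ : 0 < σ) (hh : 0 < h) (hσκ : σ ≤ κ) (hκ : 8 * K * κ ≤ 1)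
    (hhσ : h ≤ κ * σ) {E α β H a b : ℝ} (w0 wj wk wjk : ℝ)
    (hE : |E - σ * h * H| ≤ K * σ * h ^ 2) (hH : |H| ≤ K) (ha : |a| ≤ K) (hb : |b| ≤ K)
    (hβ : |β - σ * (a + b)| ≤ 2 * K * σ * h) (hα : |α - σ * (a - b)| ≤ 2 * K * σ * h) :
    |2 * Real.sinh E * (Real.cosh β * (wj * wk) - Real.cosh α * (w0 * wjk))
      - 2 * (σ * h * H) * (wj * wk - w0 * wjk) - 4 * σ ^ 3 * h * (H * a * b) * w0 ^ 2|
      ≤ 2000 * K ^ 4 * κ * (σ * h) * YY σ w0 wj wk wjk := by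
  have hκ0 : 0 < κ := by linarith
  have hκ1 : κ ≤ 1 := by nlinarith
  have hσ1 : σ ≤ 1 := by linarith
  have hh1 : h ≤ 1 := by nlinarith
  have hK0 : 0 < K := by linarith
  set Y := YY σ w0 wj wk wjk with hY
  have hY0 : 0 ≤ Y := YY_nonneg _ _ _ _ _
  have hEn : |E| ≤ 2 * K * (σ * h) := by
    calc |E| = |(E - σ * h * H) + σ * h * H| := by ring_nf
      _ ≤ |E - σ * h * H| + |σ * h * H| := abs_add_le _ _
      _ ≤ K * σ * h ^ 2 + σ * h * K := by
          rw [abs_mul (σ * h), abs_of_pos (mul_pos hσ hh)]; gcongr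
      _ ≤ K * σ * (h * 1) + σ * h * K := by rw [sq]; gcongr
      _ = _ := by ring
  have hE1 : |E| ≤ 1 := by nlinarith [mul_pos hσ hh]
  have hs := sinh_abs_le hE1
  have hs' : |Real.sinh E| ≤ 4 * K * (σ * h) := by linarith
  have hsd : |Real.sinh E - σ * h * H| ≤ 5 * K ^ 2 * κ * (σ * h) * σ := by
    calc |Real.sinh E - σ * h * H| = |(Real.sinh E - E) + (E - σ * h * H)| := by ring_nf
      _ ≤ _ := abs_add_le _ _
      _ ≤ E ^ 2 + K * σ * h ^ 2 := add_le_add (sinh_sub_le hE1) hE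
      _ ≤ (2 * K * (σ * h)) ^ 2 + K * σ * h ^ 2 := by
          rw [← sq_abs E]; gcongr
      _ = 4 * K ^ 2 * σ * (σ * h) * h + K * (σ * h) * h := by ring
      _ ≤ 4 * K ^ 2 * 1 * (σ * h) * (κ * σ) + K ^ 2 * (σ * h) * (κ * σ) := by
          have : K ≤ K ^ 2 := by nlinarith
          gcongr
      _ = _ := by ring
  have hcβ := cosh_quad hK hσ hh hσκ hκ hhσ (a := a + b) (b := β)
    ((abs_add_le _ _).trans (by linarith)) hβ
  have hcα := cosh_quad hK hσ hh hσκ hκ hhσ (a := a - b) (b := α)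
    ((abs_sub _ _).trans (by linarith)) hα
  have key : 2 * Real.sinh E * (Real.cosh β * (wj * wk) - Real.cosh α * (w0 * wjk))
      - 2 * (σ * h * H) * (wj * wk - w0 * wjk) - 4 * σ ^ 3 * h * (H * a * b) * w0 ^ 2
      = 2 * (Real.sinh E - σ * h * H) * (wj * wk - w0 * wjk)
      + 2 * Real.sinh E * ((Real.cosh β - 1 - σ ^ 2 * (a + b) ^ 2 / 2) * (wj * wk))
      - 2 * Real.sinh E * ((Real.cosh α - 1 - σ ^ 2 * (a - b) ^ 2 / 2) * (w0 * wjk))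
      + Real.sinh E * σ ^ 2 * (a + b) ^ 2 * (wj * wk - w0 ^ 2)
      - Real.sinh E * σ ^ 2 * (a - b) ^ 2 * (w0 * wjk - w0 ^ 2)
      + 4 * (Real.sinh E - σ * h * H) * (σ ^ 2 * (a * b)) * w0 ^ 2 := by ring
  have hab : |a * b| ≤ K ^ 2 := by rw [abs_mul, sq]; gcongr
  have hapb : (a + b) ^ 2 ≤ 4 * K ^ 2 := by
    rw [abs_le] at ha hb; nlinarith
  have hamb : (a - b) ^ 2 ≤ 4 * K ^ 2 := by
    rw [abs_le] at ha hb; nlinarith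
  have t1 : |2 * (Real.sinh E - σ * h * H) * (wj * wk - w0 * wjk)|
      ≤ 10 * K ^ 2 * κ * (σ * h) * Y := by
    rw [abs_mul, abs_mul, abs_two]
    calc _ ≤ 2 * (5 * K ^ 2 * κ * (σ * h) * σ) * |wj * wk - w0 * wjk| := by gcongr
      _ = 10 * K ^ 2 * κ * (σ * h) * (σ * |wj * wk - w0 * wjk|) := by ring
      _ ≤ _ := by gcongr; exact YY_diff hσ _ _ _ _
  have t2 : |2 * Real.sinh E * ((Real.cosh β - 1 - σ ^ 2 * (a + b) ^ 2 / 2) * (wj * wk))|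
      ≤ 800 * K ^ 4 * κ * (σ * h) * Y := by
    rw [abs_mul, abs_mul, abs_two, abs_mul]
    calc _ ≤ 2 * (4 * K * (σ * h)) * ((100 * K ^ 3 * κ * σ ^ 2) * |wj * wk|) := by gcongr
      _ = 800 * K ^ 4 * κ * (σ * h) * (σ ^ 2 * |wj * wk|) := by ring
      _ ≤ 800 * K ^ 4 * κ * (σ * h) * Y := by gcongr; exact YY_p1 _ _ _ _ _
  have t3 : |2 * Real.sinh E * ((Real.cosh α - 1 - σ ^ 2 * (a - b) ^ 2 / 2) * (w0 * wjk))|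
      ≤ 800 * K ^ 4 * κ * (σ * h) * Y := by
    rw [abs_mul, abs_mul, abs_two, abs_mul]
    calc _ ≤ 2 * (4 * K * (σ * h)) * ((100 * K ^ 3 * κ * σ ^ 2) * |w0 * wjk|) := by gcongr
      _ = 800 * K ^ 4 * κ * (σ * h) * (σ ^ 2 * |w0 * wjk|) := by ring
      _ ≤ 800 * K ^ 4 * κ * (σ * h) * Y := by gcongr; exact YY_p2 _ _ _ _ _
  have t4 : |Real.sinh E * σ ^ 2 * (a + b) ^ 2 * (wj * wk - w0 ^ 2)|
      ≤ 16 * K ^ 3 * κ * (σ * h) * Y := by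
    rw [abs_mul, abs_mul, abs_mul, abs_of_nonneg (sq_nonneg σ), abs_of_nonneg (sq_nonneg (a + b))]
    calc _ ≤ (4 * K * (σ * h)) * σ ^ 2 * (4 * K ^ 2) * |wj * wk - w0 ^ 2| := by gcongr
      _ = 16 * K ^ 3 * σ * (σ * h) * (σ * |wj * wk - w0 ^ 2|) := by ring
      _ ≤ _ := by gcongr; exact YY_d2 hσ _ _ _ _
  have t5 : |Real.sinh E * σ ^ 2 * (a - b) ^ 2 * (w0 * wjk - w0 ^ 2)|
      ≤ 16 * K ^ 3 * κ * (σ * h) * Y := by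
    rw [abs_mul, abs_mul, abs_mul, abs_of_nonneg (sq_nonneg σ), abs_of_nonneg (sq_nonneg (a - b))]
    calc _ ≤ (4 * K * (σ * h)) * σ ^ 2 * (4 * K ^ 2) * |w0 * wjk - w0 ^ 2| := by gcongr
      _ = 16 * K ^ 3 * σ * (σ * h) * (σ * |w0 * wjk - w0 ^ 2|) := by ring
      _ ≤ _ := by gcongr; exact YY_d3 hσ _ _ _ _
  have t6 : |4 * (Real.sinh E - σ * h * H) * (σ ^ 2 * (a * b)) * w0 ^ 2|
      ≤ 20 * K ^ 4 * κ * (σ * h) * Y := by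
    rw [abs_mul, abs_mul, abs_mul, abs_mul (σ ^ 2), abs_of_nonneg (sq_nonneg σ),
      abs_of_nonneg (sq_nonneg w0), abs_of_pos (by norm_num : (0:ℝ) < 4)]
    calc _ ≤ 4 * (5 * K ^ 2 * κ * (σ * h) * 1) * (σ ^ 2 * K ^ 2) * w0 ^ 2 := by
            gcongr; exact hsd.trans (by gcongr)
      _ = 20 * K ^ 4 * κ * (σ * h) * (σ ^ 2 * w0 ^ 2) := by ring
      _ ≤ _ := by gcongr; exact YY_p0 _ _ _ _ _
  rw [key]
  have hZ : 0 ≤ κ * (σ * h) * Y := by positivity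
  have k2 : K ^ 2 ≤ K ^ 4 := pow_le_pow_right₀ hK (by norm_num)
  have k3 : K ^ 3 ≤ K ^ 4 := pow_le_pow_right₀ hK (by norm_num)
  have z2 := mul_le_mul_of_nonneg_right k2 hZ
  have z3 := mul_le_mul_of_nonneg_right k3 hZ
  have z4 : 0 ≤ K ^ 4 * (κ * (σ * h) * Y) := by positivity
  rw [abs_le] at t1 t2 t3 t4 t5 t6
  obtain ⟨p1, q1⟩ := t1
  obtain ⟨p2, q2⟩ := t2
  obtain ⟨p3, q3⟩ := t3
  obtain ⟨p4, q4⟩ := t4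
  obtain ⟨p5, q5⟩ := t5
  obtain ⟨p6, q6⟩ := t6
  rw [abs_le]
  constructor <;> linarith

/-- comparison of the second-order square terms -/
lemma R2 {K σ h κ : ℝ} (hK : 1 ≤ K) (hσ : 0 < σ) (hh : 0 < h) (hσκ : σ ≤ κ) (hκ : 8 * K * κ ≤ 1)
    (hhσ : h ≤ κ * σ) {H0 Hj Hk Hjk : ℝ} (w0 wj wk wjk : ℝ)
    (h1 : |Hj - H0| ≤ K * h) (h2 : |Hk - H0| ≤ K * h)
    (h3 : |Hjk - Hj - Hk + H0| ≤ K * h ^ 2) :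
    |2 * H0 * (wj * wk - w0 * wjk) - ((H0 + Hjk) * (wj * wk) - (Hj + Hk) * (w0 * wjk))|
      ≤ 3 * K * κ * YY σ w0 wj wk wjk := by
  have hκ0 : 0 < κ := by linarith
  have hκ1 : κ ≤ 1 := by nlinarith
  have hK0 : 0 < K := by linarith
  have e : 2 * H0 * (wj * wk - w0 * wjk) - ((H0 + Hjk) * (wj * wk) - (Hj + Hk) * (w0 * wjk))
    = -((Hjk - Hj - Hk + H0) * (wj * wk))
      - ((Hj - H0) + (Hk - H0)) * (wj * wk - w0 * wjk) := by ring
  rw [e]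
  refine (abs_sub _ _).trans ?_
  rw [abs_neg, abs_mul (Hjk - Hj - Hk + H0), abs_mul ((Hj - H0) + (Hk - H0))]
  have a1 : |(Hj - H0) + (Hk - H0)| ≤ 2 * K * h := (abs_add_le _ _).trans (by linarith)
  calc _ ≤ K * h ^ 2 * |wj * wk| + 2 * K * h * |wj * wk - w0 * wjk| := by gcongr
    _ ≤ K * (κ * σ) ^ 2 * |wj * wk| + 2 * K * (κ * σ) * |wj * wk - w0 * wjk| := by gcongr
    _ = K * κ * κ * (σ ^ 2 * |wj * wk|) + 2 * K * κ * (σ * |wj * wk - w0 * wjk|) := by ring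
    _ ≤ K * κ * 1 * YY σ w0 wj wk wjk + 2 * K * κ * YY σ w0 wj wk wjk := by
        have := YY_nonneg σ w0 wj wk wjk
        gcongr
        · exact YY_p1 _ _ _ _ _
        · exact YY_diff hσ _ _ _ _
    _ = _ := by ring

/-- the multiplier term -/
lemma R3 {K σ h κ : ℝ} (hK : 1 ≤ K) (hσ : 0 < σ) (hh : 0 < h) (hσκ : σ ≤ κ) (hκ : 8 * K * κ ≤ 1)
    (hhσ : h ≤ κ * σ) {t0 tp tm ap am g : ℝ} (ht : |t0| ≤ K)
    (h1 : |tp - t0| ≤ K * h) (h2 : |tm - t0| ≤ K * h) (h3 : |tp + tm - 2 * t0| ≤ K * h ^ 2)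
    (hg : |g| ≤ K) (hap : |ap - σ * g| ≤ K * σ * h) (ham : |am + σ * g| ≤ K * σ * h) :
    |((t0 + tp) * Real.cosh ap + (t0 + tm) * Real.cosh am - 4 * t0) - 2 * σ ^ 2 * g ^ 2 * t0|
      ≤ 1000 * K ^ 4 * κ * σ ^ 2 := by
  have hκ0 : 0 < κ := by linarith
  have hκ1 : κ ≤ 1 := by nlinarith
  have hK0 : 0 < K := by linarith
  have hh1 : h ≤ 1 := by nlinarith
  have hhκ : h ≤ κ := by nlinarith
  have c1 := cosh_quad hK hσ hh hσκ hκ hhσ (a := g) (b := ap) (by linarith)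
    (hap.trans (by nlinarith [mul_pos hσ hh]))
  have c2 := cosh_quad hK hσ hh hσκ hκ hhσ (a := -g) (b := am) (by rw [abs_neg]; linarith)
    (by rw [mul_neg, sub_neg_eq_add]; exact ham.trans (by nlinarith [mul_pos hσ hh]))
  rw [neg_sq] at c2
  have e : ((t0 + tp) * Real.cosh ap + (t0 + tm) * Real.cosh am - 4 * t0) - 2 * σ ^ 2 * g ^ 2 * t0
    = (tp + tm - 2 * t0) + (t0 + tp) * (Real.cosh ap - 1 - σ ^ 2 * g ^ 2 / 2)
      + (t0 + tm) * (Real.cosh am - 1 - σ ^ 2 * g ^ 2 / 2)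
      + (tp + tm - 2 * t0) * (σ ^ 2 * g ^ 2 / 2) := by ring
  have hp : |t0 + tp| ≤ 3 * K := by
    have : t0 + tp = 2 * t0 + (tp - t0) := by ring
    rw [this]; refine (abs_add_le _ _).trans ?_
    rw [abs_mul, abs_two]; nlinarith
  have hm : |t0 + tm| ≤ 3 * K := by
    have : t0 + tm = 2 * t0 + (tm - t0) := by ring
    rw [this]; refine (abs_add_le _ _).trans ?_
    rw [abs_mul, abs_two]; nlinarith
  have u1 : |tp + tm - 2 * t0| ≤ K * κ * σ ^ 2 := by
    refine h3.trans ?_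
    calc K * h ^ 2 ≤ K * (κ * σ) ^ 2 := by gcongr
      _ = K * κ * σ ^ 2 * κ := by ring
      _ ≤ K * κ * σ ^ 2 * 1 := by gcongr
      _ = _ := by ring
  have u2 : |(t0 + tp) * (Real.cosh ap - 1 - σ ^ 2 * g ^ 2 / 2)| ≤ 300 * K ^ 4 * κ * σ ^ 2 := by
    rw [abs_mul]
    calc _ ≤ (3 * K) * (100 * K ^ 3 * κ * σ ^ 2) := by gcongr
      _ = _ := by ring
  have u3 : |(t0 + tm) * (Real.cosh am - 1 - σ ^ 2 * g ^ 2 / 2)| ≤ 300 * K ^ 4 * κ * σ ^ 2 := by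
    rw [abs_mul]
    calc _ ≤ (3 * K) * (100 * K ^ 3 * κ * σ ^ 2) := by gcongr
      _ = _ := by ring
  have u4 : |(tp + tm - 2 * t0) * (σ ^ 2 * g ^ 2 / 2)| ≤ K * κ * σ ^ 2 := by
    rw [abs_mul]
    have : |σ ^ 2 * g ^ 2 / 2| ≤ 1 := by
      rw [abs_of_nonneg (by positivity), ← sq_abs g]
      have : σ * |g| ≤ 1 := by nlinarith [abs_nonneg g]
      nlinarith [mul_nonneg hσ.le (abs_nonneg g)]
    calc _ ≤ (K * κ * σ ^ 2) * 1 := by gcongr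
      _ = _ := by ring
  rw [e]
  have hZ : 0 ≤ κ * σ ^ 2 := by positivity
  have k1 : K ≤ K ^ 4 := le_self_pow₀ hK (by norm_num)
  have z1 := mul_le_mul_of_nonneg_right k1 hZ
  have z4 : 0 ≤ K ^ 4 * (κ * σ ^ 2) := by positivity
  rw [abs_le] at u1 u2 u3 u4
  obtain ⟨p1, q1⟩ := u1
  obtain ⟨p2, q2⟩ := u2
  obtain ⟨p3, q3⟩ := u3
  obtain ⟨p4, q4⟩ := u4
  rw [abs_le]
  constructor <;> linarith
end Carl

namespace Carl
open Finset

section grp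
variable {ι G : Type*} [Fintype ι] [AddCommGroup G]

/-- symmetric part of the conjugated operator -/
def opS (e : ι → G) (φ q w : G → ℝ) (z : G) : ℝ :=
  ∑ j, (Real.cosh (φ (z + e j) - φ z) * w (z + e j)
    + Real.cosh (φ (z - e j) - φ z) * w (z - e j) - 2 * w z) - q z * w z

/-- antisymmetric part of the conjugated operator -/
def opA (e : ι → G) (φ w : G → ℝ) (z : G) : ℝ :=
  -∑ j, (Real.sinh (φ (z + e j) - φ z) * w (z + e j)
    + Real.sinh (φ (z - e j) - φ z) * w (z - e j))

/-- mixed second difference -/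
def d2 (φ : G → ℝ) (z a b : G) : ℝ := φ (z + a + b) + φ z - φ (z + a) - φ (z + b)

variable [Fintype G]

lemma shift (f : G → ℝ) (a : G) : ∑ z, f (z + a) = ∑ z, f z :=
  Equiv.sum_comp (Equiv.addRight a) f

lemma I1 (e : ι → G) (φ q w : G → ℝ) :
    ∑ z, 2 * opS e φ q w z * opA e φ w z
      = ∑ j, ∑ k, ∑ z, 2 * Real.sinh (d2 φ z (e j) (e k)) *
          (Real.cosh (φ (z + e j + e k) - φ z) * (w (z + e j) * w (z + e k))
            - Real.cosh (φ (z + e j) - φ (z + e k)) * (w z * w (z + e j + e k)))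
        + ∑ j, ∑ z, 2 * (q z - q (z + e j)) * Real.sinh (φ (z + e j) - φ z)
            * (w z * w (z + e j)) := by
  set C : ι → G → ℝ := fun j z => Real.cosh (φ (z + e j) - φ z) * w (z + e j)
    + Real.cosh (φ (z - e j) - φ z) * w (z - e j) with hC
  set D : ι → G → ℝ := fun j z => Real.sinh (φ (z + e j) - φ z) * w (z + e j)
    + Real.sinh (φ (z - e j) - φ z) * w (z - e j) with hD
  have hpt : ∀ z, 2 * opS e φ q w z * opA e φ w z
      = ∑ j, ∑ k, -(C j z * D k z + C k z * D j z)
        + ∑ j, 2 * (2 * Fintype.card ι + q z) * w z * D j z := by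
    intro z
    have h1 : opS e φ q w z = ∑ j, C j z - (2 * Fintype.card ι + q z) * w z := by
      simp only [opS, hC, sum_sub_distrib, sum_const, card_univ, nsmul_eq_mul]; ring
    have h2 : opA e φ w z = -∑ j, D j z := rfl
    have h3 : ∑ j, ∑ k, -(C j z * D k z + C k z * D j z) = -2 * ((∑ j, C j z) * ∑ k, D k z) := by
      simp only [sum_neg_distrib, sum_add_distrib]
      rw [sum_comm (f := fun j k => C k z * D j z), ← sum_mul_sum]; ring
    rw [h1, h2, h3, ← mul_sum]; ring
  rw [sum_congr rfl (fun z _ => hpt z), sum_add_distrib, sum_comm]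
  congr 1
  · refine sum_congr rfl fun j _ => ?_
    rw [sum_comm]
    refine sum_congr rfl fun k _ => ?_
    have hq : ∀ z, -(C j z * D k z + C k z * D j z) =
        -(Real.sinh (φ (z + e j) + φ (z + e k) - 2 * φ z) * (w (z + e j) * w (z + e k))
        + Real.sinh (φ (z - e j) + φ (z + e k) - 2 * φ z) * (w (z - e j) * w (z + e k))
        + Real.sinh (φ (z + e j) + φ (z - e k) - 2 * φ z) * (w (z + e j) * w (z - e k))
        + Real.sinh (φ (z - e j) + φ (z - e k) - 2 * φ z) * (w (z - e j) * w (z - e k))) := by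
      intro z
      have s : ∀ a b c : ℝ, a + b - 2 * c = (a - c) + (b - c) := fun a b c => by ring
      simp only [hC, hD, s, Real.sinh_add]
      ring
    rw [sum_congr rfl (fun z _ => hq z)]
    simp only [sum_neg_distrib, sum_add_distrib]
    rw [← shift (fun z => Real.sinh (φ (z - e j) + φ (z + e k) - 2 * φ z)
        * (w (z - e j) * w (z + e k))) (e j),
      ← shift (fun z => Real.sinh (φ (z + e j) + φ (z - e k) - 2 * φ z)
        * (w (z + e j) * w (z - e k))) (e k),
      ← shift (fun z => Real.sinh (φ (z - e j) + φ (z - e k) - 2 * φ z)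
        * (w (z - e j) * w (z - e k))) (e j + e k),
      ← sum_add_distrib, ← sum_add_distrib, ← sum_add_distrib, ← sum_neg_distrib]
    refine sum_congr rfl fun z _ => ?_
    have a1 : z + e j - e j = z := by abel
    have a2 : z + e k - e k = z := by abel
    have a3 : z + (e j + e k) - e j = z + e k := by abel
    have a4 : z + (e j + e k) - e k = z + e j := by abel
    have a5 : z + e k + e j = z + e j + e k := by abel
    have a6 : z + (e j + e k) = z + e j + e k := by abel
    rw [a1, a2, a3, a4, a5, a6, d2]
    generalize φ (z + e j + e k) = fjk
    generalize φ (z + e j) = fj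
    generalize φ (z + e k) = fk
    generalize φ z = f0
    have b1 : Real.sinh (fj + fk - 2 * f0) + Real.sinh (fk + fj - 2 * fjk)
        = -(2 * Real.sinh (fjk + f0 - fj - fk) * Real.cosh (fjk - f0)) := by
      have x1 : fj + fk - 2 * f0 = -(fjk + f0 - fj - fk) + (fjk - f0) := by ring
      have x2 : fk + fj - 2 * fjk = -(fjk + f0 - fj - fk) - (fjk - f0) := by ring
      rw [x1, x2]
      generalize fjk + f0 - fj - fk = E
      rw [Real.sinh_add, Real.sinh_sub (-E), Real.sinh_neg, Real.cosh_neg]; ring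
    have b2 : Real.sinh (f0 + fjk - 2 * fj) + Real.sinh (fjk + f0 - 2 * fk)
        = 2 * Real.sinh (fjk + f0 - fj - fk) * Real.cosh (fj - fk) := by
      have x1 : f0 + fjk - 2 * fj = (fjk + f0 - fj - fk) - (fj - fk) := by ring
      have x2 : fjk + f0 - 2 * fk = (fjk + f0 - fj - fk) + (fj - fk) := by ring
      rw [x1, x2]
      generalize fjk + f0 - fj - fk = E
      rw [Real.sinh_add, Real.sinh_sub E]; ring
    linear_combination (-(w (z + e j) * w (z + e k))) * b1 - (w z * w (z + e j + e k)) * b2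
  · rw [sum_comm]
    refine sum_congr rfl fun j _ => ?_
    have s1 := shift (fun z => 2 * (2 * (Fintype.card ι : ℝ) + q z) * w z
        * (Real.sinh (φ (z - e j) - φ z) * w (z - e j))) (e j)
    simp only [add_sub_cancel_right] at s1
    simp only [hD, mul_add (2 * (2 * (Fintype.card ι : ℝ) + q _) * w _), sum_add_distrib]
    rw [← s1, ← sum_add_distrib]
    refine sum_congr rfl fun z _ => ?_
    have : Real.sinh (φ z - φ (z + e j)) = -Real.sinh (φ (z + e j) - φ z) := by
      rw [← Real.sinh_neg]; congr 1; ring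
    rw [this]; ring

lemma I2 (e : ι → G) (φ q w t : G → ℝ) :
    ∑ z, -2 * t z * w z * opS e φ q w z
      = ∑ j, ∑ z, (t z + t (z + e j)) * Real.cosh (φ (z + e j) - φ z) * (w (z + e j) - w z) ^ 2
        - ∑ j, ∑ z, w z ^ 2 * ((t z + t (z + e j)) * Real.cosh (φ (z + e j) - φ z)
          + (t z + t (z - e j)) * Real.cosh (φ (z - e j) - φ z) - 4 * t z)
        + ∑ z, 2 * t z * q z * w z ^ 2 := by
  have hpt : ∀ z, -2 * t z * w z * opS e φ q w z
      = ∑ j, -2 * t z * w z * (Real.cosh (φ (z + e j) - φ z) * w (z + e j)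
          + Real.cosh (φ (z - e j) - φ z) * w (z - e j) - 2 * w z)
        + 2 * t z * q z * w z ^ 2 := by
    intro z; rw [← mul_sum, opS]; ring
  rw [sum_congr rfl (fun z _ => hpt z), sum_add_distrib, sum_comm]
  congr 1
  rw [← sum_sub_distrib]
  refine sum_congr rfl fun j _ => ?_
  have s1 := shift (fun z => -2 * t z * w z * (Real.cosh (φ (z - e j) - φ z) * w (z - e j))) (e j)
  have s2 := shift (fun z => (t z + t (z - e j)) * Real.cosh (φ (z - e j) - φ z) * w z ^ 2) (e j)
  simp only [add_sub_cancel_right] at s1 s2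
  have l : ∑ z, -2 * t z * w z * (Real.cosh (φ (z + e j) - φ z) * w (z + e j)
          + Real.cosh (φ (z - e j) - φ z) * w (z - e j) - 2 * w z)
      = ∑ z, -2 * t z * w z * (Real.cosh (φ (z + e j) - φ z) * w (z + e j))
        + ∑ z, -2 * t z * w z * (Real.cosh (φ (z - e j) - φ z) * w (z - e j))
        + ∑ z, 4 * t z * w z ^ 2 := by
    rw [← sum_add_distrib, ← sum_add_distrib]
    exact sum_congr rfl fun z _ => by ring
  have r : ∑ z, w z ^ 2 * ((t z + t (z + e j)) * Real.cosh (φ (z + e j) - φ z)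
          + (t z + t (z - e j)) * Real.cosh (φ (z - e j) - φ z) - 4 * t z)
      = ∑ z, (t z + t (z + e j)) * Real.cosh (φ (z + e j) - φ z) * w z ^ 2
        + ∑ z, (t z + t (z - e j)) * Real.cosh (φ (z - e j) - φ z) * w z ^ 2
        - ∑ z, 4 * t z * w z ^ 2 := by
    rw [← sum_add_distrib, ← sum_sub_distrib]
    exact sum_congr rfl fun z _ => by ring
  rw [l, r, ← s1, ← s2]
  simp only [← sum_add_distrib, ← sum_sub_distrib]
  refine sum_congr rfl fun z _ => ?_
  have : Real.cosh (φ z - φ (z + e j)) = Real.cosh (φ (z + e j) - φ z) := by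
    rw [← Real.cosh_neg]; congr 1; ring
  rw [this]; ring

lemma I3 (a b : G) (H w : G → ℝ) :
    ∑ z, H z * ((w (z + a) - w (z - a)) * (w (z + b) - w (z - b)))
      = ∑ z, ((H z + H (z + a + b)) * (w (z + a) * w (z + b))
          - (H (z + a) + H (z + b)) * (w z * w (z + a + b))) := by
  have s1 := shift (fun z => H z * (w (z - a) * w (z + b))) a
  have s2 := shift (fun z => H z * (w (z + a) * w (z - b))) b
  have s3 := shift (fun z => H z * (w (z - a) * w (z - b))) (a + b)
  have l : ∑ z, H z * ((w (z + a) - w (z - a)) * (w (z + b) - w (z - b)))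
      = ∑ z, H z * (w (z + a) * w (z + b)) - ∑ z, H z * (w (z - a) * w (z + b))
        - ∑ z, H z * (w (z + a) * w (z - b)) + ∑ z, H z * (w (z - a) * w (z - b)) := by
    simp only [← sum_add_distrib, ← sum_sub_distrib]
    exact sum_congr rfl fun z _ => by ring
  rw [l, ← s1, ← s2, ← s3]
  simp only [← sum_add_distrib, ← sum_sub_distrib]
  refine sum_congr rfl fun z _ => ?_
  have a1 : z + a - a = z := by abel
  have a2 : z + b - b = z := by abel
  have a3 : z + (a + b) - a = z + b := by abel
  have a4 : z + (a + b) - b = z + a := by abel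
  have a5 : z + b + a = z + a + b := by abel
  have a6 : z + (a + b) = z + a + b := by abel
  rw [a1, a2, a3, a4, a5, a6]; ring

end grp
end Carl

namespace Carl
open Finset

section grp
variable {ι G : Type*} [Fintype ι] [AddCommGroup G]

/-- pointwise assumptions on the weight at `z` -/
structure WHyp (e : ι → G) (φ q t : G → ℝ) (g : G → ι → ℝ) (H : G → ι → ι → ℝ)
    (K m ρ σ h : ℝ) (z : G) : Prop where
  g_le : ∀ j, |g z j| ≤ K
  φp : ∀ j, |φ (z + e j) - φ z - σ * g z j| ≤ K * σ * h
  φm : ∀ j, |φ (z - e j) - φ z + σ * g z j| ≤ K * σ * h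
  φpp : ∀ j k, |φ (z + e j + e k) - φ z - σ * (g z j + g z k)| ≤ 2 * K * σ * h
  φd : ∀ j k, |d2 φ z (e j) (e k) - σ * h * H z j k| ≤ K * σ * h ^ 2
  H_le : ∀ j k, |H z j k| ≤ K
  H1 : ∀ j k l, |H (z + e l) j k - H z j k| ≤ K * h
  H2 : ∀ j k, |H (z + e j + e k) j k - H (z + e j) j k - H (z + e k) j k + H z j k| ≤ K * h ^ 2
  t_lo : m ≤ t z
  t_hi : t z ≤ K
  tp : ∀ j, |t (z + e j) - t z| ≤ K * h
  tm : ∀ j, |t (z - e j) - t z| ≤ K * h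
  t2 : ∀ j, |t (z + e j) + t (z - e j) - 2 * t z| ≤ K * h ^ 2
  P1 : ∀ ξ : ι → ℝ, 0 ≤ ∑ j, ∑ k, H z j k * (ξ j * ξ k) + (t z - m) / 2 * ∑ j, ξ j ^ 2
  P2 : m ≤ 4 * ∑ j, ∑ k, H z j k * (g z j * g z k) - 2 * t z * ∑ j, g z j ^ 2
  q0 : |q z| ≤ ρ * σ ^ 2
  q1 : ∀ j, |q (z + e j) - q z| ≤ ρ * σ ^ 2 * h

variable [Fintype G]

lemma sumYY (σ : ℝ) (w : G → ℝ) (a b : G) :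
    ∑ z, YY σ (w z) (w (z + a)) (w (z + b)) (w (z + a + b))
      = 4 * σ ^ 2 * ∑ z, w z ^ 2 + 2 * ∑ z, (w (z + a) - w z) ^ 2
        + 2 * ∑ z, (w (z + b) - w z) ^ 2 := by
  have s1 := shift (fun z => w z ^ 2) a
  have s2 := shift (fun z => w z ^ 2) b
  have s3 := shift (fun z => w z ^ 2) (a + b)
  have s4 := shift (fun z => (w (z + b) - w z) ^ 2) a
  have s5 := shift (fun z => (w (z + a) - w z) ^ 2) b
  simp only [← add_assoc] at s3
  have a5 : ∀ z : G, z + b + a = z + a + b := fun z => by abel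
  simp only [a5] at s5
  simp only [YY, sum_add_distrib, ← mul_sum]
  rw [s1, s2, s3, s4, s5]; ring

lemma cc5 (a b c : ℝ) : (a - c) ^ 2 ≤ 2 * ((a - b) ^ 2 + (b - c) ^ 2) := by
  nlinarith [sq_nonneg ((a - b) - (b - c))]

lemma cc6 (a b : ℝ) : |a * b| ≤ (a ^ 2 + b ^ 2) / 2 := by
  rw [abs_le]
  constructor <;> nlinarith [sq_nonneg (a + b), sq_nonneg (a - b)]

lemma cc1 {n X m : ℝ} (hn0 : 0 ≤ n) (Z : 0 ≤ X) (h : 20000 * (n + 1) ^ 2 * X ≤ m) :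
    8012 * n * X ≤ 2 * m := by nlinarith [mul_nonneg hn0 Z, mul_nonneg (sq_nonneg n) Z]

lemma cc2 {n X m K ρ : ℝ} (hn0 : 0 ≤ n) (Z : 0 ≤ X) (h : 20000 * (n + 1) ^ 2 * X ≤ m)
    (hρ : K * ρ ≤ X) :
    8012 * n ^ 2 * X + 1000 * n * X + 2 * K * ρ + 8 * K * n * ρ ≤ m / 2 := by
  nlinarith [mul_nonneg hn0 Z, mul_nonneg (sq_nonneg n) Z, mul_le_mul_of_nonneg_left hρ hn0]

lemma cc3 {n X m : ℝ} (hn0 : 0 ≤ n) (Z : 0 ≤ X) (h : 20000 * (n + 1) ^ 2 * X ≤ m) :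
    X ≤ m := by nlinarith [mul_nonneg hn0 Z, mul_nonneg (sq_nonneg n) Z]

lemma cc4 {a b K σ h g : ℝ} (hK0 : 0 < K) (hσ : 0 < σ) (hh1 : h ≤ 1)
    (h1 : |a - b - σ * g| ≤ K * σ * h) (h2 : |g| ≤ K) : |a - b| ≤ 2 * K * σ := by
  have h1 := abs_le.1 h1
  have h2 := abs_le.1 h2
  have : K * σ * h ≤ K * σ * 1 := by gcongr
  rw [abs_le]; constructor <;> nlinarith

set_option maxHeartbeats 2000000 in
theorem carleman (e : ι → G) (φ q t w : G → ℝ) (g : G → ι → ℝ) (H : G → ι → ι → ℝ)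
    {K m ρ σ h κ : ℝ} (hK : 1 ≤ K) (hm : 0 < m) (hσ : 0 < σ) (hh : 0 < h) (hσκ : σ ≤ κ)
    (hκ : 8 * K * κ ≤ 1) (hhσ : h ≤ κ * σ) (hρ0 : 0 ≤ ρ) (hρ : ρ ≤ κ)
    (hκm : 20000 * ((Fintype.card ι : ℝ) + 1) ^ 2 * K ^ 4 * κ ≤ m)
    (B : Set G) (hB : ∀ z ∈ B, WHyp e φ q t g H K m ρ σ h z)
    (hw : ∀ z, z ∉ B → w z = 0 ∧ (∀ j, w (z + e j) = 0 ∧ w (z - e j) = 0)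
      ∧ ∀ j k, w (z + e j + e k) = 0) :
    m / 2 * σ ^ 3 * h * ∑ z, w z ^ 2
      ≤ ∑ z, 2 * opS e φ q w z * (opA e φ w z - σ * h * t z * w z) := by
  have hκ0 : 0 < κ := by linarith
  have hκ1 : κ ≤ 1 := by nlinarith
  have hσ1 : σ ≤ 1 := by linarith
  have hh1 : h ≤ 1 := by nlinarith
  have hhκ : h ≤ κ := by nlinarith
  have hK0 : 0 < K := by linarith
  have hKσ : 2 * K * σ ≤ 1 := by nlinarith
  set n : ℝ := (Fintype.card ι : ℝ) with hn
  have hn0 : 0 ≤ n := by positivity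
  have hK4 : K ≤ K ^ 4 := le_self_pow₀ hK (by norm_num)
  have hKκm : K * κ ≤ m := by
    have h2 : K * κ ≤ K ^ 4 * κ := by gcongr
    exact h2.trans (cc3 hn0 (by positivity) (by linarith))
  set W := ∑ z, w z ^ 2 with hW
  have hW0 : 0 ≤ W := sum_nonneg fun _ _ => sq_nonneg _
  set Γ := ∑ j, ∑ z, (w (z + e j) - w z) ^ 2 with hΓ
  have hΓ0 : 0 ≤ Γ := sum_nonneg fun _ _ => sum_nonneg fun _ _ => sq_nonneg _
  -- splitting
  have split : ∑ z, 2 * opS e φ q w z * (opA e φ w z - σ * h * t z * w z)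
      = ∑ z, 2 * opS e φ q w z * opA e φ w z
        + σ * h * ∑ z, -2 * t z * w z * opS e φ q w z := by
    rw [mul_sum, ← sum_add_distrib]
    exact sum_congr rfl fun z _ => by ring
  -- quartic part
  have A1 : ∑ j, ∑ k, ∑ z, (σ * h * ((H z j k + H (z + e j + e k) j k) * (w (z + e j) * w (z + e k))
        - (H (z + e j) j k + H (z + e k) j k) * (w z * w (z + e j + e k)))
        + 4 * σ ^ 3 * h * (H z j k * g z j * g z k) * w z ^ 2
        - 2003 * K ^ 4 * κ * (σ * h) * YY σ (w z) (w (z + e j)) (w (z + e k)) (w (z + e j + e k)))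
      ≤ ∑ j, ∑ k, ∑ z, 2 * Real.sinh (d2 φ z (e j) (e k)) *
          (Real.cosh (φ (z + e j + e k) - φ z) * (w (z + e j) * w (z + e k))
            - Real.cosh (φ (z + e j) - φ (z + e k)) * (w z * w (z + e j + e k))) := by
    refine sum_le_sum fun j _ => sum_le_sum fun k _ => sum_le_sum fun z _ => ?_
    by_cases hz : z ∈ B
    · obtain ⟨hg, hp, hm', hpp, hd, hH, hH1, hH2, -, -, -, -, -, -, -, -, -⟩ := hB z hz
      have hα : |φ (z + e j) - φ (z + e k) - σ * (g z j - g z k)| ≤ 2 * K * σ * h := by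
        have : φ (z + e j) - φ (z + e k) - σ * (g z j - g z k)
          = (φ (z + e j) - φ z - σ * g z j) - (φ (z + e k) - φ z - σ * g z k) := by ring
        rw [this]
        exact (abs_sub _ _).trans (by linarith [hp j, hp k])
      have r1 := R1 hK hσ hh hσκ hκ hhσ (w z) (w (z + e j)) (w (z + e k)) (w (z + e j + e k))
        (hd j k) (hH j k) (hg j) (hg k) (hpp j k) hα
      have r2 := R2 hK hσ hh hσκ hκ hhσ (w z) (w (z + e j)) (w (z + e k)) (w (z + e j + e k))
        (hH1 j k j) (hH1 j k k) (hH2 j k)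
      have r2' := mul_le_mul_of_nonneg_left (abs_le.1 r2).1 (mul_pos hσ hh).le
      have r1' := (abs_le.1 r1).1
      have hY := YY_nonneg σ (w z) (w (z + e j)) (w (z + e k)) (w (z + e j + e k))
      set Y := YY σ (w z) (w (z + e j)) (w (z + e k)) (w (z + e j + e k))
      have hZ : 0 ≤ κ * (σ * h) * Y := by positivity
      have := mul_le_mul_of_nonneg_right hK4 hZ
      linear_combination r1' + r2' + 3 * this
    · obtain ⟨h0, h1, h2⟩ := hw z hz
      simp [h0, h1, h2, YY]
  have A2 : ∑ j, ∑ k, ∑ z, (σ * h * ((H z j k + H (z + e j + e k) j k) * (w (z + e j) * w (z + e k))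
        - (H (z + e j) j k + H (z + e k) j k) * (w z * w (z + e j + e k)))
        + 4 * σ ^ 3 * h * (H z j k * g z j * g z k) * w z ^ 2
        - 2003 * K ^ 4 * κ * (σ * h) * YY σ (w z) (w (z + e j)) (w (z + e k)) (w (z + e j + e k)))
      = σ * h * ∑ z, ∑ j, ∑ k, H z j k * ((w (z + e j) - w (z - e j)) * (w (z + e k) - w (z - e k)))
        + σ ^ 3 * h * ∑ z, 4 * (∑ j, ∑ k, H z j k * (g z j * g z k)) * w z ^ 2
        - 2003 * K ^ 4 * κ * (σ * h) * (4 * n ^ 2 * σ ^ 2 * W + 4 * n * Γ) := by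
    have x1 : ∑ z, ∑ j, ∑ k, H z j k * ((w (z + e j) - w (z - e j)) * (w (z + e k) - w (z - e k)))
        = ∑ j, ∑ k, ∑ z, ((H z j k + H (z + e j + e k) j k) * (w (z + e j) * w (z + e k))
        - (H (z + e j) j k + H (z + e k) j k) * (w z * w (z + e j + e k))) := by
      rw [sum_comm]
      refine sum_congr rfl fun j _ => ?_
      rw [sum_comm]
      refine sum_congr rfl fun k _ => ?_
      exact I3 (e j) (e k) (fun z => H z j k) w
    have x2 : ∑ z, 4 * (∑ j, ∑ k, H z j k * (g z j * g z k)) * w z ^ 2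
        = ∑ j, ∑ k, ∑ z, 4 * (H z j k * g z j * g z k) * w z ^ 2 := by
      simp only [mul_sum, sum_mul]
      rw [sum_comm]
      refine sum_congr rfl fun j _ => ?_
      rw [sum_comm]
      refine sum_congr rfl fun k _ => sum_congr rfl fun z _ => by ring
    have x3 : (4 * n ^ 2 * σ ^ 2 * W + 4 * n * Γ)
        = ∑ j, ∑ k, ∑ z, YY σ (w z) (w (z + e j)) (w (z + e k)) (w (z + e j + e k)) := by
      simp only [sumYY, sum_add_distrib, sum_const, card_univ, nsmul_eq_mul, ← mul_sum, ← hn,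
        ← hW, ← hΓ]
      ring
    rw [x1, x2, x3]
    simp only [mul_sum, ← sum_add_distrib, ← sum_sub_distrib]
    exact sum_congr rfl fun j _ => sum_congr rfl fun k _ => sum_congr rfl fun z _ => by ring
  -- convexity
  have A3 : ∑ z, -((t z - m) * ∑ j, ((w (z + e j) - w z) ^ 2 + (w z - w (z - e j)) ^ 2))
      ≤ ∑ z, ∑ j, ∑ k, H z j k * ((w (z + e j) - w (z - e j)) * (w (z + e k) - w (z - e k))) := by
    refine sum_le_sum fun z _ => ?_
    by_cases hz : z ∈ B
    · have p := (hB z hz).P1 (fun j => w (z + e j) - w (z - e j))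
      have tl := (hB z hz).t_lo
      have : ∑ j, (w (z + e j) - w (z - e j)) ^ 2
          ≤ 2 * ∑ j, ((w (z + e j) - w z) ^ 2 + (w z - w (z - e j)) ^ 2) := by
        rw [mul_sum]
        refine sum_le_sum fun j _ => ?_
        exact cc5 _ _ _
      have h2 := mul_le_mul_of_nonneg_left this (show 0 ≤ (t z - m) / 2 by linarith)
      linarith
    · obtain ⟨h0, h1, h2⟩ := hw z hz
      simp [h0, h1]
  have A4 : ∑ z, -((t z - m) * ∑ j, ((w (z + e j) - w z) ^ 2 + (w z - w (z - e j)) ^ 2))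
      = 2 * m * Γ - ∑ j, ∑ z, (t z + t (z + e j)) * (w (z + e j) - w z) ^ 2 := by
    have y : ∀ j, ∑ z, (t z - m) * (w z - w (z - e j)) ^ 2
        = ∑ z, (t (z + e j) - m) * (w (z + e j) - w z) ^ 2 := by
      intro j
      rw [← shift _ (e j)]
      simp only [add_sub_cancel_right]
    have : ∑ z, -((t z - m) * ∑ j, ((w (z + e j) - w z) ^ 2 + (w z - w (z - e j)) ^ 2))
        = -(∑ j, (∑ z, (t z - m) * (w (z + e j) - w z) ^ 2 + ∑ z, (t z - m) * (w z - w (z - e j)) ^ 2)) := by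
      rw [sum_neg_distrib]
      congr 1
      simp only [mul_sum]
      rw [sum_comm]
      refine sum_congr rfl fun j _ => ?_
      rw [← sum_add_distrib]
      exact sum_congr rfl fun z _ => by ring
    rw [this]
    simp only [y]
    rw [hΓ, mul_sum, ← sum_sub_distrib, ← sum_neg_distrib]
    refine sum_congr rfl fun j _ => ?_
    rw [mul_sum, ← sum_sub_distrib, ← sum_add_distrib, ← sum_neg_distrib]
    exact sum_congr rfl fun z _ => by ring
  -- multiplier
  have A5 : ∑ j, ∑ z, (t z + t (z + e j)) * (w (z + e j) - w z) ^ 2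
      ≤ ∑ j, ∑ z, (t z + t (z + e j)) * Real.cosh (φ (z + e j) - φ z) * (w (z + e j) - w z) ^ 2 := by
    refine sum_le_sum fun j _ => sum_le_sum fun z _ => ?_
    by_cases hz : z ∈ B
    · have tl := (hB z hz).t_lo
      have tp := (abs_le.1 ((hB z hz).tp j)).1
      have : K * h ≤ K * κ := by gcongr
      have : 0 ≤ t z + t (z + e j) := by linarith
      have := le_mul_of_one_le_right this (Real.one_le_cosh (φ (z + e j) - φ z))
      gcongr
    · obtain ⟨h0, h1, h2⟩ := hw z hz
      simp [h0, h1]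
  have A6 : ∑ j, ∑ z, w z ^ 2 * ((t z + t (z + e j)) * Real.cosh (φ (z + e j) - φ z)
          + (t z + t (z - e j)) * Real.cosh (φ (z - e j) - φ z) - 4 * t z)
      ≤ σ ^ 2 * ∑ z, (2 * t z * ∑ j, g z j ^ 2) * w z ^ 2 + 1000 * K ^ 4 * κ * σ ^ 2 * n * W := by
    have x : σ ^ 2 * ∑ z, (2 * t z * ∑ j, g z j ^ 2) * w z ^ 2 + 1000 * K ^ 4 * κ * σ ^ 2 * n * W
        = ∑ j, ∑ z, (2 * σ ^ 2 * g z j ^ 2 * t z + 1000 * K ^ 4 * κ * σ ^ 2) * w z ^ 2 := by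
      simp only [add_mul, sum_add_distrib, ← mul_sum, ← hW, sum_const, card_univ, nsmul_eq_mul, ← hn]
      congr 1
      · rw [sum_comm, mul_sum]
        refine sum_congr rfl fun z _ => ?_
        rw [mul_sum, sum_mul, mul_sum]
        exact sum_congr rfl fun j _ => by ring
      · ring
    rw [x]
    refine sum_le_sum fun j _ => sum_le_sum fun z _ => ?_
    by_cases hz : z ∈ B
    · have hz' := hB z hz
      have r := R3 hK hσ hh hσκ hκ hhσ (t0 := t z)
        (abs_le.2 ⟨by linarith [hz'.t_lo], hz'.t_hi⟩) (hz'.tp j) (hz'.tm j) (hz'.t2 j) (hz'.g_le j)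
        (hz'.φp j) (hz'.φm j)
      rw [mul_comm]
      have := (abs_le.1 r).2
      gcongr
      linarith
    · obtain ⟨h0, h1, h2⟩ := hw z hz
      simp [h0]
  have A7 : -(2 * K * ρ * σ ^ 2 * W) ≤ ∑ z, 2 * t z * q z * w z ^ 2 := by
    rw [hW, mul_sum, ← sum_neg_distrib]
    refine sum_le_sum fun z _ => ?_
    by_cases hz : z ∈ B
    · have hz' := hB z hz
      have : |t z * q z| ≤ K * (ρ * σ ^ 2) := by
        rw [abs_mul, abs_of_nonneg (by linarith [hz'.t_lo])]
        have := hz'.t_hi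
        have := hz'.q0
        gcongr
      have := mul_le_mul_of_nonneg_right (abs_le.1 this).1 (sq_nonneg (w z))
      linear_combination 2 * this
    · simp [(hw z hz).1]
  have A8 : -(8 * K * ρ * σ ^ 3 * h * n * W) ≤ ∑ j, ∑ z, 2 * (q z - q (z + e j)) *
      Real.sinh (φ (z + e j) - φ z) * (w z * w (z + e j)) := by
    have x : 8 * K * ρ * σ ^ 3 * h * n * W
        = ∑ j : ι, ∑ z, 4 * K * ρ * σ ^ 3 * h * (w z ^ 2 + w (z + e j) ^ 2) := by
      have s1 := fun a => shift (fun z => w z ^ 2) a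
      simp only [← mul_sum, sum_add_distrib, s1, ← hW, sum_const, card_univ, nsmul_eq_mul, ← hn]
      ring
    rw [x, ← sum_neg_distrib]
    refine sum_le_sum fun j _ => ?_
    rw [← sum_neg_distrib]
    refine sum_le_sum fun z _ => ?_
    by_cases hz : z ∈ B
    · have hz' := hB z hz
      have d : |φ (z + e j) - φ z| ≤ 2 * K * σ := cc4 hK0 hσ hh1 (hz'.φp j) (hz'.g_le j)
      have d1 : |φ (z + e j) - φ z| ≤ 1 := d.trans hKσ
      have s := sinh_abs_le d1
      have q1 := hz'.q1 j
      rw [abs_sub_comm] at q1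
      have ww : |w z * w (z + e j)| ≤ (w z ^ 2 + w (z + e j) ^ 2) / 2 := cc6 _ _
      have : |2 * (q z - q (z + e j)) * Real.sinh (φ (z + e j) - φ z) * (w z * w (z + e j))|
          ≤ 2 * (ρ * σ ^ 2 * h) * (2 * (2 * K * σ)) * ((w z ^ 2 + w (z + e j) ^ 2) / 2) := by
        rw [abs_mul, abs_mul, abs_mul, abs_two]
        have s' := s.trans (mul_le_mul_of_nonneg_left d (by norm_num : (0:ℝ) ≤ 2))
        gcongr
      have := (abs_le.1 this).1
      linarith
    · obtain ⟨h0, h1, h2⟩ := hw z hz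
      simp [h0, h1]
  have A9 : m * W ≤ ∑ z, (4 * (∑ j, ∑ k, H z j k * (g z j * g z k)) * w z ^ 2
      - (2 * t z * ∑ j, g z j ^ 2) * w z ^ 2) := by
    rw [hW, mul_sum]
    refine sum_le_sum fun z _ => ?_
    by_cases hz : z ∈ B
    · have := mul_le_mul_of_nonneg_right (hB z hz).P2 (sq_nonneg (w z))
      linarith
    · simp [(hw z hz).1]
  rw [sum_sub_distrib] at A9
  rw [split, I1, I2]
  set X1 := ∑ z, 4 * (∑ j, ∑ k, H z j k * (g z j * g z k)) * w z ^ 2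
  set X2 := ∑ z, (2 * t z * ∑ j, g z j ^ 2) * w z ^ 2
  set X3 := ∑ z, ∑ j, ∑ k, H z j k * ((w (z + e j) - w (z - e j)) * (w (z + e k) - w (z - e k)))
  rw [A2] at A1
  rw [A4] at A3
  have hsh : 0 < σ * h := mul_pos hσ hh
  set X4 := ∑ j, ∑ z, (t z + t (z + e j)) * (w (z + e j) - w z) ^ 2
  have B1 : X4 - (σ ^ 2 * X2 + 1000 * K ^ 4 * κ * σ ^ 2 * n * W) - 2 * K * ρ * σ ^ 2 * W ≤
    ∑ j, ∑ z, (t z + t (z + e j)) * Real.cosh (φ (z + e j) - φ z) * (w (z + e j) - w z) ^ 2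
        - ∑ j, ∑ z, w z ^ 2 * ((t z + t (z + e j)) * Real.cosh (φ (z + e j) - φ z)
          + (t z + t (z - e j)) * Real.cosh (φ (z - e j) - φ z) - 4 * t z)
        + ∑ z, 2 * t z * q z * w z ^ 2 := by linarith
  have B2 := mul_le_mul_of_nonneg_left B1 hsh.le
  have B3 := mul_le_mul_of_nonneg_left A3 hsh.le
  have B4 := mul_le_mul_of_nonneg_left A9 (show 0 ≤ σ * h * σ ^ 2 by positivity)
  -- smallness
  have Z : 0 ≤ K ^ 4 * κ := by positivity
  have c0 : 20000 * (n + 1) ^ 2 * (K ^ 4 * κ) ≤ m := by rw [← mul_assoc]; exact hκm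
  have c1 := cc1 hn0 Z c0
  have c2 := cc2 (K := K) (ρ := ρ) hn0 Z c0 (by gcongr)
  have D1 := mul_le_mul_of_nonneg_right c1 (show 0 ≤ σ * h * Γ by positivity)
  have D2 := mul_le_mul_of_nonneg_right c2 (show 0 ≤ σ ^ 3 * h * W by positivity)
  refine le_trans ?_ (add_le_add (add_le_add A1 A8) B2)
  linear_combination B3 + B4 + D1 + D2

end grp
end Carl

namespace Carl
open Finset

section torus
variable {ι : Type*} [Fintype ι] [DecidableEq ι]

/-- lattice basis vector -/
def eZ (j : ι) : ι → ℤ := Pi.single j 1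

/-- box of lattice points -/
def boxZ (ι : Type*) [Fintype ι] [DecidableEq ι] (Q : ℕ) : Finset (ι → ℤ) :=
  Fintype.piFinset fun _ => Finset.Icc (-(Q : ℤ)) Q

lemma mem_boxZ {Q : ℕ} {z : ι → ℤ} : z ∈ boxZ ι Q ↔ ∀ i, |z i| ≤ Q := by
  simp [boxZ, abs_le]

lemma eZ_abs (j i : ι) : |eZ j i| ≤ 1 := by
  by_cases h : i = j
  · subst h; simp [eZ]
  · simp [eZ, h]

/-- representative -/
def rep {N : ℕ} (z : ι → ZMod N) : ι → ℤ := fun i => (z i).valMinAbs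
/-- reduction -/
def red (N : ℕ) (y : ι → ℤ) : ι → ZMod N := fun i => (y i : ZMod N)

lemma red_rep {N : ℕ} (z : ι → ZMod N) : red N (rep z) = z := by
  funext i; simp [red, rep]

lemma rep_red {Q N : ℕ} [NeZero N] (hN : 2 * Q + 10 ≤ N) {y : ι → ℤ} (hy : ∀ i, |y i| ≤ Q + 2) :
    rep (red N y) = y := by
  funext i
  simp only [rep, red]
  refine (ZMod.valMinAbs_spec _ _).2 ⟨rfl, ?_⟩
  have := abs_le.1 (hy i)
  constructor <;> omega

lemma red_add (N : ℕ) (y u : ι → ℤ) : red N (y + u) = red N y + red N u := by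
  funext i; simp [red]
lemma red_sub (N : ℕ) (y u : ι → ℤ) : red N (y - u) = red N y - red N u := by
  funext i; simp [red]

theorem carlemanZ (φ q t w : (ι → ℤ) → ℝ) (g : (ι → ℤ) → ι → ℝ) (H : (ι → ℤ) → ι → ι → ℝ)
    {K m ρ σ h κ : ℝ} (hK : 1 ≤ K) (hm : 0 < m) (hσ : 0 < σ) (hh : 0 < h) (hσκ : σ ≤ κ)
    (hκ : 8 * K * κ ≤ 1) (hhσ : h ≤ κ * σ) (hρ0 : 0 ≤ ρ) (hρ : ρ ≤ κ)
    (hκm : 20000 * ((Fintype.card ι : ℝ) + 1) ^ 2 * K ^ 4 * κ ≤ m)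
    (B : Set (ι → ℤ)) (Q : ℕ) (hBQ : ∀ z ∈ B, ∀ i, |z i| ≤ Q)
    (hB : ∀ z ∈ B, WHyp eZ φ q t g H K m ρ σ h z)
    (hw : ∀ z, z ∉ B → w z = 0 ∧ (∀ j, w (z + eZ j) = 0 ∧ w (z - eZ j) = 0)
      ∧ ∀ j k, w (z + eZ j + eZ k) = 0) :
    m / 2 * σ ^ 3 * h * ∑ z ∈ boxZ ι Q, w z ^ 2
      ≤ ∑ z ∈ boxZ ι Q, 2 * opS eZ φ q w z * (opA eZ φ w z - σ * h * t z * w z) := by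
  set N := 2 * Q + 10 with hN
  have : NeZero N := ⟨by omega⟩
  let e' : ι → (ι → ZMod N) := fun j => red N (eZ j)
  have hwB : ∀ y, w y ≠ 0 → y ∈ B := fun y hy => by
    by_contra hc; exact hy (hw y hc).1
  have ev : ∀ (z : ι → ZMod N) (u : ι → ℤ), (∀ i, |rep z i| ≤ Q) → (∀ i, |u i| ≤ 2) →
      rep (z + red N u) = rep z + u := by
    intro z u hz hu
    conv_lhs => rw [← red_rep z, ← red_add]
    exact rep_red hN.ge fun i => (abs_add_le _ _).trans (by linarith [hz i, hu i])
  have evm : ∀ (z : ι → ZMod N) (u : ι → ℤ), (∀ i, |rep z i| ≤ Q) → (∀ i, |u i| ≤ 2) →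
      rep (z - red N u) = rep z - u := by
    intro z u hz hu
    conv_lhs => rw [← red_rep z, ← red_sub]
    exact rep_red hN.ge fun i => (abs_sub _ _).trans (by linarith [hz i, hu i])
  have he1 : ∀ j i, |eZ (ι := ι) j i| ≤ 2 := fun j i => (eZ_abs j i).trans (by norm_num)
  have he2 : ∀ (j k i : ι), |(eZ j + eZ k : ι → ℤ) i| ≤ 2 := fun j k i =>
    (abs_add_le _ _).trans (by linarith [eZ_abs (ι := ι) j i, eZ_abs (ι := ι) k i])
  have rp : ∀ z : ι → ZMod N, rep z ∈ B → ∀ j, rep (z + e' j) = rep z + eZ j := fun z hz j =>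
    ev z _ (hBQ _ hz) (he1 j)
  have rm : ∀ z : ι → ZMod N, rep z ∈ B → ∀ j, rep (z - e' j) = rep z - eZ j := fun z hz j =>
    evm z _ (hBQ _ hz) (he1 j)
  have rpp : ∀ z : ι → ZMod N, rep z ∈ B → ∀ j k,
      rep (z + e' j + e' k) = rep z + eZ j + eZ k := fun z hz j k => by
    have := ev z _ (hBQ _ hz) (he2 j k)
    rw [red_add] at this
    rw [add_assoc, this, add_assoc]
  -- vanishing
  have van : ∀ z : ι → ZMod N, rep z ∉ B → w (rep z) = 0 ∧
      (∀ j, w (rep (z + e' j)) = 0 ∧ w (rep (z - e' j)) = 0)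
      ∧ ∀ j k, w (rep (z + e' j + e' k)) = 0 := by
    intro z hz
    obtain ⟨h0, h1, h2⟩ := hw _ hz
    refine ⟨h0, fun j => ⟨?_, ?_⟩, fun j k => ?_⟩
    · by_contra hc
      have hb := hwB _ hc
      have := rm _ hb j
      rw [add_sub_cancel_right] at this
      apply hc
      have e : rep (z + e' j) = rep z + eZ j := by rw [this]; abel
      rw [e]; exact (h1 j).1
    · by_contra hc
      have hb := hwB _ hc
      have := rp _ hb j
      rw [sub_add_cancel] at this
      apply hc
      have e : rep (z - e' j) = rep z - eZ j := by rw [this]; abel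
      rw [e]; exact (h1 j).2
    · by_contra hc
      have hb := hwB _ hc
      have := evm _ _ (hBQ _ hb) (he2 j k)
      rw [red_add] at this
      have e0 : z + e' j + e' k - (red N (eZ j) + red N (eZ k)) = z := by
        change z + red N (eZ j) + red N (eZ k) - (red N (eZ j) + red N (eZ k)) = z
        abel
      rw [e0] at this
      apply hc
      have e : rep (z + e' j + e' k) = rep z + eZ j + eZ k := by rw [this]; abel
      rw [e]; exact h2 j k
  have main := carleman e' (fun z => φ (rep z)) (fun z => q (rep z)) (fun z => t (rep z))
    (fun z => w (rep z)) (fun z => g (rep z)) (fun z => H (rep z)) hK hm hσ hh hσκ hκ hhσ hρ0 hρ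
    hκm {z | rep z ∈ B} (by
      intro z hz
      have hz : rep z ∈ B := hz
      obtain ⟨a1, a2, a3, a4, a5, a6, a7, a8, a9, a10, a11, a12, a13, a14, a15, a16, a17⟩ := hB _ hz
      refine ⟨a1, ?_, ?_, ?_, ?_, a6, ?_, ?_, a9, a10, ?_, ?_, ?_, a14, a15, a16, ?_⟩
      · intro j; rw [rp z hz j]; exact a2 j
      · intro j; rw [rm z hz j]; exact a3 j
      · intro j k; rw [rpp z hz j k]; exact a4 j k
      · intro j k; have := a5 j k; unfold d2 at this ⊢; beta_reduce; rw [rpp z hz j k, rp z hz, rp z hz]; exact this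
      · intro j k l; rw [rp z hz l]; exact a7 j k l
      · intro j k; rw [rpp z hz j k, rp z hz, rp z hz]; exact a8 j k
      · intro j; rw [rp z hz j]; exact a11 j
      · intro j; rw [rm z hz j]; exact a12 j
      · intro j; rw [rp z hz, rm z hz]; exact a13 j
      · intro j; rw [rp z hz j]; exact a17 j) van
  have tr : ∀ (F : (ι → ZMod N) → ℝ) (F' : (ι → ℤ) → ℝ), (∀ z, rep z ∈ B → F z = F' (rep z)) →
      (∀ z, rep z ∉ B → F z = 0) → (∀ y, y ∉ B → F' y = 0) → ∑ z, F z = ∑ y ∈ boxZ ι Q, F' y := by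
    intro F F' h1 h2 h3
    have : ∑ z, F z = ∑ z ∈ univ.filter (fun z : ι → ZMod N => rep z ∈ boxZ ι Q), F z := by
      symm
      refine sum_subset (subset_univ _) fun z _ hz => h2 z fun hb => hz ?_
      simp only [mem_filter, mem_univ, true_and, mem_boxZ]
      exact hBQ _ hb
    rw [this]
    refine sum_nbij' rep (red N) ?_ ?_ ?_ ?_ ?_
    · intro z hz; simpa using hz
    · intro y hy
      have hy' := mem_boxZ.1 hy
      simp only [mem_filter, mem_univ, true_and]
      rwa [rep_red hN.ge fun i => by linarith [hy' i]]
    · intro z _; exact red_rep z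
    · intro y hy
      have hy' := mem_boxZ.1 hy
      exact rep_red hN.ge fun i => by linarith [hy' i]
    · intro z _
      by_cases hb : rep z ∈ B
      · exact h1 z hb
      · rw [h2 z hb, h3 _ hb]
  rw [tr (fun z => w (rep z) ^ 2) (fun y => w y ^ 2) (fun _ _ => rfl)
    (fun z hz => by simp [(van z hz).1]) (fun y hy => by simp [(hw y hy).1])] at main
  rw [tr _ (fun y => 2 * opS eZ φ q w y * (opA eZ φ w y - σ * h * t y * w y))] at main
  · exact main
  · intro z hz
    simp only [opS, opA, rp z hz, rm z hz]
  · intro z hz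
    obtain ⟨h0, h1, h2⟩ := van z hz
    simp [opS, h0, h1]
  · intro y hy
    obtain ⟨h0, h1, h2⟩ := hw y hy
    simp [opS, h0, h1]

end torus
end Carl

namespace Carl
open Finset

section taylor
variable {ι : Type*} [Fintype ι] [DecidableEq ι]

/-- partial derivative -/
def pd (j : ι) (F : (ι → ℝ) → ℝ) (x : ι → ℝ) : ℝ := fderiv ℝ F x (Pi.single j 1)

/-- increment vector -/
def inc (s : ℝ) (j : ι) : ι → ℝ := Pi.single j s

/-- smooth -/
abbrev Smo (F : (ι → ℝ) → ℝ) : Prop := ContDiff ℝ (⊤ : ℕ∞) F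

lemma inc_norm (s : ℝ) (j : ι) : ‖inc s j‖ = |s| := by
  rw [inc, Pi.norm_single, Real.norm_eq_abs]

lemma inc_zero (j : ι) : inc 0 j = 0 := by simp [inc]

lemma smo_pd {F : (ι → ℝ) → ℝ} (hF : Smo F) (j : ι) : Smo (pd j F) := by
  have : Smo (fun x => fderiv ℝ F x (Pi.single j 1)) :=
    (hF.fderiv_right (m := (⊤ : ℕ∞)) (by simp)).clm_apply contDiff_const
  exact this

lemma hasd {F : (ι → ℝ) → ℝ} (hF : Smo F) (x : ι → ℝ) (j : ι) (s : ℝ) :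
    HasDerivAt (fun s => F (x + inc s j)) (pd j F (x + inc s j)) s := by
  have h1 : HasFDerivAt F (fderiv ℝ F (x + inc s j)) (x + inc s j) :=
    (hF.differentiable (by simp) _).hasFDerivAt
  have h2 : HasDerivAt (fun s : ℝ => x + inc s j) (Pi.single j (1:ℝ)) s := by
    have e : (fun s : ℝ => x + inc s j) = fun s : ℝ => x + s • (Pi.single j (1:ℝ) : ι → ℝ) := by
      funext s; simp [inc, ← Pi.single_smul]
    rw [e]
    have := ((hasDerivAt_id s).smul_const (Pi.single j (1:ℝ) : ι → ℝ)).const_add x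
    simpa using this
  exact h1.comp_hasDerivAt s h2

lemma mvt {f f' : ℝ → ℝ} {C a : ℝ} (h : ∀ s, |s| ≤ |a| → HasDerivAt f (f' s) s)
    (hC : ∀ s, |s| ≤ |a| → |f' s| ≤ C) : |f a - f 0| ≤ C * |a| := by
  have := (convex_Icc (-|a|) |a|).norm_image_sub_le_of_norm_hasDerivWithin_le (f := f) (f' := f')
    (C := C) (x := 0) (y := a) (fun s hs => (h s (abs_le.2 hs)).hasDerivWithinAt)
    (fun s hs => hC s (abs_le.2 hs)) ⟨by simp, by simp⟩ (abs_le.1 le_rfl)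
  simpa using this

lemma bddF {F : (ι → ℝ) → ℝ} (hF : Continuous F) (R : ℝ) : ∃ K, 0 ≤ K ∧ ∀ x, ‖x‖ ≤ R → |F x| ≤ K := by
  obtain ⟨K, hK⟩ := (isCompact_closedBall (0 : ι → ℝ) R).exists_bound_of_continuousOn hF.continuousOn
  exact ⟨max K 0, le_max_right _ _, fun x hx => (hK x (by simpa using hx)).trans (le_max_left _ _)⟩

lemma unif {α : Type*} [Fintype α] {P : α → ℝ → Prop} (hP : ∀ a, ∃ K, 0 ≤ K ∧ ∀ K', K ≤ K' → P a K') :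
    ∃ K, 0 ≤ K ∧ ∀ a, ∀ K', K ≤ K' → P a K' := by
  choose K h0 h using hP
  refine ⟨∑ a, K a, sum_nonneg fun a _ => h0 a, fun a K' hK' => h a K' (le_trans ?_ hK')⟩
  exact single_le_sum (f := K) (fun a _ => h0 a) (mem_univ a)

lemma nb {x : ι → ℝ} {R s : ℝ} (j : ι) (hx : ‖x‖ ≤ R) (hs : |s| ≤ 1) : ‖x + inc s j‖ ≤ R + 1 :=
  (norm_add_le _ _).trans (by rw [inc_norm]; linarith)

lemma T1 {F : (ι → ℝ) → ℝ} (hF : Smo F) (R : ℝ) : ∃ K, 0 ≤ K ∧ ∀ K', K ≤ K' →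
    ∀ j x, ‖x‖ ≤ R → ∀ s, |s| ≤ 1 → |F (x + inc s j) - F x| ≤ K' * |s| := by
  have := unif (α := ι) (P := fun j K' => ∀ x, ‖x‖ ≤ R → ∀ s, |s| ≤ 1 →
    |F (x + inc s j) - F x| ≤ K' * |s|) (fun j => by
      obtain ⟨K, h0, hK⟩ := bddF (smo_pd hF j).continuous (R + 1)
      refine ⟨K, h0, fun K' hK' x hx s hs => ?_⟩
      have := mvt (f := fun s => F (x + inc s j)) (a := s) (C := K') (fun s' _ => hasd hF x j s')
        (fun s' hs' => (hK _ (nb j hx (hs'.trans hs))).trans hK')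
      simpa [inc_zero] using this)
  obtain ⟨K, h0, h⟩ := this
  exact ⟨K, h0, fun K' hK' j => h j K' hK'⟩

lemma T2 {F : (ι → ℝ) → ℝ} (hF : Smo F) (R : ℝ) : ∃ K, 0 ≤ K ∧ ∀ K', K ≤ K' →
    ∀ j x, ‖x‖ ≤ R → ∀ s, |s| ≤ 1 → |F (x + inc s j) - F x - s * pd j F x| ≤ K' * s ^ 2 := by
  have := unif (α := ι) (P := fun j K' => ∀ x, ‖x‖ ≤ R → ∀ s, |s| ≤ 1 →
    |F (x + inc s j) - F x - s * pd j F x| ≤ K' * s ^ 2) (fun j => by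
      obtain ⟨K, h0, hK⟩ := T1 (smo_pd hF j) R
      refine ⟨K, h0, fun K' hK' x hx s hs => ?_⟩
      have := mvt (f := fun s => F (x + inc s j) - s * pd j F x)
        (f' := fun s => pd j F (x + inc s j) - 1 * pd j F x) (a := s) (C := K' * |s|)
        (fun s' _ => (hasd hF x j s').sub ((hasDerivAt_id s').mul_const _))
        (fun s' hs' => by
          rw [one_mul]
          refine (hK K' hK' j x hx s' (hs'.trans hs)).trans ?_
          have := h0.trans hK'
          gcongr)
      simp only [inc_zero, add_zero, zero_mul, sub_zero] at this
      rw [sub_right_comm, ← sq_abs s, sq, ← mul_assoc]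
      exact this)
  obtain ⟨K, h0, h⟩ := this
  exact ⟨K, h0, fun K' hK' j => h j K' hK'⟩

lemma T3 {F : (ι → ℝ) → ℝ} (hF : Smo F) (R : ℝ) : ∃ K, 0 ≤ K ∧ ∀ K', K ≤ K' →
    ∀ j k x, ‖x‖ ≤ R → ∀ s, |s| ≤ 1 →
      |F (x + inc s j + inc s k) + F x - F (x + inc s j) - F (x + inc s k)| ≤ K' * s ^ 2 := by
  have := unif (α := ι) (P := fun j K' => ∀ k x, ‖x‖ ≤ R → ∀ s, |s| ≤ 1 →
    |F (x + inc s j + inc s k) + F x - F (x + inc s j) - F (x + inc s k)| ≤ K' * s ^ 2) (fun j => by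
      obtain ⟨K, h0, hK⟩ := T1 (smo_pd hF j) (R + 1)
      refine ⟨K, h0, fun K' hK' k x hx s hs => ?_⟩
      have := mvt (f := fun s' => F (x + inc s k + inc s' j) - F (x + inc s' j))
        (f' := fun s' => pd j F (x + inc s k + inc s' j) - pd j F (x + inc s' j)) (a := s)
        (C := K' * |s|)
        (fun s' _ => (hasd hF _ j s').sub (hasd hF _ j s'))
        (fun s' hs' => by
          have := hK K' hK' k (x + inc s' j) (nb j hx (hs'.trans hs)) s hs
          rwa [add_right_comm] at this)
      simp only [inc_zero, add_zero] at this
      rw [add_right_comm x, ← sq_abs s, sq, ← mul_assoc]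
      refine le_trans (le_of_eq ?_) this
      congr 1; ring)
  obtain ⟨K, h0, h⟩ := this
  exact ⟨K, h0, fun K' hK' j => h j K' hK'⟩

lemma T4 {F : (ι → ℝ) → ℝ} (hF : Smo F) (R : ℝ) : ∃ K, 0 ≤ K ∧ ∀ K', K ≤ K' →
    ∀ j k x, ‖x‖ ≤ R → ∀ s, |s| ≤ 1 →
      |F (x + inc s j + inc s k) + F x - F (x + inc s j) - F (x + inc s k)
        - s ^ 2 * pd k (pd j F) x| ≤ K' * |s| ^ 3 := by
  have := unif (α := ι × ι) (P := fun jk K' => ∀ x, ‖x‖ ≤ R → ∀ s, |s| ≤ 1 →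
    |F (x + inc s jk.1 + inc s jk.2) + F x - F (x + inc s jk.1) - F (x + inc s jk.2)
      - s ^ 2 * pd jk.2 (pd jk.1 F) x| ≤ K' * |s| ^ 3) (fun jk => by
      obtain ⟨j, k⟩ := jk
      obtain ⟨K, h0, hK⟩ := T2 (smo_pd hF j) (R + 1)
      obtain ⟨K2, h02, hK2⟩ := T1 (smo_pd (smo_pd hF j) k) R
      refine ⟨K + K2, by positivity, fun K' hK' x hx s hs => ?_⟩
      have := mvt (f := fun s' => F (x + inc s k + inc s' j) - F (x + inc s' j)
          - s' * (s * pd k (pd j F) x))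
        (f' := fun s' => pd j F (x + inc s k + inc s' j) - pd j F (x + inc s' j)
          - 1 * (s * pd k (pd j F) x)) (a := s)
        (C := K' * |s| ^ 2)
        (fun s' _ => ((hasd hF _ j s').sub (hasd hF _ j s')).sub ((hasDerivAt_id s').mul_const _))
        (fun s' hs' => by
          have a := hK K le_rfl k (x + inc s' j) (nb j hx (hs'.trans hs)) s hs
          rw [add_right_comm] at a
          have b := hK2 K2 le_rfl j x hx s' (hs'.trans hs)
          have b' : |s * (pd k (pd j F) (x + inc s' j) - pd k (pd j F) x)| ≤ K2 * |s| ^ 2 := by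
            rw [abs_mul]
            calc _ ≤ |s| * (K2 * |s|) := by
                  gcongr; exact b.trans (by gcongr)
              _ = _ := by ring
          have e : pd j F (x + inc s k + inc s' j) - pd j F (x + inc s' j)
            - 1 * (s * pd k (pd j F) x) = (pd j F (x + inc s k + inc s' j) - pd j F (x + inc s' j)
              - s * pd k (pd j F) (x + inc s' j))
              + s * (pd k (pd j F) (x + inc s' j) - pd k (pd j F) x) := by ring
          rw [e]
          refine (abs_add_le _ _).trans ?_
          rw [← sq_abs s] at a
          calc _ ≤ K * |s| ^ 2 + K2 * |s| ^ 2 := add_le_add a b'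
            _ = (K + K2) * |s| ^ 2 := by ring
            _ ≤ _ := by gcongr)
      simp only [inc_zero, add_zero] at this
      rw [add_right_comm x]
      have e3 : K' * |s| ^ 3 = K' * |s| ^ 2 * |s| := by ring
      rw [e3]
      refine le_trans (le_of_eq ?_) this
      congr 1; ring)
  obtain ⟨K, h0, h⟩ := this
  exact ⟨K, h0, fun K' hK' j k => h (j, k) K' hK'⟩

end taylor
end Carl

namespace Carl
open Finset

section weight
variable {ι : Type*} [Fintype ι] [DecidableEq ι]

/-- exponential weight -/
def Ex (lam : ℝ) (ψ : (ι → ℝ) → ℝ) (x : ι → ℝ) : ℝ := Real.exp (lam * ψ x)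

lemma Ex_pos (lam : ℝ) (ψ : (ι → ℝ) → ℝ) (x : ι → ℝ) : 0 < Ex lam ψ x := Real.exp_pos _

lemma smo_Ex {ψ : (ι → ℝ) → ℝ} (hψ : Smo ψ) (lam : ℝ) : Smo (Ex lam ψ) := by
  have : Smo fun x => Real.exp (lam * ψ x) := (contDiff_const.mul hψ).exp
  exact this

lemma pd_of_hasd {F : (ι → ℝ) → ℝ} (hF : Smo F) {j : ι} {x : ι → ℝ} {c : ℝ}
    (h : HasDerivAt (fun s => F (x + inc s j)) c 0) : pd j F x = c := by
  have := (hasd hF x j 0).unique h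
  simpa [inc_zero] using this

lemma hasd0 {F : (ι → ℝ) → ℝ} (hF : Smo F) (j : ι) (x : ι → ℝ) :
    HasDerivAt (fun s => F (x + inc s j)) (pd j F x) 0 := by
  have := hasd hF x j 0
  simpa [inc_zero] using this

lemma pd_Ex {ψ : (ι → ℝ) → ℝ} (hψ : Smo ψ) (lam : ℝ) (j : ι) :
    pd j (Ex lam ψ) = fun x => lam * Ex lam ψ x * pd j ψ x := by
  funext x
  refine pd_of_hasd (smo_Ex hψ lam) ?_
  have := ((hasd0 hψ j x).const_mul lam).exp
  simp only [inc_zero, add_zero] at this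
  refine this.congr_deriv ?_
  simp only [Ex]; ring

lemma pd2_Ex {ψ : (ι → ℝ) → ℝ} (hψ : Smo ψ) (lam : ℝ) (j k : ι) (x : ι → ℝ) :
    pd k (pd j (Ex lam ψ)) x
      = lam * Ex lam ψ x * (pd k (pd j ψ) x + lam * pd j ψ x * pd k ψ x) := by
  refine pd_of_hasd (smo_pd (smo_Ex hψ lam) j) ?_
  rw [pd_Ex hψ]
  have h1 := hasd0 (smo_Ex hψ lam) k x
  rw [pd_Ex hψ] at h1
  have := (h1.const_mul lam).mul (hasd0 (smo_pd hψ j) k x)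
  simp only [inc_zero, add_zero] at this
  refine this.congr_deriv ?_
  ring

/-- lattice to space map -/
def xmap (h : ℝ) (o : ι → ℝ) (z : ι → ℤ) : ι → ℝ := fun i => h * (z i : ℝ) - o i

lemma xmap_add (h : ℝ) (o : ι → ℝ) (z : ι → ℤ) (j : ι) :
    xmap h o (z + eZ j) = xmap h o z + inc h j := by
  funext i
  by_cases hi : i = j
  · subst hi; simp [xmap, eZ, inc]; ring
  · simp [xmap, eZ, inc, hi]

lemma xmap_sub (h : ℝ) (o : ι → ℝ) (z : ι → ℤ) (j : ι) :
    xmap h o (z - eZ j) = xmap h o z + inc (-h) j := by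
  funext i
  by_cases hi : i = j
  · subst hi; simp [xmap, eZ, inc]; ring
  · simp [xmap, eZ, inc, hi]

lemma quad_bound {K1 : ℝ} (A : ι → ι → ℝ) (hA : ∀ j k, |A j k| ≤ K1)
    (ξ : ι → ℝ) : -(Fintype.card ι * K1 * ∑ j, ξ j ^ 2) ≤ ∑ j, ∑ k, A j k * (ξ j * ξ k) := by
  have h1 : ∑ j, ∑ k, -(K1 * ((ξ j ^ 2 + ξ k ^ 2) / 2)) ≤ ∑ j, ∑ k, A j k * (ξ j * ξ k) := by
    refine sum_le_sum fun j _ => sum_le_sum fun k _ => ?_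
    have a : |A j k * (ξ j * ξ k)| ≤ K1 * ((ξ j ^ 2 + ξ k ^ 2) / 2) := by
      rw [abs_mul]
      have := cc6 (ξ j) (ξ k)
      have := hA j k
      have : 0 ≤ K1 := (abs_nonneg _).trans this
      gcongr
    linarith [(abs_le.1 a).1]
  refine le_trans (le_of_eq ?_) h1
  simp only [sum_neg_distrib, ← mul_sum, ← sum_div, sum_add_distrib, sum_const, card_univ,
    nsmul_eq_mul]
  ring

lemma rank1 (a ξ : ι → ℝ) : ∑ j, ∑ k, (a j * a k) * (ξ j * ξ k) = (∑ j, a j * ξ j) ^ 2 := by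
  rw [sq, sum_mul_sum]
  exact sum_congr rfl fun j _ => sum_congr rfl fun k _ => by ring

theorem weight {ψ : (ι → ℝ) → ℝ} (hψ : Smo ψ) (R : ℝ) {g0 : ℝ} (hg0 : 0 < g0) :
    ∃ lam κ0 m K0 : ℝ, 1 ≤ lam ∧ 0 < κ0 ∧ 0 < m ∧ 1 ≤ K0 ∧ ∀ K, K0 ≤ K →
      ∀ (h τ : ℝ) (o : ι → ℝ) (q : (ι → ℤ) → ℝ) (ρ : ℝ) (z : ι → ℤ), 0 < h → h ≤ 1 → 0 < τ →
        ‖xmap h o z‖ ≤ R → g0 ≤ ∑ j, pd j ψ (xmap h o z) ^ 2 →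
        |q z| ≤ ρ * (τ * h) ^ 2 → (∀ j, |q (z + eZ j) - q z| ≤ ρ * (τ * h) ^ 2 * h) →
        WHyp eZ (fun z => τ * Ex lam ψ (xmap h o z)) q (fun z => κ0 * lam * Ex lam ψ (xmap h o z))
          (fun z j => pd j (Ex lam ψ) (xmap h o z)) (fun z j k => pd k (pd j (Ex lam ψ)) (xmap h o z))
          K m ρ (τ * h) h z := by
  set n : ℝ := (Fintype.card ι : ℝ) with hn
  have hn0 : 0 ≤ n := by positivity
  obtain ⟨K1, hK10, hK1⟩ := unif (α := ι × ι) (P := fun jk K' => ∀ x, ‖x‖ ≤ R →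
      |pd jk.2 (pd jk.1 ψ) x| ≤ K') (fun jk => by
    obtain ⟨K, h0, hK⟩ := bddF (smo_pd (smo_pd hψ jk.1) jk.2).continuous R
    exact ⟨K, h0, fun K' hK' x hx => (hK x hx).trans hK'⟩)
  obtain ⟨K2, hK20, hK2⟩ := bddF hψ.continuous R
  set κ0 : ℝ := 2 * n * K1 + 2 with hκ0
  have hκ0p : 0 < κ0 := by positivity
  set lam : ℝ := 1 + (4 * n * K1 + 2 * κ0 + 1) / (4 * g0) with hlam
  have hlam1 : 1 ≤ lam := by rw [hlam]; have : 0 ≤ (4 * n * K1 + 2 * κ0 + 1) / (4 * g0) := by positivity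
                             linarith
  have hlamg : 4 * n * K1 + 2 * κ0 + 1 ≤ 4 * lam * g0 := by
    rw [hlam]; field_simp; nlinarith
  set Φm : ℝ := Real.exp (-(lam * K2)) with hΦm
  have hΦm0 : 0 < Φm := Real.exp_pos _
  set Φ := Ex lam ψ with hΦ
  have hΦs : Smo Φ := smo_Ex hψ lam
  have hlow : ∀ x, ‖x‖ ≤ R → Φm ≤ Φ x := fun x hx => by
    rw [hΦm, hΦ, Ex]
    apply Real.exp_le_exp.2
    have := (abs_le.1 (hK2 x hx)).1
    nlinarith
  set m : ℝ := min Φm (Φm ^ 3 * g0) with hm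
  have hm0 : 0 < m := lt_min hΦm0 (by positivity)
  obtain ⟨Ka, ha0, ha⟩ := unif (α := ι) (P := fun j K' => ∀ x, ‖x‖ ≤ R →
      |pd j Φ x| ≤ K') (fun j => by
    obtain ⟨K, h0, hK⟩ := bddF (smo_pd hΦs j).continuous R
    exact ⟨K, h0, fun K' hK' x hx => (hK x hx).trans hK'⟩)
  obtain ⟨Kb, hb0, hb⟩ := T2 hΦs R
  obtain ⟨Kc, hc0, hc⟩ := T3 hΦs R
  obtain ⟨Kd, hd0, hd⟩ := T4 hΦs R
  obtain ⟨Ke, he0, he⟩ := unif (α := ι × ι) (P := fun jk K' => ∀ x, ‖x‖ ≤ R →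
      |pd jk.2 (pd jk.1 Φ) x| ≤ K') (fun jk => by
    obtain ⟨K, h0, hK⟩ := bddF (smo_pd (smo_pd hΦs jk.1) jk.2).continuous R
    exact ⟨K, h0, fun K' hK' x hx => (hK x hx).trans hK'⟩)
  obtain ⟨Kf, hf0, hf⟩ := unif (α := ι × ι) (P := fun jk K' => ∀ j x, ‖x‖ ≤ R → ∀ s, |s| ≤ 1 →
      |pd jk.2 (pd jk.1 Φ) (x + inc s j) - pd jk.2 (pd jk.1 Φ) x| ≤ K' * |s|) (fun jk =>
    T1 (smo_pd (smo_pd hΦs jk.1) jk.2) R)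
  obtain ⟨Kg, hg0', hg⟩ := unif (α := ι × ι) (P := fun jk K' => ∀ j k x, ‖x‖ ≤ R → ∀ s, |s| ≤ 1 →
      |pd jk.2 (pd jk.1 Φ) (x + inc s j + inc s k) + pd jk.2 (pd jk.1 Φ) x
        - pd jk.2 (pd jk.1 Φ) (x + inc s j) - pd jk.2 (pd jk.1 Φ) (x + inc s k)| ≤ K' * s ^ 2)
    (fun jk => T3 (smo_pd (smo_pd hΦs jk.1) jk.2) R)
  have hts : Smo (fun x => κ0 * lam * Φ x) := contDiff_const.mul hΦs
  obtain ⟨Kh, hh0, hh⟩ := bddF hts.continuous R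
  obtain ⟨Ki, hi0, hi⟩ := T1 hts R
  obtain ⟨Kj, hj0, hj⟩ := T2 hts R
  refine ⟨lam, κ0, m, 1 + Ka + 2 * Kb + Kc + Kd + Ke + Kf + Kg + Kh + Ki + 2 * Kj, hlam1, hκ0p, hm0,
    by linarith, ?_⟩
  intro K hK h τ o q ρ z hpos hh1 hτ hx hgr hq0 hq1
  set x := xmap h o z with hxdef
  have hha : |h| ≤ 1 := by rw [abs_of_pos hpos]; exact hh1
  have hhb : |-h| ≤ 1 := by rw [abs_neg]; exact hha
  have B2p := fun j => hb Kb le_rfl j x hx h hha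
  have B2m := fun j => hb Kb le_rfl j x hx (-h) hhb
  have Φx := Ex_pos lam ψ x
  have lowx := hlow x hx
  -- P1-type bound
  have Hform : ∀ ξ : ι → ℝ, ∑ j, ∑ k, pd k (pd j Φ) x * (ξ j * ξ k)
      = lam * Φ x * (∑ j, ∑ k, pd k (pd j ψ) x * (ξ j * ξ k) + lam * (∑ j, pd j ψ x * ξ j) ^ 2) := by
    intro ξ
    rw [← rank1, mul_add, mul_sum, mul_sum, mul_sum, ← sum_add_distrib]
    refine sum_congr rfl fun j _ => ?_
    rw [mul_sum, mul_sum, mul_sum, ← sum_add_distrib]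
    refine sum_congr rfl fun k _ => ?_
    rw [hΦ, pd2_Ex hψ]; ring
  have qb := fun ξ : ι → ℝ => quad_bound (fun j k => pd k (pd j ψ) x) (K1 := K1)
    (fun j k => hK1 (j, k) K1 le_rfl x hx) ξ
  have hlamΦ : 0 < lam * Φ x := by positivity
  refine ⟨?_, ?_, ?_, ?_, ?_, ?_, ?_, ?_, ?_, ?_, ?_, ?_, ?_, ?_, ?_, hq0, hq1⟩
  · intro j; exact ha j K (by linarith) x hx
  · intro j
    beta_reduce
    rw [xmap_add]
    have : τ * Φ (x + inc h j) - τ * Φ x - τ * h * pd j Φ x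
      = τ * (Φ (x + inc h j) - Φ x - h * pd j Φ x) := by ring
    rw [this, abs_mul, abs_of_pos hτ]
    calc _ ≤ τ * (Kb * h ^ 2) := by gcongr; exact B2p j
      _ ≤ τ * (K * h ^ 2) := by gcongr; linarith
      _ = _ := by ring
  · intro j
    beta_reduce
    rw [xmap_sub]
    have : τ * Φ (x + inc (-h) j) - τ * Φ x + τ * h * pd j Φ x
      = τ * (Φ (x + inc (-h) j) - Φ x - -h * pd j Φ x) := by ring
    rw [this, abs_mul, abs_of_pos hτ]
    calc _ ≤ τ * (Kb * (-h) ^ 2) := by gcongr; exact B2m j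
      _ ≤ τ * (K * (-h) ^ 2) := by gcongr; linarith
      _ = _ := by ring
  · intro j k
    beta_reduce
    rw [xmap_add, xmap_add]
    have : τ * Φ (x + inc h j + inc h k) - τ * Φ x - τ * h * (pd j Φ x + pd k Φ x)
      = τ * ((Φ (x + inc h j + inc h k) + Φ x - Φ (x + inc h j) - Φ (x + inc h k))
        + (Φ (x + inc h j) - Φ x - h * pd j Φ x) + (Φ (x + inc h k) - Φ x - h * pd k Φ x)) := by ring
    rw [this, abs_mul, abs_of_pos hτ]
    have c := hc Kc le_rfl j k x hx h hha
    calc _ ≤ τ * (Kc * h ^ 2 + Kb * h ^ 2 + Kb * h ^ 2) := by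
          gcongr
          exact (abs_add_three _ _ _).trans (add_le_add (add_le_add c (B2p j)) (B2p k))
      _ = τ * ((Kc + 2 * Kb) * h ^ 2) := by ring
      _ ≤ τ * ((2 * K) * h ^ 2) := by gcongr; linarith
      _ = _ := by ring
  · intro j k
    unfold d2
    beta_reduce
    rw [xmap_add, xmap_add, xmap_add]
    have : τ * Φ (x + inc h j + inc h k) + τ * Φ x - τ * Φ (x + inc h j) - τ * Φ (x + inc h k)
        - τ * h * h * pd k (pd j Φ) x
      = τ * (Φ (x + inc h j + inc h k) + Φ x - Φ (x + inc h j) - Φ (x + inc h k)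
          - h ^ 2 * pd k (pd j Φ) x) := by ring
    rw [this, abs_mul, abs_of_pos hτ]
    have c := hd Kd le_rfl j k x hx h hha
    rw [abs_of_pos hpos] at c
    calc _ ≤ τ * (Kd * h ^ 3) := by gcongr
      _ ≤ τ * (K * h ^ 3) := by gcongr; linarith
      _ = _ := by ring
  · intro j k; exact he (j, k) K (by linarith) x hx
  · intro j k l
    beta_reduce
    rw [xmap_add]
    have := hf (j, k) K (by linarith) l x hx h hha
    rwa [abs_of_pos hpos] at this
  · intro j k
    beta_reduce
    rw [xmap_add, xmap_add, xmap_add]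
    have := hg (j, k) K (by linarith) j k x hx h hha
    refine le_trans (le_of_eq ?_) this
    congr 1; ring
  · beta_reduce
    have : m ≤ Φm := min_le_left _ _
    have h2 : 1 ≤ κ0 := by rw [hκ0]; nlinarith
    calc m ≤ Φ x := this.trans lowx
      _ = 1 * 1 * Φ x := by ring
      _ ≤ κ0 * lam * Φ x := by gcongr
  · exact ((le_abs_self _).trans (hh x hx)).trans (by linarith)
  · intro j
    beta_reduce
    rw [xmap_add]
    have := hi K (by linarith) j x hx h hha
    rwa [abs_of_pos hpos] at this
  · intro j
    beta_reduce
    rw [xmap_sub]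
    have := hi K (by linarith) j x hx (-h) hhb
    rwa [abs_neg, abs_of_pos hpos] at this
  · intro j
    beta_reduce
    rw [xmap_add, xmap_sub]
    have a := hj Kj le_rfl j x hx h hha
    have b := hj Kj le_rfl j x hx (-h) hhb
    have : (2 * Kj) * h ^ 2 ≤ K * h ^ 2 := by gcongr; linarith
    rw [neg_sq] at b
    rw [abs_le] at a b ⊢
    constructor <;> linarith [a.1, a.2, b.1, b.2]
  · intro ξ
    change 0 ≤ ∑ j, ∑ k, pd k (pd j Φ) x * (ξ j * ξ k) + (κ0 * lam * Φ x - m) / 2 * ∑ j, ξ j ^ 2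
    rw [Hform]
    have q1 := qb ξ
    set S := ∑ j, ξ j ^ 2
    have hS : 0 ≤ S := sum_nonneg fun _ _ => sq_nonneg _
    set D := ∑ j, ∑ k, pd k (pd j ψ) x * (ξ j * ξ k)
    have h1 : -(n * K1 * S) ≤ D + lam * (∑ j, pd j ψ x * ξ j) ^ 2 := by
      have : 0 ≤ lam * (∑ j, pd j ψ x * ξ j) ^ 2 := by positivity
      linarith
    have h2 := mul_le_mul_of_nonneg_left h1 hlamΦ.le
    have h3 : m ≤ lam * Φ x := by
      calc m ≤ 1 * Φ x := by rw [one_mul]; exact (min_le_left _ _).trans lowx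
        _ ≤ _ := by gcongr
    have h4 := mul_le_mul_of_nonneg_right h3 hS
    have h5 : 0 ≤ lam * Φ x * S := by positivity
    rw [hκ0]
    linarith
  · change m ≤ 4 * ∑ j, ∑ k, pd k (pd j Φ) x * (pd j Φ x * pd k Φ x)
      - 2 * (κ0 * lam * Φ x) * ∑ j, pd j Φ x ^ 2
    rw [Hform]
    have q1 := qb (fun j => pd j ψ x)
    beta_reduce at q1
    have e0 : ∀ j, pd j Φ x = lam * Φ x * pd j ψ x := fun j => by rw [hΦ, pd_Ex hψ]
    set S := ∑ j, pd j ψ x ^ 2 with hS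
    have e1 : ∑ j, pd j Φ x ^ 2 = (lam * Φ x) ^ 2 * S := by
      rw [hS, mul_sum]; exact sum_congr rfl fun j _ => by rw [e0]; ring
    have e2 : ∑ j, pd j ψ x * pd j Φ x = lam * Φ x * S := by
      rw [hS, mul_sum]; exact sum_congr rfl fun j _ => by rw [e0]; ring
    set D := ∑ j, ∑ k, pd k (pd j ψ) x * (pd j ψ x * pd k ψ x) with hD
    have e3 : ∑ j, ∑ k, pd k (pd j ψ) x * (pd j Φ x * pd k Φ x) = (lam * Φ x) ^ 2 * D := by
      rw [hD, mul_sum]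
      refine sum_congr rfl fun j _ => ?_
      rw [mul_sum]
      exact sum_congr rfl fun k _ => by rw [e0, e0]; ring
    rw [e1, e2, e3]
    have h1 : 1 * g0 ≤ 4 * D + 4 * lam * S ^ 2 - 2 * κ0 * S := by
      have : 4 * lam * g0 * S ≤ 4 * lam * S * S := by gcongr
      have a := mul_le_mul_of_nonneg_right hlamg (hg0.le.trans hgr)
      linarith
    have h2 : Φm ^ 3 * 1 ≤ Φ x ^ 3 * lam ^ 3 := by
      gcongr
      exact one_le_pow₀ hlam1
    calc m ≤ Φm ^ 3 * g0 := min_le_right _ _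
      _ = (Φm ^ 3 * 1) * (1 * g0) := by ring
      _ ≤ (Φ x ^ 3 * lam ^ 3) * (4 * D + 4 * lam * S ^ 2 - 2 * κ0 * S) := by
          gcongr
      _ = _ := by ring

end weight
end Carl

namespace Carl
open Finset

section psi
variable {d : ℕ}

/-- the phase -/
def psi (d : ℕ) (ε r : ℝ) (X : Fin (d + 1) → ℝ) : ℝ :=
  -∑ i, X i ^ 2 + ε * X 0 * (∑ i : Fin d, X i.succ ^ 2 - r ^ 2)

lemma smo_psi (ε r : ℝ) : Smo (psi d ε r) := by
  unfold psi Smo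
  fun_prop

lemma hcoord {ι : Type*} [Fintype ι] [DecidableEq ι] (X : ι → ℝ) (j k : ι) (s : ℝ) :
    HasDerivAt (fun s => (X + inc s j) k) (if k = j then 1 else 0) s := by
  by_cases hk : k = j
  · subst hk
    simp only [inc, Pi.add_apply, Pi.single_eq_same, if_true]
    exact (hasDerivAt_id s).const_add _
  · simp only [inc, Pi.add_apply, hk, if_false, Pi.single_eq_of_ne hk, add_zero, ne_eq,
      not_false_eq_true]
    exact hasDerivAt_const _ _

lemma hpsi (ε r : ℝ) (X : Fin (d + 1) → ℝ) (j : Fin (d + 1)) :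
    pd j (psi d ε r) X = -∑ i, 2 * X i * (if i = j then 1 else 0)
      + (ε * (if (0 : Fin (d + 1)) = j then 1 else 0) * (∑ i : Fin d, X i.succ ^ 2 - r ^ 2)
        + ε * X 0 * ∑ i : Fin d, 2 * X i.succ * (if i.succ = j then 1 else 0)) := by
  refine pd_of_hasd (smo_psi ε r) ?_
  unfold psi
  have sq : ∀ k, HasDerivAt (fun s => (X + inc s j) k ^ 2) (2 * X k * (if k = j then 1 else 0)) 0 := by
    intro k
    have := (hcoord X j k 0).fun_pow 2
    simpa [inc_zero] using this
  have h1 := (HasDerivAt.fun_sum (u := univ) fun k _ => sq k).fun_neg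
  have h2 := (HasDerivAt.fun_sum (u := (univ : Finset (Fin d))) fun k _ => sq k.succ).sub_const (r ^ 2)
  have h3 := ((hcoord X j 0 0).const_mul ε).fun_mul h2
  have := h1.fun_add h3
  simpa [inc_zero] using this

lemma pd_psi_zero (ε r : ℝ) (X : Fin (d + 1) → ℝ) :
    pd 0 (psi d ε r) X = -2 * X 0 + ε * (∑ i : Fin d, X i.succ ^ 2 - r ^ 2) := by
  rw [hpsi]; simp [Fin.succ_ne_zero]

lemma pd_psi_succ (ε r : ℝ) (X : Fin (d + 1) → ℝ) (i : Fin d) :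
    pd i.succ (psi d ε r) X = -2 * X i.succ * (1 - ε * X 0) := by
  rw [hpsi]; simp [(Fin.succ_ne_zero _).symm]; ring

lemma grad_psi {r Rb : ℝ} (hr : 0 < r) (hRb : 1 ≤ Rb) (X : Fin (d + 1) → ℝ) (hX : ‖X‖ ≤ Rb)
    (h0 : -(1 / (2 * Rb) * r ^ 2 / 8) ≤ X 0) :
    min (r ^ 2 / 4) ((1 / (2 * Rb) * r ^ 2 / 2) ^ 2) ≤ ∑ j, pd j (psi d (1 / (2 * Rb)) r) X ^ 2 := by
  set ε := 1 / (2 * Rb) with hε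
  have hRb0 : 0 < Rb := by linarith
  have hε0 : 0 < ε := by positivity
  have hεR : ε * Rb = 1 / 2 := by rw [hε]; field_simp
  have hX0 : X 0 ≤ Rb := (le_abs_self _).trans ((norm_le_pi_norm X 0).trans hX)
  rw [Fin.sum_univ_succ, pd_psi_zero]
  simp only [pd_psi_succ]
  set T := ∑ i : Fin d, X i.succ ^ 2 with hT
  have hεX : ε * X 0 ≤ 1 / 2 := by rw [← hεR]; gcongr
  have hS : T ≤ ∑ i : Fin d, (-2 * X i.succ * (1 - ε * X 0)) ^ 2 := by
    refine sum_le_sum fun i _ => ?_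
    have : 1 ≤ 4 * (1 - ε * X 0) ^ 2 := by nlinarith
    calc X i.succ ^ 2 = X i.succ ^ 2 * 1 := by ring
      _ ≤ X i.succ ^ 2 * (4 * (1 - ε * X 0) ^ 2) := by gcongr
      _ = _ := by ring
  by_cases hc : r ^ 2 / 4 ≤ T
  · refine (min_le_left _ _).trans ?_
    nlinarith [sq_nonneg (-2 * X 0 + ε * (T - r ^ 2))]
  · push Not at hc
    refine (min_le_right _ _).trans ?_
    have hT0 : 0 ≤ T := sum_nonneg fun _ _ => sq_nonneg _
    have h1 : -2 * X 0 + ε * (T - r ^ 2) ≤ -(ε * r ^ 2 / 2) := by nlinarith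
    have h2 : 0 ≤ ε * r ^ 2 / 2 := by positivity
    nlinarith

lemma psi_out {r Rb : ℝ} (hr : 0 < r) (hRb : 1 ≤ Rb) (X : Fin (d + 1) → ℝ) (hX : ‖X‖ ≤ Rb)
    (h0 : 0 ≤ X 0) {a : ℝ} (ha : 0 ≤ a) (hXa : a ≤ ‖X‖) :
    psi d (1 / (2 * Rb)) r X ≤ -(a ^ 2 / 2) := by
  set ε := 1 / (2 * Rb) with hε
  have hRb0 : 0 < Rb := by linarith
  have hε0 : 0 < ε := by positivity
  have hεR : ε * Rb = 1 / 2 := by rw [hε]; field_simp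
  have hX0 : X 0 ≤ Rb := (le_abs_self _).trans ((norm_le_pi_norm X 0).trans hX)
  have hεX : ε * X 0 ≤ 1 / 2 := by rw [← hεR]; gcongr
  have hs : a ^ 2 ≤ ∑ i, X i ^ 2 := by
    have h0' : 0 ≤ ∑ i, X i ^ 2 := sum_nonneg fun _ _ => sq_nonneg _
    have : ‖X‖ ≤ Real.sqrt (∑ i, X i ^ 2) := by
      rw [pi_norm_le_iff_of_nonneg (Real.sqrt_nonneg _)]
      intro i
      rw [Real.norm_eq_abs]
      exact Real.abs_le_sqrt (single_le_sum (f := fun i => X i ^ 2) (fun _ _ => sq_nonneg _) (mem_univ i))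
    calc a ^ 2 ≤ Real.sqrt (∑ i, X i ^ 2) ^ 2 := by gcongr; exact hXa.trans this
      _ = _ := Real.sq_sqrt h0'
  have hT : ∑ i : Fin d, X i.succ ^ 2 ≤ ∑ i, X i ^ 2 := by
    rw [Fin.sum_univ_succ (fun i => X i ^ 2)]; nlinarith [sq_nonneg (X 0)]
  have hT0 : 0 ≤ ∑ i : Fin d, X i.succ ^ 2 := sum_nonneg fun _ _ => sq_nonneg _
  unfold psi
  have e0 : 0 ≤ ε * X 0 := by positivity
  nlinarith [sq_nonneg r, mul_nonneg e0 (sq_nonneg r)]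

lemma psi_in {r Rb L : ℝ} (hr : 0 < r) (hRb : 1 ≤ Rb) (hL : 0 < L) (X : Fin (d + 1) → ℝ)
    (h0 : 0 ≤ X 0) (h1 : X 0 ≤ 1) (hx : ∀ i : Fin d, |X i.succ| ≤ L) :
    -(d * L ^ 2 + 1 + r ^ 2) ≤ psi d (1 / (2 * Rb)) r X := by
  set ε := 1 / (2 * Rb) with hε
  have hε0 : 0 < ε := by positivity
  have hε1 : ε ≤ 1 := by rw [hε, div_le_one (by linarith)]; linarith
  have hT : ∑ i : Fin d, X i.succ ^ 2 ≤ d * L ^ 2 := by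
    calc _ ≤ ∑ i : Fin d, L ^ 2 := by
          refine sum_le_sum fun i _ => ?_
          rw [← sq_abs]; gcongr; exact hx i
      _ = _ := by simp
  have hT0 : 0 ≤ ∑ i : Fin d, X i.succ ^ 2 := sum_nonneg fun _ _ => sq_nonneg _
  unfold psi
  rw [Fin.sum_univ_succ (fun i => X i ^ 2)]
  have e0 : 0 ≤ ε * X 0 := by positivity
  have e1 : ε * X 0 ≤ 1 := by nlinarith
  have := mul_nonneg e0 hT0
  have := mul_le_mul_of_nonneg_right e1 (sq_nonneg r)
  nlinarith

end psi

lemma cutoff {ι : Type*} [Fintype ι] [DecidableEq ι] {a : ℝ} (ha : 0 < a) :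
    ∃ χ : (ι → ℝ) → ℝ, Smo χ ∧ (∀ x, 0 ≤ χ x ∧ χ x ≤ 1) ∧ (∀ x, ‖x‖ ≤ a → χ x = 1) ∧
      ∀ x, a + 1 ≤ ‖x‖ → χ x = 0 := by
  let f : ContDiffBump (0 : ι → ℝ) := ⟨a, a + 1, ha, by linarith⟩
  refine ⟨f, f.contDiff, fun x => ⟨f.nonneg, f.le_one⟩, fun x hx => ?_, fun x hx => ?_⟩
  · exact f.one_of_mem_closedBall (by simpa using hx)
  · exact f.zero_of_le_dist (by simpa using hx)

lemma conj_eq {ι : Type*} [Fintype ι] [DecidableEq ι] (φ q f : (ι → ℤ) → ℝ) (z : ι → ℤ) :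
    opS eZ φ q (fun z => Real.exp (φ z) * f z) z + opA eZ φ (fun z => Real.exp (φ z) * f z) z
      = Real.exp (φ z) * (∑ j, (f (z + eZ j) + f (z - eZ j) - 2 * f z) - q z * f z) := by
  have key : ∀ y, Real.cosh (φ y - φ z) * (Real.exp (φ y) * f y)
      - Real.sinh (φ y - φ z) * (Real.exp (φ y) * f y) = Real.exp (φ z) * f y := by
    intro y
    rw [← sub_mul, Real.cosh_sub_sinh, ← mul_assoc, ← Real.exp_add]
    congr 2; ring
  unfold opS opA
  rw [mul_sub, mul_sum, sub_add_eq_add_sub, ← sub_eq_add_neg, ← sum_sub_distrib]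
  congr 1
  · refine sum_congr rfl fun j _ => ?_
    linear_combination key (z + eZ j) + key (z - eZ j)
  · ring

lemma comm_eq {ι : Type*} [Fintype ι] [DecidableEq ι] (χ u : (ι → ℤ) → ℝ) (z : ι → ℤ) :
    ∑ j, (χ (z + eZ j) * u (z + eZ j) + χ (z - eZ j) * u (z - eZ j) - 2 * (χ z * u z))
      = χ z * ∑ j, (u (z + eZ j) + u (z - eZ j) - 2 * u z)
        + ∑ j, ((χ (z + eZ j) + χ (z - eZ j) - 2 * χ z) * u z
          + (χ (z + eZ j) - χ z) * (u (z + eZ j) - u z)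
          + (χ (z - eZ j) - χ z) * (u (z - eZ j) - u z)) := by
  rw [mul_sum, ← sum_add_distrib]
  exact sum_congr rfl fun j _ => by ring

lemma comm_bound {ι : Type*} [Fintype ι] [Nonempty ι] {K h u0 : ℝ} (hh : 0 < h)
    (c a b up um : ι → ℝ) (hc : ∀ j, |c j| ≤ K * h ^ 2) (ha : ∀ j, |a j| ≤ K * h)
    (hb : ∀ j, |b j| ≤ K * h) :
    (∑ j, (c j * u0 + a j * up j + b j * um j)) ^ 2
      ≤ 3 * (Fintype.card ι : ℝ) ^ 2 * K ^ 2 * h ^ 2 * (h ^ 2 * u0 ^ 2 + ∑ j, (up j ^ 2 + um j ^ 2)) := by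
  set n : ℝ := (Fintype.card ι : ℝ) with hn
  have hn1 : 1 ≤ n := by rw [hn]; exact_mod_cast Fintype.card_pos
  have s := sq_sum_le_card_mul_sum_sq (s := univ) (f := fun j => c j * u0 + a j * up j + b j * um j)
  rw [card_univ, ← hn] at s
  refine s.trans ?_
  have p : ∀ j, (c j * u0 + a j * up j + b j * um j) ^ 2
      ≤ 3 * K ^ 2 * h ^ 4 * u0 ^ 2 + 3 * K ^ 2 * h ^ 2 * (up j ^ 2 + um j ^ 2) := by
    intro j
    have c2 : c j ^ 2 ≤ (K * h ^ 2) ^ 2 := by rw [← sq_abs]; gcongr; exact hc j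
    have a2 : a j ^ 2 ≤ (K * h) ^ 2 := by rw [← sq_abs]; gcongr; exact ha j
    have b2 : b j ^ 2 ≤ (K * h) ^ 2 := by rw [← sq_abs]; gcongr; exact hb j
    have c3 := mul_le_mul_of_nonneg_right c2 (sq_nonneg u0)
    have a3 := mul_le_mul_of_nonneg_right a2 (sq_nonneg (up j))
    have b3 := mul_le_mul_of_nonneg_right b2 (sq_nonneg (um j))
    nlinarith [sq_nonneg (c j * u0 - a j * up j), sq_nonneg (c j * u0 - b j * um j),
      sq_nonneg (a j * up j - b j * um j)]
  set T := ∑ j, (up j ^ 2 + um j ^ 2) with hT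
  have hT0 : 0 ≤ T := sum_nonneg fun _ _ => by positivity
  calc n * ∑ j, (c j * u0 + a j * up j + b j * um j) ^ 2
      ≤ n * ∑ j, (3 * K ^ 2 * h ^ 4 * u0 ^ 2 + 3 * K ^ 2 * h ^ 2 * (up j ^ 2 + um j ^ 2)) := by
        gcongr with j; exact p j
    _ = 3 * n ^ 2 * K ^ 2 * h ^ 2 * (h ^ 2 * u0 ^ 2) + 3 * (n * 1) * K ^ 2 * h ^ 2 * T := by
        rw [sum_add_distrib, sum_const, card_univ, nsmul_eq_mul, ← mul_sum, ← hT, ← hn]; ring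
    _ ≤ 3 * n ^ 2 * K ^ 2 * h ^ 2 * (h ^ 2 * u0 ^ 2) + 3 * (n * n) * K ^ 2 * h ^ 2 * T := by
        gcongr
    _ = _ := by ring
end Carl

namespace Carl
open Finset

lemma alg1 (S x : ℝ) : 2 * S * x ≤ (S + x) ^ 2 := by nlinarith [sq_nonneg S, sq_nonneg x]

lemma alg2 (E c a th w : ℝ) : (E * c + a * w - th * w) ^ 2
    ≤ 2 * (E ^ 2 * c ^ 2) + 4 * a ^ 2 * w ^ 2 + 4 * th ^ 2 * w ^ 2 := by
  nlinarith [sq_nonneg (E * c - (a * w - th * w)), sq_nonneg (a * w + th * w)]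

lemma sinh_le_two {y : ℝ} (h0 : 0 ≤ y) (h1 : y ≤ 1) : Real.sinh y ≤ 2 * y := by
  have h := Real.sinh_eq y
  have e1 := Real.abs_exp_sub_one_sub_id_le (x := y) (by rw [abs_of_nonneg h0]; exact h1)
  have e2 := Real.add_one_le_exp (-y)
  have := (abs_le.1 e1).2
  nlinarith

/-- center offset -/
def offs {d : ℕ} (h : ℝ) (zc : Fin d → ℝ) : Fin (d + 1) → ℝ := Fin.cons (h / 2) zc

lemma xm0 {d : ℕ} (h : ℝ) (zc : Fin d → ℝ) (z : Fin (d + 1) → ℤ) :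
    xmap h (offs h zc) z 0 = h * z 0 - h / 2 := by simp [xmap, offs]

lemma xms {d : ℕ} (h : ℝ) (zc : Fin d → ℝ) (z : Fin (d + 1) → ℤ) (i : Fin d) :
    xmap h (offs h zc) z i.succ = h * z i.succ - zc i := by simp [xmap, offs]

lemma psi_diff {d : ℕ} (h ε r : ℝ) (zc : Fin d → ℝ) (z : Fin (d + 1) → ℤ) (hz : z 0 = 0) :
    psi d ε r (xmap h (offs h zc) (z + eZ 0)) - psi d ε r (xmap h (offs h zc) z)
      = ε * h * (∑ i : Fin d, (xmap h (offs h zc) z i.succ) ^ 2 - r ^ 2) := by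
  unfold psi
  rw [Fin.sum_univ_succ, Fin.sum_univ_succ (fun i => xmap h (offs h zc) z i ^ 2)]
  simp only [xm0, xms, Pi.add_apply, hz]
  simp [eZ]
  ring

lemma psi_row {d : ℕ} {h ε r : ℝ} (hh : 0 < h) (hε : 0 < ε) (zc : Fin d → ℝ) (z : Fin (d + 1) → ℤ) (hz : z 0 = 0)
    (hr : ∑ i : Fin d, (xmap h (offs h zc) z i.succ) ^ 2 < r ^ 2) :
    psi d ε r (xmap h (offs h zc) (z + eZ 0)) ≤ 0 := by
  have := psi_diff h ε r zc z hz
  have h2 : psi d ε r (xmap h (offs h zc) z) = -(h^2/4 + ∑ i : Fin d, (xmap h (offs h zc) z i.succ) ^ 2)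
     - ε * h / 2 * (∑ i : Fin d, (xmap h (offs h zc) z i.succ) ^ 2 - r ^ 2) := by
    unfold psi
    rw [Fin.sum_univ_succ (fun i => xmap h (offs h zc) z i ^ 2)]
    simp only [xm0, hz]; push_cast; ring
  have hT0 : 0 ≤ ∑ i : Fin d, (xmap h (offs h zc) z i.succ) ^ 2 := sum_nonneg fun _ _ => sq_nonneg _
  have : 0 ≤ ε * h / 2 * (r ^ 2 - ∑ i : Fin d, (xmap h (offs h zc) z i.succ) ^ 2) :=
    mul_nonneg (by positivity) (by linarith)
  nlinarith [sq_nonneg h]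

lemma opS_zero {ι : Type*} [Fintype ι] [DecidableEq ι] (φ q w : (ι → ℤ) → ℝ) (z : ι → ℤ) (h0 : w z = 0)
    (hp : ∀ j, w (z + eZ j) = 0) (hm : ∀ j, w (z - eZ j) = 0) : opS eZ φ q w z = 0 := by
  simp [opS, h0, hp, hm]

/-- row zero -/
lemma row0 {d : ℕ} (φ q w : (Fin (d + 1) → ℤ) → ℝ) (z : Fin (d + 1) → ℤ) (t : ℝ) (h0 : w z = 0)
    (hp : ∀ i : Fin d, w (z + eZ i.succ) = 0) (hm : ∀ j, w (z - eZ j) = 0) :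
    2 * opS eZ φ q w z * (opA eZ φ w z - t * w z)
      = -Real.sinh (2 * (φ (z + eZ 0) - φ z)) * w (z + eZ 0) ^ 2 := by
  unfold opS opA
  rw [Fin.sum_univ_succ, Fin.sum_univ_succ]
  simp only [h0, hp, hm, mul_zero, add_zero, sub_zero, sum_const_zero, Real.sinh_two_mul]
  ring

end Carl

namespace Carl
open Finset

/-- energy density -/
def enr {d : ℕ} (h : ℝ) (u : (Fin (d + 1) → ℤ) → ℝ) (z : Fin (d + 1) → ℤ) : ℝ :=
  h ^ 2 * u z ^ 2 + ∑ j, ((u (z + eZ j) - u z) ^ 2 + (u (z - eZ j) - u z) ^ 2)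

lemma enr_nonneg {d : ℕ} (h : ℝ) (u : (Fin (d + 1) → ℤ) → ℝ) (z : Fin (d + 1) → ℤ) :
    0 ≤ enr h u z := add_nonneg (by positivity) (sum_nonneg fun _ _ => by positivity)

/-- local hypotheses -/
structure LocHyp (d : ℕ) (κ Rb h τ : ℝ) (zc : Fin d → ℝ) (u V1 V2 : (Fin (d + 1) → ℤ) → ℝ) (Q : ℕ) : Prop where
  hh : 0 < h
  hκ : h ≤ κ
  hτ : τ * h ≤ κ
  hκτ : 1 ≤ κ * τ
  u0 : ∀ z, z 0 ≤ 0 → u z = 0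
  eq : ∀ z, 1 ≤ z 0 → ‖xmap h (offs h zc) z‖ ≤ Rb →
    ∑ j, (u (z + eZ j) + u (z - eZ j) - 2 * u z) = h ^ 2 * (V1 z + V2 z) * u z
  v1 : ∀ z, ‖xmap h (offs h zc) z‖ ≤ Rb → |V1 z| ≤ κ * τ ^ 2
  v1d : ∀ z, ‖xmap h (offs h zc) z‖ ≤ Rb → ∀ j, |V1 (z + eZ j) - V1 z| ≤ κ * τ ^ 2 * h
  v2 : ∀ z, ‖xmap h (offs h zc) z‖ ≤ Rb → V2 z ^ 2 ≤ κ * τ ^ 3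
  hQ : ∀ z, ‖xmap h (offs h zc) z‖ ≤ Rb → ∀ i, |z i| ≤ Q

lemma norm_inc_lo {ι : Type*} [Fintype ι] [DecidableEq ι] (X : ι → ℝ) (s : ℝ) (j : ι) :
    ‖X‖ ≤ ‖X + inc s j‖ + |s| := by
  have := norm_sub_le (X + inc s j) (inc s j)
  rw [add_sub_cancel_right, inc_norm] at this
  exact this

lemma norm_inc_hi {ι : Type*} [Fintype ι] [DecidableEq ι] (X : ι → ℝ) (s : ℝ) (j : ι) :
    ‖X + inc s j‖ ≤ ‖X‖ + |s| := by
  have := norm_add_le X (inc s j)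
  rwa [inc_norm] at this

/-- pointwise bound on rows `≥ 1` -/
lemma row1 {d : ℕ} {K h κ σ τ m P : ℝ} (hh : 0 < h) (hK : 1 ≤ K) (hκ0 : 0 < κ) (hσ : σ = τ * h) (hτ : 0 < τ)
    (hm : 40 * K ^ 2 * κ ≤ m) (hhσ : h ≤ κ * σ)
    (φ q χ u : (Fin (d + 1) → ℤ) → ℝ) (v1 v2 t E : ℝ) (z : Fin (d + 1) → ℤ)
    (hq : q z = h ^ 2 * v1)
    (hE : E = Real.exp (φ z))
    (he : ∑ j, (u (z + eZ j) + u (z - eZ j) - 2 * u z) = h ^ 2 * (v1 + v2) * u z)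
    (hv2 : v2 ^ 2 ≤ κ * τ ^ 3) (ht : |t| ≤ K)
    (hχ2 : ∀ j, |χ (z + eZ j) + χ (z - eZ j) - 2 * χ z| ≤ K * h ^ 2)
    (hχp : ∀ j, |χ (z + eZ j) - χ z| ≤ K * h) (hχm : ∀ j, |χ (z - eZ j) - χ z| ≤ K * h)
    (hdi : φ z ≤ P ∨ (∀ j, χ (z + eZ j) = χ z ∧ χ (z - eZ j) = χ z)) :
    2 * opS eZ φ q (fun z => Real.exp (φ z) * (χ z * u z)) z *
      (opA eZ φ (fun z => Real.exp (φ z) * (χ z * u z)) z - σ * h * t * (Real.exp (φ z) * (χ z * u z)))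
      ≤ m / 4 * σ ^ 3 * h * (Real.exp (φ z) * (χ z * u z)) ^ 2
        + 6 * ((d : ℝ) + 1) ^ 2 * K ^ 2 * h ^ 2 * Real.exp (2 * P) * enr h u z := by
  have hσ0 : 0 < σ := by rw [hσ]; positivity
  set c := ∑ j, ((χ (z + eZ j) + χ (z - eZ j) - 2 * χ z) * u z
          + (χ (z + eZ j) - χ z) * (u (z + eZ j) - u z)
          + (χ (z - eZ j) - χ z) * (u (z - eZ j) - u z)) with hc
  set w := Real.exp (φ z) * (χ z * u z) with hw
  have e1 := conj_eq φ q (fun z => χ z * u z) z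
  rw [comm_eq, he, hq, ← hc, ← hE] at e1
  have e2 : E * (χ z * (h ^ 2 * (v1 + v2) * u z) + c - h ^ 2 * v1 * (χ z * u z)) = E * c + (h ^ 2 * v2) * w := by
    rw [hw, ← hE]; ring
  refine (alg1 _ _).trans ?_
  rw [← add_sub_assoc, e1, e2]
  refine (alg2 _ _ _ _ _).trans ?_
  have hw2 : 0 ≤ w ^ 2 := sq_nonneg w
  have b1 : 4 * (h ^ 2 * v2) ^ 2 + 4 * (σ * h * t) ^ 2 ≤ m / 4 * σ ^ 3 * h := by
    have t2 : t ^ 2 ≤ K ^ 2 := by rw [← sq_abs]; gcongr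
    have a1 : (h ^ 2 * v2) ^ 2 ≤ κ * (σ ^ 3 * h) := by
      calc (h ^ 2 * v2) ^ 2 = h ^ 4 * v2 ^ 2 := by ring
        _ ≤ h ^ 4 * (κ * τ ^ 3) := by gcongr
        _ = _ := by rw [hσ]; ring
    have a2 : (σ * h * t) ^ 2 ≤ K ^ 2 * κ * (σ ^ 3 * h) := by
      calc (σ * h * t) ^ 2 = σ ^ 2 * h * h * t ^ 2 := by ring
        _ ≤ σ ^ 2 * h * (κ * σ) * K ^ 2 := by gcongr
        _ = _ := by ring
    have a3 : κ ≤ K ^ 2 * κ := le_mul_of_one_le_left hκ0.le (one_le_pow₀ hK)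
    have a4 : 0 ≤ σ ^ 3 * h := by positivity
    have a5 := mul_le_mul_of_nonneg_right a3 a4
    have a6 := mul_le_mul_of_nonneg_right hm a4
    nlinarith [mul_nonneg (mul_nonneg (sq_nonneg K) hκ0.le) a4]
  have b2 : 2 * (E ^ 2 * c ^ 2) ≤ 6 * ((d : ℝ) + 1) ^ 2 * K ^ 2 * h ^ 2 * Real.exp (2 * P) * enr h u z := by
    have nn : 0 ≤ 6 * ((d : ℝ) + 1) ^ 2 * K ^ 2 * h ^ 2 * Real.exp (2 * P) * enr h u z :=
      mul_nonneg (by positivity) (enr_nonneg _ _ _)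
    rcases hdi with h1 | h1
    · have cb := comm_bound (K := K) (h := h) (u0 := u z) hh
        (fun j => χ (z + eZ j) + χ (z - eZ j) - 2 * χ z) (fun j => χ (z + eZ j) - χ z)
        (fun j => χ (z - eZ j) - χ z) (fun j => u (z + eZ j) - u z) (fun j => u (z - eZ j) - u z)
        hχ2 hχp hχm
      rw [← hc] at cb
      have E2 : E ^ 2 ≤ Real.exp (2 * P) := by
        rw [hE, ← Real.exp_nat_mul]
        apply Real.exp_le_exp.2
        push_cast; linarith
      have : 0 ≤ c ^ 2 := sq_nonneg c
      have cb' : c ^ 2 ≤ 3 * ((d : ℝ) + 1) ^ 2 * K ^ 2 * h ^ 2 * enr h u z := by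
        simpa [enr, Fintype.card_fin] using cb
      calc 2 * (E ^ 2 * c ^ 2) ≤ 2 * (Real.exp (2 * P) * (3 * ((d : ℝ) + 1) ^ 2 * K ^ 2 * h ^ 2 * enr h u z)) := by gcongr
        _ = _ := by ring
    · have : c = 0 := by
        rw [hc]; refine sum_eq_zero fun j _ => ?_
        rw [(h1 j).1, (h1 j).2]; ring
      rw [this]; simpa using nn
  nlinarith [mul_le_mul_of_nonneg_right b1 hw2]

end Carl

namespace Carl
open Finset

lemma chi2 {a b c h K2 : ℝ} {p : ℝ} (h1 : |a - c - h * p| ≤ K2 * h ^ 2) (h2 : |b - c - -h * p| ≤ K2 * (-h) ^ 2) :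
    |a + b - 2 * c| ≤ 2 * K2 * h ^ 2 := by
  rw [abs_le] at *
  constructor <;> nlinarith

lemma na1 (d : ℕ) (L r : ℝ) : 1 ≤ d * L ^ 2 + 1 + r ^ 2 := by
  nlinarith [mul_nonneg (Nat.cast_nonneg (α := ℝ) d) (sq_nonneg L), sq_nonneg r]
lemma na2 (n : ℕ) {K : ℝ} (hK1 : 1 ≤ K) : 40 * K ^ 2 ≤ 20000 * ((n : ℝ) + 1) ^ 2 * K ^ 4 := by
  have k1 : K ^ 2 ≤ K ^ 4 := pow_le_pow_right₀ hK1 (by norm_num)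
  have k2 : 1 ≤ ((n : ℝ) + 1) ^ 2 := one_le_pow₀ (by linarith [Nat.cast_nonneg (α := ℝ) n])
  nlinarith [mul_le_mul_of_nonneg_right k2 (by positivity : 0 ≤ K ^ 4)]
lemma na3 {κ τ : ℝ} (κp : 0 < κ) (h : 1 ≤ κ * τ) : 0 < τ := by
  by_contra hc; push Not at hc; nlinarith [mul_nonneg κp.le (neg_nonneg.2 hc)]
lemma na4 {κ τ h : ℝ} (hh : 0 < h) (hk : 1 ≤ κ * τ) : h ≤ κ * (τ * h) := by nlinarith
lemma na5 {h κ ε r z : ℝ} (hh : 0 < h) (h1 : h ≤ κ) (h2 : κ ≤ ε * r ^ 2 / 12) (hz : -1 ≤ z) :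
    -(ε * r ^ 2 / 8) ≤ h * z - h / 2 := by nlinarith
lemma na6 {K κ σ : ℝ} (hK : 1 ≤ K) (h1 : 8 * K * κ ≤ 1) (h2 : σ ≤ κ) : K * σ ≤ 1 / 8 := by nlinarith
lemma na9 {A : ℝ} (hA : 1 ≤ A) : -((3 + 2 * A - 1) ^ 2 / 2) ≤ -(A + 1) := by nlinarith
lemma na10 {d : ℕ} {L r A : ℝ} (hA : A = d * L ^ 2 + 1 + r ^ 2) (i : Fin d) : L ≤ 3 + 2 * A := by
  have : (1 : ℝ) ≤ d := by exact_mod_cast (Nat.one_le_iff_ne_zero.2 (by rintro rfl; exact i.elim0))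
  have := mul_le_mul_of_nonneg_right this (sq_nonneg L)
  nlinarith [sq_nonneg (L - 1), sq_nonneg r]
lemma na11 {h : ℝ} {z : ℤ} (hh : 0 < h) (hz : 1 ≤ z) : 0 ≤ h * z - h / 2 := by
  have : (1 : ℝ) ≤ z := by exact_mod_cast hz
  nlinarith
lemma na12 {K g p σ h : ℝ} (hK : 1 ≤ K) (σp : 0 < σ) (hh : h ≤ 1) (p1 : |p - σ * g| ≤ K * σ * h) (p2 : |g| ≤ K)
    (h3 : K * σ ≤ 1 / 8) : -Real.sinh (2 * p) ≤ 8 * K * σ := by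
  have pb : |p| ≤ 2 * K * σ := by
    have a : |p| ≤ |p - σ * g| + |σ * g| := by
      have := abs_add_le (p - σ * g) (σ * g); rwa [sub_add_cancel] at this
    rw [abs_mul, abs_of_pos σp] at a
    have b : σ * |g| ≤ σ * K := by gcongr
    have c : K * σ * h ≤ K * σ * 1 := by gcongr
    linarith
  have := sinh_abs_le (x := 2 * p) (by rw [abs_mul, abs_two]; linarith)
  rw [abs_mul, abs_two] at this
  linarith [neg_abs_le (Real.sinh (2 * p))]

set_option maxHeartbeats 4000000 in
open scoped Classical in
/-- main local estimate -/
theorem loc (d : ℕ) (L r : ℝ) (hL : 0 < L) (hr : 0 < r) : ∃ C c κ Pin Pout Rb : ℝ,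
    0 < C ∧ 0 < c ∧ 0 < κ ∧ κ ≤ 1 ∧ 0 < Pin ∧ Pout < Pin ∧ 1 ≤ Rb ∧
    ∀ h τ zc u V1 V2 Q, LocHyp d κ Rb h τ zc u V1 V2 Q →
      c * τ ^ 3 * h ^ 4 * Real.exp (2 * (τ * Pin)) *
        ∑ z ∈ boxZ (Fin (d + 1)) Q with (1 ≤ z 0 ∧ h * z 0 ≤ 1 ∧ ∀ i : Fin d, |h * z i.succ - zc i| ≤ L), u z ^ 2
      ≤ C * h ^ 2 * Real.exp (2 * (τ * Pout)) *
          ∑ z ∈ boxZ (Fin (d + 1)) Q with (1 ≤ z 0 ∧ ‖xmap h (offs h zc) z‖ ≤ Rb), enr h u z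
        + C * τ * h * Real.exp (2 * τ) *
          ∑ z ∈ boxZ (Fin (d + 1)) Q with (z 0 = 0 ∧ ∑ i : Fin d, (h * z i.succ - zc i) ^ 2 < r ^ 2),
            u (z + eZ 0) ^ 2 := by
  obtain ⟨A, hA⟩ : ∃ x : ℝ, x = d * L ^ 2 + 1 + r ^ 2 := ⟨_, rfl⟩
  have hA1 : 1 ≤ A := by rw [hA]; exact na1 d L r
  obtain ⟨rIn, hrIn⟩ : ∃ x : ℝ, x = 3 + 2 * A := ⟨_, rfl⟩
  obtain ⟨Rb, hRb⟩ : ∃ x : ℝ, x = rIn + 3 := ⟨_, rfl⟩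
  have hRb1 : 1 ≤ Rb := by linarith
  obtain ⟨ε, hε⟩ : ∃ x : ℝ, x = 1 / (2 * Rb) := ⟨_, rfl⟩
  have hRb0 : 0 < Rb := by linarith
  have hε0 : 0 < ε := by rw [hε]; positivity
  obtain ⟨ψ, hψ⟩ : ∃ x, x = psi d ε r := ⟨_, rfl⟩
  have sψ : Smo ψ := by rw [hψ]; exact smo_psi ε r
  obtain ⟨lam, κ0, m, K0, hlam, hκ0, hm, hK0, W⟩ := weight sψ Rb
    (g0 := min (r ^ 2 / 4) ((ε * r ^ 2 / 2) ^ 2)) (lt_min (by positivity) (by positivity))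
  obtain ⟨χ, χs, χ01, χ1, χ0⟩ := cutoff (ι := Fin (d + 1)) (a := rIn) (by linarith)
  obtain ⟨Ka, hKa, Ta⟩ := T1 χs Rb
  obtain ⟨Kb, hKb, Tb⟩ := T2 χs Rb
  obtain ⟨K, hK⟩ : ∃ x : ℝ, x = K0 + Ka + 2 * Kb := ⟨_, rfl⟩
  have hK1 : 1 ≤ K := by linarith
  have hn : Fintype.card (Fin (d + 1)) = d + 1 := Fintype.card_fin _
  obtain ⟨Z, hZ⟩ : ∃ x : ℝ, x = 20000 * ((Fintype.card (Fin (d + 1)) : ℝ) + 1) ^ 2 * K ^ 4 := ⟨_, rfl⟩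
  have hZ0 : 40 * K ^ 2 ≤ Z := by rw [hZ]; exact na2 _ hK1
  have hZp : 0 < Z := lt_of_lt_of_le (by positivity) hZ0
  obtain ⟨κ, hκ⟩ : ∃ x : ℝ, x = min (min 1 (1 / (8 * K))) (min (m / Z) (ε * r ^ 2 / 12)) := ⟨_, rfl⟩
  have κ1 : κ ≤ 1 := by rw [hκ]; exact (min_le_left _ _).trans (min_le_left _ _)
  have κ2 : 8 * K * κ ≤ 1 := by
    have : κ ≤ 1 / (8 * K) := by rw [hκ]; exact (min_le_left _ _).trans (min_le_right _ _)
    rw [le_div_iff₀ (by positivity)] at this; linarith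
  have κ3 : Z * κ ≤ m := by
    have : κ ≤ m / Z := by rw [hκ]; exact (min_le_right _ _).trans (min_le_left _ _)
    rw [le_div_iff₀ hZp] at this; linarith
  have κ4 : κ ≤ ε * r ^ 2 / 12 := by rw [hκ]; exact (min_le_right _ _).trans (min_le_right _ _)
  have κp : 0 < κ := by
    rw [hκ]; refine lt_min (lt_min one_pos (by positivity)) (lt_min (div_pos hm hZp) (by positivity))
  have κ5 : 40 * K ^ 2 * κ ≤ m := le_trans (by gcongr) κ3
  obtain ⟨CC, hCC⟩ : ∃ x : ℝ, x = 6 * ((d : ℝ) + 1) ^ 2 * K ^ 2 + 8 * K := ⟨_, rfl⟩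
  have CCp : 0 < CC := by rw [hCC]; positivity
  refine ⟨CC, m / 4, κ, Real.exp (lam * -A), Real.exp (lam * -(A + 1)), Rb, by positivity, by positivity, κp, κ1,
    Real.exp_pos _, Real.exp_lt_exp.2 (mul_lt_mul_of_pos_left (by linarith) (by linarith)), hRb1, ?_⟩
  intro h τ zc u V1 V2 Q LH
  obtain ⟨hh, hhκ, hτ, hκτ, u0, heq, hv1, hv1d, hv2, hQ⟩ := LH
  have hh1 : h ≤ 1 := hhκ.trans κ1
  have hah : |h| ≤ 1 := by rw [abs_of_pos hh]; exact hh1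
  have hah' : |(-h)| ≤ 1 := by rwa [abs_neg]
  have τp : 0 < τ := na3 κp hκτ
  obtain ⟨o, ho⟩ : ∃ x, x = offs h zc := ⟨_, rfl⟩
  obtain ⟨σ, hσ⟩ : ∃ x, x = τ * h := ⟨_, rfl⟩
  simp only [← ho] at heq hv1 hv1d hv2 hQ ⊢
  rw [← hσ] at hτ
  have σp : 0 < σ := by rw [hσ]; positivity
  have hhσ : h ≤ κ * σ := by rw [hσ]; exact na4 hh hκτ
  obtain ⟨φ, hφ⟩ : ∃ x : (Fin (d + 1) → ℤ) → ℝ, x = fun z => τ * Ex lam ψ (xmap h o z) := ⟨_, rfl⟩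
  obtain ⟨q, hq⟩ : ∃ x : (Fin (d + 1) → ℤ) → ℝ, x = fun z => h ^ 2 * V1 z := ⟨_, rfl⟩
  obtain ⟨t, ht⟩ : ∃ x : (Fin (d + 1) → ℤ) → ℝ, x = fun z => κ0 * lam * Ex lam ψ (xmap h o z) := ⟨_, rfl⟩
  obtain ⟨w, hw⟩ : ∃ x : (Fin (d + 1) → ℤ) → ℝ, x = fun z => Real.exp (φ z) * (χ (xmap h o z) * u z) := ⟨_, rfl⟩
  set B : Set (Fin (d + 1) → ℤ) := {z | ‖xmap h o z‖ ≤ Rb ∧ -1 ≤ z 0} with hB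
  have e0 : ∀ j, (eZ j : Fin (d + 1) → ℤ) 0 ≤ 1 := fun j => (abs_le.1 (eZ_abs j 0)).2
  have e0' : ∀ j, -1 ≤ (eZ j : Fin (d + 1) → ℤ) 0 := fun j => (abs_le.1 (eZ_abs j 0)).1
  have wu : ∀ z, z 0 ≤ 0 → w z = 0 := fun z hz => by simp [hw, u0 z hz]
  have wx : ∀ z, rIn + 1 ≤ ‖xmap h o z‖ → w z = 0 := fun z hz => by simp [hw, χ0 _ hz]
  have np : ∀ z j, ‖xmap h o z‖ ≤ ‖xmap h o (z + eZ j)‖ + h := fun z j => by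
    have := norm_inc_lo (xmap h o z) h j
    rwa [← xmap_add, abs_of_pos hh] at this
  have nm : ∀ z j, ‖xmap h o z‖ ≤ ‖xmap h o (z - eZ j)‖ + h := fun z j => by
    have := norm_inc_lo (xmap h o z) (-h) j
    rwa [← xmap_sub, abs_neg, abs_of_pos hh] at this
  have np' : ∀ z j, ‖xmap h o (z + eZ j)‖ ≤ ‖xmap h o z‖ + h := fun z j => by
    have := norm_inc_hi (xmap h o z) h j
    rwa [← xmap_add, abs_of_pos hh] at this
  have nm' : ∀ z j, ‖xmap h o (z - eZ j)‖ ≤ ‖xmap h o z‖ + h := fun z j => by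
    have := norm_inc_hi (xmap h o z) (-h) j
    rwa [← xmap_sub, abs_neg, abs_of_pos hh] at this
  have hw0 : ∀ z, z ∉ B → w z = 0 ∧ (∀ j, w (z + eZ j) = 0 ∧ w (z - eZ j) = 0) ∧
      ∀ j k, w (z + eZ j + eZ k) = 0 := by
    intro z hz
    have hz' : Rb < ‖xmap h o z‖ ∨ z 0 ≤ -2 := by
      by_contra hcon; push Not at hcon; exact hz ⟨hcon.1, by linarith [hcon.2]⟩
    rcases hz' with h1 | h1
    · refine ⟨wx _ (by linarith), fun j => ⟨wx _ (by linarith [np z j]), wx _ (by linarith [nm z j])⟩,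
        fun j k => wx _ (by linarith [np z j, np (z + eZ j) k])⟩
    · refine ⟨wu _ (by linarith), fun j => ⟨wu _ ?_, wu _ ?_⟩, fun j k => wu _ ?_⟩
      · have := e0 j; simp only [Pi.add_apply]; linarith
      · have := e0' j; simp only [Pi.sub_apply]; linarith
      · have := e0 j; have := e0 k; simp only [Pi.add_apply]; linarith
  have WH : ∀ z ∈ B, WHyp eZ φ q t (fun z j => pd j (Ex lam ψ) (xmap h o z))
      (fun z j k => pd k (pd j (Ex lam ψ)) (xmap h o z)) K m κ σ h z := by
    intro z hz
    have hKK : K0 ≤ K := by linarith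
    rw [hφ, ht, hσ]
    refine W K hKK h τ o q κ z hh hh1 τp hz.1 ?_ ?_ ?_
    · rw [hψ, hε]
      refine grad_psi hr hRb1 _ hz.1 ?_
      rw [ho, xm0, ← hε]
      exact na5 hh hhκ κ4 (by exact_mod_cast hz.2)
    · rw [hq]; simp only [abs_mul, abs_of_pos (pow_pos hh 2)]
      calc h ^ 2 * |V1 z| ≤ h ^ 2 * (κ * τ ^ 2) := by gcongr; exact hv1 z hz.1
        _ = _ := by ring
    · intro j
      rw [hq]; simp only [← mul_sub, abs_mul, abs_of_pos (pow_pos hh 2)]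
      calc h ^ 2 * |V1 (z + eZ j) - V1 z| ≤ h ^ 2 * (κ * τ ^ 2 * h) := by gcongr; exact hv1d z hz.1 j
        _ = _ := by ring
  have CZ := carlemanZ φ q t w _ _ hK1 hm σp hh hτ κ2 hhσ κp.le le_rfl (by rw [← hZ]; exact κ3) B Q
    (fun z hz => hQ z hz.1) WH hw0
  -- pointwise
  have PT : ∀ z, 2 * opS eZ φ q w z * (opA eZ φ w z - σ * h * t z * w z)
      ≤ m / 4 * σ ^ 3 * h * w z ^ 2
        + (if (1 ≤ z 0 ∧ ‖xmap h o z‖ ≤ Rb) then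
            CC * h ^ 2 * Real.exp (2 * (τ * Real.exp (lam * -(A + 1)))) * enr h u z else 0)
        + (if (z 0 = 0 ∧ ∑ i : Fin d, (h * z i.succ - zc i) ^ 2 < r ^ 2) then
            CC * τ * h * Real.exp (2 * τ) * u (z + eZ 0) ^ 2 else 0) := by
    intro z
    have n1 : 0 ≤ m / 4 * σ ^ 3 * h * w z ^ 2 := by positivity
    have n2 : 0 ≤ (if (1 ≤ z 0 ∧ ‖xmap h o z‖ ≤ Rb) then
            CC * h ^ 2 * Real.exp (2 * (τ * Real.exp (lam * -(A + 1)))) * enr h u z else 0) := by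
      split_ifs
      · exact mul_nonneg (by positivity) (enr_nonneg _ _ _)
      · exact le_rfl
    have n3 : 0 ≤ (if (z 0 = 0 ∧ ∑ i : Fin d, (h * z i.succ - zc i) ^ 2 < r ^ 2) then
            CC * τ * h * Real.exp (2 * τ) * u (z + eZ 0) ^ 2 else 0) := by
      split_ifs
      · positivity
      · exact le_rfl
    by_cases hzB : z ∈ B
    swap
    · obtain ⟨a1, a2, a3⟩ := hw0 z hzB
      rw [opS_zero φ q w z a1 (fun j => (a2 j).1) (fun j => (a2 j).2)]
      simp only [mul_zero, zero_mul]
      positivity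
    rcases lt_trichotomy (z 0) 0 with hz | hz | hz
    · rw [opS_zero φ q w z (wu _ hz.le) (fun j => wu _ ?_) (fun j => wu _ ?_)]
      · simp only [mul_zero, zero_mul]
        positivity
      · have := e0 j; simp only [Pi.add_apply]; linarith
      · have := e0' j; simp only [Pi.sub_apply]; linarith
    · -- row zero
      rw [row0 φ q w z (σ * h * t z) (wu _ hz.le) (fun i => wu _ ?_) (fun j => wu _ ?_)]
      rotate_left
      · simp [eZ, hz]
      · have := e0' j; simp only [Pi.sub_apply]; 
        by_cases hj : j = 0
        · subst hj; simp [eZ, hz]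
        · simp [eZ, hz, Ne.symm hj]
      have pdif := psi_diff h ε r zc z hz
      rw [← ho] at pdif
      have hT : ∑ i : Fin d, (xmap h o z i.succ) ^ 2 = ∑ i : Fin d, (h * z i.succ - zc i) ^ 2 := by
        simp only [ho, xms]
      by_cases hin : ∑ i : Fin d, (h * z i.succ - zc i) ^ 2 < r ^ 2
      · rw [if_pos (show z 0 = 0 ∧ _ from ⟨hz, hin⟩)]
        have pr := psi_row hh hε0 zc z hz (by rw [← ho, hT]; exact hin)
        rw [← ho] at pr
        have wh := WH z hzB
        have p1 := wh.φp 0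
        have p2 := wh.g_le 0
        have sb := na12 hK1 σp hh1 p1 p2 (na6 hK1 κ2 hτ)
        have wb : w (z + eZ 0) ^ 2 ≤ Real.exp (2 * τ) * u (z + eZ 0) ^ 2 := by
          have e1 : Real.exp (φ (z + eZ 0)) ^ 2 ≤ Real.exp (2 * τ) := by
            rw [← Real.exp_nat_mul]
            apply Real.exp_le_exp.2
            have : Ex lam ψ (xmap h o (z + eZ 0)) ≤ 1 := by
              unfold Ex; rw [Real.exp_le_one_iff]; exact mul_nonpos_of_nonneg_of_nonpos (by linarith) (by rw [hψ]; exact pr)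
            have : φ (z + eZ 0) ≤ τ * 1 := by simp only [hφ]; gcongr
            push_cast; linarith
          have e2 : χ (xmap h o (z + eZ 0)) ^ 2 ≤ 1 := by
            obtain ⟨a, b⟩ := χ01 (xmap h o (z + eZ 0))
            exact pow_le_one₀ a b
          calc w (z + eZ 0) ^ 2 = Real.exp (φ (z + eZ 0)) ^ 2 * (χ (xmap h o (z + eZ 0)) ^ 2 * u (z + eZ 0) ^ 2) := by
                simp only [hw]; ring
            _ ≤ Real.exp (2 * τ) * (1 * u (z + eZ 0) ^ 2) := by gcongr
            _ = _ := by ring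
        have : -Real.sinh (2 * (φ (z + eZ 0) - φ z)) * w (z + eZ 0) ^ 2 ≤ 8 * K * σ * (Real.exp (2 * τ) * u (z + eZ 0) ^ 2) :=
          mul_le_mul sb wb (sq_nonneg _) (by positivity)
        have h8 : 8 * K * σ * (Real.exp (2 * τ) * u (z + eZ 0) ^ 2) ≤ CC * σ * (Real.exp (2 * τ) * u (z + eZ 0) ^ 2) := by
          gcongr
          rw [hCC]; exact le_add_of_nonneg_left (by positivity)
        have h9 : CC * σ * (Real.exp (2 * τ) * u (z + eZ 0) ^ 2) = CC * τ * h * Real.exp (2 * τ) * u (z + eZ 0) ^ 2 := by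
          rw [hσ]; ring
        linarith
      · have : 0 ≤ Real.sinh (2 * (φ (z + eZ 0) - φ z)) := by
          rw [Real.sinh_nonneg_iff]
          have : φ z ≤ φ (z + eZ 0) := by
            simp only [hφ, Ex]
            gcongr
            push Not at hin
            have : 0 ≤ ε * h * (∑ i : Fin d, (xmap h o z i.succ) ^ 2 - r ^ 2) := by
              rw [hT]; exact mul_nonneg (by positivity) (by linarith)
            rw [hψ]; linarith
          linarith
        have := mul_nonneg this (sq_nonneg (w (z + eZ 0)))
        linarith
    · -- rows at least one
      have hz1 : 1 ≤ z 0 := hz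
      rw [if_pos (show 1 ≤ z 0 ∧ _ from ⟨hz1, hzB.1⟩)]
      have wh := WH z hzB
      have tb : |t z| ≤ K := by
        rw [abs_of_nonneg (hm.le.trans wh.t_lo)]; exact wh.t_hi
      have x0 : 0 ≤ xmap h o z 0 := by
        rw [ho, xm0]; exact na11 hh hz1
      have r1 := row1 (P := τ * Real.exp (lam * -(A + 1))) hh hK1 κp hσ τp κ5 hhσ φ q (fun z => χ (xmap h o z)) u (V1 z) (V2 z) (t z) _ z (by rw [hq]) rfl
        (heq z hz1 hzB.1) (hv2 z hzB.1) tb ?_ ?_ ?_ ?_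
      · have h8 : 6 * ((d : ℝ) + 1) ^ 2 * K ^ 2 * h ^ 2 * Real.exp (2 * (τ * Real.exp (lam * -(A + 1)))) * enr h u z
          ≤ CC * h ^ 2 * Real.exp (2 * (τ * Real.exp (lam * -(A + 1)))) * enr h u z := by
          have := enr_nonneg h u z
          gcongr
          rw [hCC]; exact le_add_of_nonneg_right (by positivity)
        have wz : w z = Real.exp (φ z) * (χ (xmap h o z) * u z) := by rw [hw]
        rw [← hw, ← wz] at r1
        linarith
      · intro j
        have a := Tb Kb le_rfl j _ hzB.1 h hah
        have b := Tb Kb le_rfl j _ hzB.1 (-h) hah'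
        rw [← xmap_add] at a
        rw [← xmap_sub] at b
        refine (chi2 a b).trans ?_
        gcongr; linarith
      · intro j
        have a := Ta K (by linarith) j _ hzB.1 h hah
        rwa [← xmap_add, abs_of_pos hh] at a
      · intro j
        have a := Ta K (by linarith) j _ hzB.1 (-h) hah'
        rwa [← xmap_sub, abs_neg, abs_of_pos hh] at a
      · by_cases hX : ‖xmap h o z‖ ≤ rIn - 1
        · right
          intro j
          rw [χ1 _ (hX.trans (by linarith)), χ1 _ (by linarith [np' z j]), χ1 _ (by linarith [nm' z j])]
          exact ⟨rfl, rfl⟩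
        · left
          push Not at hX
          have po := psi_out hr hRb1 (xmap h o z) hzB.1 x0 (a := rIn - 1) (by linarith) hX.le
          simp only [hφ, Ex]
          gcongr
          rw [hψ, hε]
          refine po.trans ?_
          rw [hrIn]; exact na9 hA1
  have S1 := CZ.trans (sum_le_sum fun z _ => PT z)
  rw [sum_add_distrib, sum_add_distrib, ← mul_sum, ← sum_filter, ← sum_filter, ← mul_sum, ← mul_sum] at S1
  have S2 : Real.exp (2 * (τ * Real.exp (lam * -A))) *
        ∑ z ∈ boxZ (Fin (d + 1)) Q with (1 ≤ z 0 ∧ h * z 0 ≤ 1 ∧ ∀ i : Fin d, |h * z i.succ - zc i| ≤ L), u z ^ 2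
      ≤ ∑ z ∈ boxZ (Fin (d + 1)) Q, w z ^ 2 := by
    rw [mul_sum]
    refine le_trans (sum_le_sum fun z hz => ?_) (sum_le_sum_of_subset_of_nonneg (filter_subset _ _) fun _ _ _ => sq_nonneg _)
    obtain ⟨-, hz1, hz2, hz3⟩ := mem_filter.1 hz
    have x0 : 0 ≤ xmap h o z 0 := by rw [ho, xm0]; exact na11 hh hz1
    have x1 : xmap h o z 0 ≤ 1 := by rw [ho, xm0]; linarith
    have xs : ∀ i : Fin d, |xmap h o z i.succ| ≤ L := fun i => by rw [ho, xms]; exact hz3 i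
    have pin := psi_in hr hRb1 hL (xmap h o z) x0 x1 xs
    have nr : ‖xmap h o z‖ ≤ rIn := by
      rw [pi_norm_le_iff_of_nonneg (by linarith)]
      intro i
      rw [Real.norm_eq_abs]
      refine Fin.cases ?_ (fun i => ?_) i
      · rw [abs_of_nonneg x0]; linarith
      · exact (xs i).trans (by rw [hrIn]; exact na10 hA i)
    have we : w z ^ 2 = Real.exp (2 * φ z) * u z ^ 2 := by
      simp only [hw, χ1 _ nr, one_mul, mul_pow]
      rw [← Real.exp_nat_mul]; push_cast; rfl
    rw [we]
    gcongr
    simp only [hφ, Ex]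
    gcongr
    rw [hψ, hε, hA]; exact pin
  have S3 := mul_le_mul_of_nonneg_left S2 (by positivity : 0 ≤ m / 4 * σ ^ 3 * h)
  have S4 : σ ^ 3 * h = τ ^ 3 * h ^ 4 := by rw [hσ]; ring
  have S5 : ∀ a b : ℝ, m / 4 * τ ^ 3 * h ^ 4 * a * b = m / 4 * σ ^ 3 * h * (a * b) := fun a b => by rw [hσ]; ring
  rw [S5]
  linarith
end Carl

namespace Carl
open Finset

/-- energy density -/
def enrC {d : ℕ} (h : ℝ) (u : (Fin (d + 1) → ℤ) → ℂ) (z : Fin (d + 1) → ℤ) : ℝ :=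
  h ^ 2 * ‖u z‖ ^ 2 + ∑ j, (‖u (z + eZ j) - u z‖ ^ 2 + ‖u (z - eZ j) - u z‖ ^ 2)

lemma enrC_nonneg {d : ℕ} (h : ℝ) (u : (Fin (d + 1) → ℤ) → ℂ) (z : Fin (d + 1) → ℤ) :
    0 ≤ enrC h u z := add_nonneg (by positivity) (sum_nonneg fun _ _ => by positivity)

lemma nsq (a : ℂ) : ‖a‖ ^ 2 = a.re ^ 2 + a.im ^ 2 := by
  rw [Complex.sq_norm, Complex.normSq_apply]; ring

lemma enrC_eq {d : ℕ} (h : ℝ) (u : (Fin (d + 1) → ℤ) → ℂ) (z : Fin (d + 1) → ℤ) :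
    enrC h u z = enr h (fun z => (u z).re) z + enr h (fun z => (u z).im) z := by
  simp only [enrC, enr, nsq, Complex.sub_re, Complex.sub_im]
  have : ∀ a b c d : ℝ, (a + b) + (c + d) = (a + c) + (b + d) := fun a b c d => by ring
  rw [this, ← sum_add_distrib, mul_add]
  congr 1
  exact sum_congr rfl fun j _ => by ring

/-- local hypotheses -/
structure LocHypC (d : ℕ) (κ Rb h τ : ℝ) (zc : Fin d → ℝ) (u : (Fin (d + 1) → ℤ) → ℂ) (V1 V2 : (Fin (d + 1) → ℤ) → ℝ) (Q : ℕ) : Prop where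
  hh : 0 < h
  hκ : h ≤ κ
  hτ : τ * h ≤ κ
  hκτ : 1 ≤ κ * τ
  u0 : ∀ z, z 0 ≤ 0 → u z = 0
  eq : ∀ z, 1 ≤ z 0 →
    ∑ j, (u (z + eZ j) + u (z - eZ j) - 2 * u z) = ((h ^ 2 * (V1 z + V2 z) : ℝ) : ℂ) * u z
  v1 : ∀ z, ‖xmap h (offs h zc) z‖ ≤ Rb → |V1 z| ≤ κ * τ ^ 2
  v1d : ∀ z, ‖xmap h (offs h zc) z‖ ≤ Rb → ∀ j, |V1 (z + eZ j) - V1 z| ≤ κ * τ ^ 2 * h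
  v2 : ∀ z, ‖xmap h (offs h zc) z‖ ≤ Rb → V2 z ^ 2 ≤ κ * τ ^ 3
  hQ : ∀ z, ‖xmap h (offs h zc) z‖ ≤ Rb → ∀ i, |z i| ≤ Q

lemma LocHypC.re {d : ℕ} {κ Rb h τ : ℝ} {zc : Fin d → ℝ} {u : (Fin (d + 1) → ℤ) → ℂ} {V1 V2 : (Fin (d + 1) → ℤ) → ℝ} {Q : ℕ}
    (H : LocHypC d κ Rb h τ zc u V1 V2 Q) : LocHyp d κ Rb h τ zc (fun z => (u z).re) V1 V2 Q := by
  refine ⟨H.hh, H.hκ, H.hτ, H.hκτ, fun z hz => by simp [H.u0 z hz], fun z hz _ => ?_, H.v1, H.v1d, H.v2, H.hQ⟩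
  have := congrArg Complex.re (H.eq z hz)
  rw [Complex.re_ofReal_mul, Complex.re_sum] at this
  rw [← this]
  exact sum_congr rfl fun j _ => by simp

lemma LocHypC.im {d : ℕ} {κ Rb h τ : ℝ} {zc : Fin d → ℝ} {u : (Fin (d + 1) → ℤ) → ℂ} {V1 V2 : (Fin (d + 1) → ℤ) → ℝ} {Q : ℕ}
    (H : LocHypC d κ Rb h τ zc u V1 V2 Q) : LocHyp d κ Rb h τ zc (fun z => (u z).im) V1 V2 Q := by
  refine ⟨H.hh, H.hκ, H.hτ, H.hκτ, fun z hz => by simp [H.u0 z hz], fun z hz _ => ?_, H.v1, H.v1d, H.v2, H.hQ⟩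
  have := congrArg Complex.im (H.eq z hz)
  rw [Complex.im_ofReal_mul, Complex.im_sum] at this
  rw [← this]
  exact sum_congr rfl fun j _ => by simp

open scoped Classical in
/-- main local estimate, complex version -/
theorem locC (d : ℕ) (L r : ℝ) (hL : 0 < L) (hr : 0 < r) : ∃ C c κ Pin Pout Rb : ℝ,
    0 < C ∧ 0 < c ∧ 0 < κ ∧ κ ≤ 1 ∧ 0 < Pin ∧ Pout < Pin ∧ 1 ≤ Rb ∧
    ∀ h τ zc u V1 V2 Q, LocHypC d κ Rb h τ zc u V1 V2 Q →
      c * τ ^ 3 * h ^ 4 * Real.exp (2 * (τ * Pin)) *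
        ∑ z ∈ boxZ (Fin (d + 1)) Q with (1 ≤ z 0 ∧ h * z 0 ≤ 1 ∧ ∀ i : Fin d, |h * z i.succ - zc i| ≤ L), ‖u z‖ ^ 2
      ≤ C * h ^ 2 * Real.exp (2 * (τ * Pout)) *
          ∑ z ∈ boxZ (Fin (d + 1)) Q with (1 ≤ z 0 ∧ ‖xmap h (offs h zc) z‖ ≤ Rb), enrC h u z
        + C * τ * h * Real.exp (2 * τ) *
          ∑ z ∈ boxZ (Fin (d + 1)) Q with (z 0 = 0 ∧ ∑ i : Fin d, (h * z i.succ - zc i) ^ 2 < r ^ 2),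
            ‖u (z + eZ 0)‖ ^ 2 := by
  obtain ⟨C, c, κ, Pin, Pout, Rb, h1, h2, h3, h4, h5, h6, h7, H⟩ := loc d L r hL hr
  refine ⟨C, c, κ, Pin, Pout, Rb, h1, h2, h3, h4, h5, h6, h7, fun h τ zc u V1 V2 Q LH => ?_⟩
  have a := H h τ zc _ V1 V2 Q LH.re
  have b := H h τ zc _ V1 V2 Q LH.im
  simp only [enrC_eq, nsq, sum_add_distrib, mul_add]
  linarith
end Carl

namespace Carl
open Finset

/-- spectral data on the lattice -/
structure Spec (d n : ℕ) (h M : ℝ) (W : (Fin d → ℤ) → ℝ) (φ : Fin n → (Fin d → ℤ) → ℂ) (lam : Fin n → ℝ) : Prop where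
  hh : 0 < h
  W0 : ∀ k, 0 ≤ W k
  sm : ∀ i, Summable fun k => ‖φ i k‖ ^ 2
  orth : ∀ i j : Fin n, ∑' k, (starRingEnd ℂ) (φ i k) * φ j k = if i = j then 1 else 0
  eig : ∀ i k, ∑ j, (φ i (k + eZ j) + φ i (k - eZ j) - 2 * φ i k) = ((h ^ 2 * (W k - lam i) : ℝ) : ℂ) * φ i k
  le : ∀ i, lam i ≤ M

/-- linear combination -/
def comb {d n : ℕ} (φ : Fin n → (Fin d → ℤ) → ℂ) (c : Fin n → ℂ) (k : Fin d → ℤ) : ℂ := ∑ i, c i * φ i k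

/-- coefficient square sum -/
def cS {n : ℕ} (c : Fin n → ℂ) : ℝ := ∑ i, ‖c i‖ ^ 2

lemma summable_ip {G : Type*} {u v : G → ℂ} (hu : Summable fun k => ‖u k‖ ^ 2) (hv : Summable fun k => ‖v k‖ ^ 2) :
    Summable fun k => (starRingEnd ℂ) (u k) * v k := by
  apply Summable.of_norm
  refine Summable.of_nonneg_of_le (fun _ => norm_nonneg _) (fun k => ?_) (hu.add hv)
  rw [norm_mul, RCLike.norm_conj]
  nlinarith [sq_nonneg (‖u k‖ - ‖v k‖), sq_nonneg (‖u k‖), sq_nonneg (‖v k‖)]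

lemma comb_bound {d n : ℕ} (φ : Fin n → (Fin d → ℤ) → ℂ) (c : Fin n → ℂ) (k : Fin d → ℤ) :
    ‖comb φ c k‖ ^ 2 ≤ n * ∑ i, ‖c i‖ ^ 2 * ‖φ i k‖ ^ 2 := by
  have h1 : ‖comb φ c k‖ ≤ ∑ i, ‖c i * φ i k‖ := norm_sum_le _ _
  calc ‖comb φ c k‖ ^ 2 ≤ (∑ i, ‖c i * φ i k‖) ^ 2 := by gcongr
    _ ≤ (Finset.univ : Finset (Fin n)).card * ∑ i, ‖c i * φ i k‖ ^ 2 := sq_sum_le_card_mul_sum_sq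
    _ = _ := by simp [mul_pow]

section
variable {d n : ℕ} {h M : ℝ} {W : (Fin d → ℤ) → ℝ} {φ : Fin n → (Fin d → ℤ) → ℂ} {lam : Fin n → ℝ}

lemma Spec.csm (H : Spec d n h M W φ lam) (c : Fin n → ℂ) : Summable fun k => ‖comb φ c k‖ ^ 2 :=
  Summable.of_nonneg_of_le (fun _ => by positivity) (comb_bound φ c)
    ((summable_sum fun i _ => (H.sm i).mul_left _).mul_left _)

lemma Spec.hasIp (H : Spec d n h M W φ lam) (c b : Fin n → ℂ) :
    HasSum (fun k => (starRingEnd ℂ) (comb φ c k) * comb φ b k) (∑ i, (starRingEnd ℂ) (c i) * b i) := by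
  have h1 : ∀ i j, HasSum (fun k => (starRingEnd ℂ) (c i) * b j * ((starRingEnd ℂ) (φ i k) * φ j k))
      ((starRingEnd ℂ) (c i) * b j * (if i = j then 1 else 0)) := fun i j => by
    rw [← H.orth i j]
    exact ((summable_ip (H.sm i) (H.sm j)).hasSum).mul_left _
  have h2 := hasSum_sum (s := univ) fun i _ => hasSum_sum (s := univ) fun j _ => h1 i j
  convert h2 using 1
  · funext k
    simp only [comb, map_sum, map_mul, sum_mul_sum]
    exact sum_congr rfl fun i _ => sum_congr rfl fun j _ => by ring
  · simp

lemma Spec.hasN (H : Spec d n h M W φ lam) (c : Fin n → ℂ) : HasSum (fun k => ‖comb φ c k‖ ^ 2) (cS c) := by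
  have := Complex.hasSum_re (H.hasIp c c)
  convert this using 1
  · funext k
    rw [mul_comm, Complex.mul_conj, Complex.ofReal_re, Complex.sq_norm]
  · rw [cS, Complex.re_sum]
    exact sum_congr rfl fun i _ => by rw [mul_comm, Complex.mul_conj, Complex.ofReal_re, Complex.sq_norm]

lemma Spec.ceq (H : Spec d n h M W φ lam) (c : Fin n → ℂ) (k : Fin d → ℤ) :
    ∑ j, (comb φ c (k + eZ j) + comb φ c (k - eZ j) - 2 * comb φ c k)
      = ((h ^ 2 : ℝ) : ℂ) * (W k * comb φ c k - comb φ (fun i => lam i * c i) k) := by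
  have : ∀ i, c i * ∑ j, (φ i (k + eZ j) + φ i (k - eZ j) - 2 * φ i k) = c i * (((h ^ 2 * (W k - lam i) : ℝ) : ℂ) * φ i k) :=
    fun i => by rw [H.eig]
  have h2 := sum_congr (s₁ := univ) rfl fun i _ => this i
  simp only [mul_sum] at h2
  rw [sum_comm] at h2
  simp only [comb, mul_sum, ← sum_add_distrib, ← sum_sub_distrib]
  convert h2 using 1
  · exact sum_congr rfl fun j _ => sum_congr rfl fun i _ => by ring
  · exact sum_congr rfl fun i _ => by push_cast; ring

lemma normsq_sub (a b : ℂ) : ‖a - b‖ ^ 2 = ‖a‖ ^ 2 + ‖b‖ ^ 2 - 2 * ((starRingEnd ℂ) b * a).re := by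
  rw [nsq, nsq, nsq]; simp; ring

/-- difference square sums -/
def pD (φ : Fin n → (Fin d → ℤ) → ℂ) (c : Fin n → ℂ) (j : Fin d) : ℝ :=
  ∑' k, ‖comb φ c (k + eZ j) - comb φ c k‖ ^ 2

lemma Spec.en (H : Spec d n h M W φ lam) (c : Fin n → ℂ) :
    (∀ j, HasSum (fun k => ‖comb φ c (k + eZ j) - comb φ c k‖ ^ 2) (pD φ c j)) ∧
    (∀ j, HasSum (fun k => ‖comb φ c (k - eZ j) - comb φ c k‖ ^ 2) (pD φ c j)) ∧
    ∃ w, HasSum (fun k => W k * ‖comb φ c k‖ ^ 2) w ∧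
      ∑ j, pD φ c j + h ^ 2 * w = h ^ 2 * ∑ i, lam i * ‖c i‖ ^ 2 := by
  have hN := H.hasN c
  have hNs : ∀ j : Fin d, HasSum (fun k => ‖comb φ c (k + eZ j)‖ ^ 2) (cS c) := fun j =>
    ((Equiv.addRight (eZ j : Fin d → ℤ)).hasSum_iff (f := fun k => ‖comb φ c k‖ ^ 2)).2 hN
  have hP : ∀ j : Fin d, Summable fun k => ((starRingEnd ℂ) (comb φ c k) * comb φ c (k + eZ j)).re := fun j =>
    (Complex.hasSum_re (summable_ip hN.summable (hNs j).summable).hasSum).summable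
  have hD : ∀ j, HasSum (fun k => ‖comb φ c (k + eZ j) - comb φ c k‖ ^ 2)
      (cS c + cS c - 2 * ∑' k, ((starRingEnd ℂ) (comb φ c k) * comb φ c (k + eZ j)).re) := fun j => by
    simp only [normsq_sub]
    exact ((hNs j).add hN).sub ((hP j).hasSum.mul_left 2)
  have hDv : ∀ j, pD φ c j = cS c + cS c - 2 * ∑' k, ((starRingEnd ℂ) (comb φ c k) * comb φ c (k + eZ j)).re :=
    fun j => (hD j).tsum_eq
  have hP' : ∀ j : Fin d, HasSum (fun k => ((starRingEnd ℂ) (comb φ c k) * comb φ c (k - eZ j)).re)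
      (∑' k, ((starRingEnd ℂ) (comb φ c k) * comb φ c (k + eZ j)).re) := fun j => by
    have := ((Equiv.subRight (eZ j : Fin d → ℤ)).hasSum_iff
      (f := fun k => ((starRingEnd ℂ) (comb φ c k) * comb φ c (k + eZ j)).re)).2 (hP j).hasSum
    convert this using 1
    funext k
    simp [mul_comm]
  refine ⟨fun j => (hDv j) ▸ hD j, fun j => ?_, ?_⟩
  · have := ((Equiv.subRight (eZ j : Fin d → ℤ)).hasSum_iff
      (f := fun k => ‖comb φ c (k + eZ j) - comb φ c k‖ ^ 2)).2 ((hDv j) ▸ hD j)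
    convert this using 1
    funext k
    simp only [Function.comp, Equiv.subRight_apply, sub_add_cancel]
    rw [norm_sub_rev]
  · have hT : HasSum (fun k => ((starRingEnd ℂ) (comb φ c k) * comb φ (fun i => lam i * c i) k).re)
        (∑ i, lam i * ‖c i‖ ^ 2) := by
      convert Complex.hasSum_re (H.hasIp c (fun i => lam i * c i)) using 1
      rw [Complex.re_sum]
      refine sum_congr rfl fun i _ => ?_
      rw [nsq]; simp; ring
    have hsum : HasSum (fun k => ∑ j, (((starRingEnd ℂ) (comb φ c k) * comb φ c (k + eZ j)).re
        + ((starRingEnd ℂ) (comb φ c k) * comb φ c (k - eZ j)).re - 2 * ‖comb φ c k‖ ^ 2)) (∑ j, (- pD φ c j)) := by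
      refine hasSum_sum fun j _ => ?_
      have := (((hP j).hasSum).add (hP' j)).sub (hN.mul_left 2)
      have e3 : ∀ x y z : ℝ, x = y + y - 2 * z → -x = z + z - 2 * y := fun x y z e => by linarith
      rw [e3 _ _ _ (hDv j)]
      exact this
    have hk : ∀ k, W k * ‖comb φ c k‖ ^ 2 = (h ^ 2)⁻¹ * ∑ j, (((starRingEnd ℂ) (comb φ c k) * comb φ c (k + eZ j)).re
        + ((starRingEnd ℂ) (comb φ c k) * comb φ c (k - eZ j)).re - 2 * ‖comb φ c k‖ ^ 2)
        + ((starRingEnd ℂ) (comb φ c k) * comb φ (fun i => lam i * c i) k).re := fun k => by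
      have e := congrArg (fun x => ((starRingEnd ℂ) (comb φ c k) * x).re) (H.ceq c k)
      simp only [mul_sum, Complex.re_sum] at e
      have e1 : ∀ j, ((starRingEnd ℂ) (comb φ c k) * (comb φ c (k + eZ j) + comb φ c (k - eZ j) - 2 * comb φ c k)).re
        = (((starRingEnd ℂ) (comb φ c k) * comb φ c (k + eZ j)).re
        + ((starRingEnd ℂ) (comb φ c k) * comb φ c (k - eZ j)).re - 2 * ‖comb φ c k‖ ^ 2) := fun j => by
        rw [nsq]; simp; ring
      simp only [e1] at e
      rw [e]
      have e2 : ((starRingEnd ℂ) (comb φ c k) * (((h ^ 2 : ℝ) : ℂ) * (W k * comb φ c k - comb φ (fun i => lam i * c i) k))).re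
        = h ^ 2 * (W k * ‖comb φ c k‖ ^ 2 - ((starRingEnd ℂ) (comb φ c k) * comb φ (fun i => lam i * c i) k).re) := by
        rw [mul_left_comm, Complex.re_ofReal_mul, nsq]; congr 1; simp; ring
      rw [e2, inv_mul_cancel_left₀ (pow_ne_zero 2 H.hh.ne')]; ring
    have hfin := (hsum.mul_left (h ^ 2)⁻¹).add hT
    simp only [← hk] at hfin
    refine ⟨_, hfin, ?_⟩
    · rw [mul_add, mul_inv_cancel_left₀ (pow_ne_zero 2 H.hh.ne'), sum_neg_distrib]; ring

lemma pD_nonneg (c : Fin n → ℂ) (j : Fin d) : 0 ≤ pD φ c j := tsum_nonneg fun _ => by positivity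

lemma cS_nonneg (c : Fin n → ℂ) : 0 ≤ cS c := sum_nonneg fun _ _ => by positivity

lemma Spec.lam_nonneg (H : Spec d n h M W φ lam) (i : Fin n) : 0 ≤ lam i := by
  obtain ⟨_, _, w, hw, he⟩ := H.en (Pi.single i 1)
  have hw0 : 0 ≤ w := hw.nonneg fun k => mul_nonneg (H.W0 k) (by positivity)
  have h1 : ∑ i', lam i' * ‖(Pi.single i 1 : Fin n → ℂ) i'‖ ^ 2 = lam i := by
    rw [sum_eq_single i]
    · simp
    · intro b _ hb; simp [hb]
    · simp
  rw [h1] at he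
  have h2 : 0 ≤ ∑ j : Fin d, pD φ (Pi.single i 1) j := sum_nonneg fun j _ => pD_nonneg _ j
  have hh := pow_pos H.hh 2
  have : 0 ≤ h ^ 2 * lam i := by rw [← he]; positivity
  exact nonneg_of_mul_nonneg_right this hh

lemma Spec.pD_le (H : Spec d n h M W φ lam) (c : Fin n → ℂ) : ∑ j, pD φ c j ≤ h ^ 2 * (M * cS c) := by
  obtain ⟨_, _, w, hw, he⟩ := H.en c
  have hw0 : 0 ≤ w := hw.nonneg fun k => mul_nonneg (H.W0 k) (by positivity)
  have hT : ∑ i, lam i * ‖c i‖ ^ 2 ≤ M * cS c := by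
    rw [cS, mul_sum]; exact sum_le_sum fun i _ => by gcongr; exact H.le i
  have := mul_le_mul_of_nonneg_left hT (sq_nonneg h)
  have := mul_nonneg (sq_nonneg h) hw0
  linarith

lemma Spec.W_le (H : Spec d n h M W φ lam) (c : Fin n → ℂ) :
    Summable (fun k => W k * ‖comb φ c k‖ ^ 2) ∧ ∑' k, W k * ‖comb φ c k‖ ^ 2 ≤ M * cS c := by
  obtain ⟨_, _, w, hw, he⟩ := H.en c
  refine ⟨hw.summable, ?_⟩
  rw [hw.tsum_eq]
  have hT : ∑ i, lam i * ‖c i‖ ^ 2 ≤ M * cS c := by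
    rw [cS, mul_sum]; exact sum_le_sum fun i _ => by gcongr; exact H.le i
  have h2 : 0 ≤ ∑ j : Fin d, pD φ c j := sum_nonneg fun j _ => pD_nonneg _ j
  have hh := pow_pos H.hh 2
  have : h ^ 2 * w ≤ h ^ 2 * (M * cS c) := by
    have := mul_le_mul_of_nonneg_left hT (sq_nonneg h)
    linarith
  exact le_of_mul_le_mul_left this hh

/-- confinement -/
lemma Spec.conf (H : Spec d n h M W φ lam) (hM : 0 < M) (c : Fin n → ℂ) (X : Finset (Fin d → ℤ))
    (hX : ∀ k, k ∉ X → 2 * M ≤ W k) : cS c / 2 ≤ ∑ k ∈ X, ‖comb φ c k‖ ^ 2 := by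
  obtain ⟨hs, hle⟩ := H.W_le c
  have hN := H.hasN c
  have h1 := (hN.summable).sum_add_tsum_compl (s := X)
  rw [hN.tsum_eq] at h1
  have h2 : ∑' k : ↑(X : Set (Fin d → ℤ))ᶜ, ‖comb φ c k‖ ^ 2 ≤ ∑' k : ↑(X : Set (Fin d → ℤ))ᶜ, (2 * M)⁻¹ * (W k * ‖comb φ c k‖ ^ 2) := by
    refine Summable.tsum_le_tsum (fun k => ?_) (hN.summable.subtype _) ((hs.mul_left _).subtype _)
    have : 2 * M ≤ W k := hX k (fun hk => k.2 (by simpa using hk))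
    rw [← mul_assoc]
    refine le_mul_of_one_le_left (by positivity) ?_
    rw [inv_mul_eq_div, le_div_iff₀ (by positivity)]; linarith
  have h3 : ∑' k : ↑(X : Set (Fin d → ℤ))ᶜ, (2 * M)⁻¹ * (W k * ‖comb φ c k‖ ^ 2) ≤ ∑' k, (2 * M)⁻¹ * (W k * ‖comb φ c k‖ ^ 2) :=
    Summable.tsum_subtype_le _ _ (fun k => mul_nonneg (by positivity) (mul_nonneg (H.W0 k) (by positivity))) (hs.mul_left _)
  rw [tsum_mul_left, tsum_mul_left] at h3
  rw [tsum_mul_left] at h2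
  have h4 : (2 * M)⁻¹ * ∑' k, W k * ‖comb φ c k‖ ^ 2 ≤ (2 * M)⁻¹ * (M * cS c) := by gcongr
  have h5 : (2 * M)⁻¹ * (M * cS c) = cS c / 2 := by field_simp
  linarith
end
end Carl

namespace Carl
open Finset

/-- transfer recursion -/
def ab (h l : ℝ) : ℕ → ℝ × ℝ
  | 0 => (0, 1)
  | m + 1 => ((ab h l m).1 + h * (ab h l m).2, (ab h l m).2 + h * l * ((ab h l m).1 + h * (ab h l m).2))

/-- solution -/
def am (h l : ℝ) (m : ℕ) : ℝ := (ab h l m).1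
/-- its difference quotient -/
def bm (h l : ℝ) (m : ℕ) : ℝ := (ab h l m).2

lemma am_zero (h l : ℝ) : am h l 0 = 0 := rfl
lemma bm_zero (h l : ℝ) : bm h l 0 = 1 := rfl
lemma am_succ (h l : ℝ) (m : ℕ) : am h l (m + 1) = am h l m + h * bm h l m := rfl
lemma bm_succ (h l : ℝ) (m : ℕ) : bm h l (m + 1) = bm h l m + h * l * am h l (m + 1) := rfl
lemma am_one (h l : ℝ) : am h l 1 = h := by rw [am_succ, am_zero, bm_zero]; ring

lemma am_rec (h l : ℝ) (m : ℕ) : am h l (m + 2) + am h l m - 2 * am h l (m + 1) = h ^ 2 * l * am h l (m + 1) := by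
  rw [am_succ h l (m + 1), bm_succ, am_succ h l m]; ring

lemma ab_lower {h l : ℝ} (hh : 0 < h) (hl : 0 ≤ l) (m : ℕ) : m * h ≤ am h l m ∧ 1 ≤ bm h l m := by
  induction m with
  | zero => simp [am_zero, bm_zero]
  | succ m ih =>
    obtain ⟨h1, h2⟩ := ih
    have h3 : ((m + 1 : ℕ) : ℝ) * h ≤ am h l (m + 1) := by
      rw [am_succ]; push_cast
      have : h * 1 ≤ h * bm h l m := by gcongr
      linarith
    refine ⟨h3, ?_⟩
    rw [bm_succ]
    have : 0 ≤ am h l (m + 1) := le_trans (by positivity) h3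
    have : 0 ≤ h * l * am h l (m + 1) := by positivity
    linarith

lemma ab_step {a b s : ℝ} (ha : 0 ≤ a) (hb : 0 ≤ b) (hs : 0 ≤ s) (hs1 : s ≤ 1) :
    (1 + s) * (a + s * b) + b ≤ (1 + 2 * s) * (a + b) := by
  nlinarith [mul_nonneg hs ha, mul_nonneg (mul_nonneg hs hb) (sub_nonneg.2 hs1)]

lemma ab_upper {h l ℓ : ℝ} (hh : 0 < h) (hl : 0 ≤ l) (hℓ : 0 ≤ ℓ) (hlℓ : l ≤ ℓ ^ 2) (h1 : ℓ * h ≤ 1) (m : ℕ) :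
    ℓ * am h l m + bm h l m ≤ Real.exp (2 * ℓ * h * m) := by
  induction m with
  | zero => simp [am_zero, bm_zero]
  | succ m ih =>
    obtain ⟨p1, p2⟩ := ab_lower hh hl m
    have p1' : 0 ≤ am h l m := le_trans (by positivity) p1
    have p2' : 0 ≤ bm h l m := by linarith
    have st := ab_step (mul_nonneg hℓ p1') p2' (mul_nonneg hℓ hh.le) h1
    have e1 : h * l * am h l (m + 1) ≤ h * ℓ ^ 2 * am h l (m + 1) := by
      have : 0 ≤ am h l (m + 1) := le_trans (by positivity) (ab_lower hh hl (m + 1)).1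
      gcongr
    have e2 : 1 + 2 * (ℓ * h) ≤ Real.exp (2 * ℓ * h) := by
      have := Real.add_one_le_exp (2 * ℓ * h); linarith
    have e3 : (1 + 2 * (ℓ * h)) * (ℓ * am h l m + bm h l m) ≤ Real.exp (2 * ℓ * h) * Real.exp (2 * ℓ * h * m) := by
      gcongr
    rw [← Real.exp_add] at e3
    have e4 : 2 * ℓ * h * ((m + 1 : ℕ) : ℝ) = 2 * ℓ * h + 2 * ℓ * h * m := by push_cast; ring
    rw [e4, bm_succ]
    rw [am_succ] at e1 ⊢
    nlinarith

section
variable {d n : ℕ} {h M : ℝ} {W : (Fin d → ℤ) → ℝ} {φ : Fin n → (Fin d → ℤ) → ℂ} {lam : Fin n → ℝ}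

/-- row coefficients -/
def rc (h : ℝ) (lam : Fin n → ℝ) (c : Fin n → ℂ) (m : ℕ) (i : Fin n) : ℂ := c i * (am h (lam i) m : ℂ)

/-- the extension -/
def Uf (h : ℝ) (φ : Fin n → (Fin d → ℤ) → ℂ) (lam : Fin n → ℝ) (c : Fin n → ℂ) (z : Fin (d + 1) → ℤ) : ℂ :=
  comb φ (rc h lam c (z 0).toNat) (Fin.tail z)

lemma comb_zero (k : Fin d → ℤ) : comb φ (0 : Fin n → ℂ) k = 0 := by simp [comb]

lemma rc_zero (c : Fin n → ℂ) : rc h lam c 0 = 0 := by funext i; simp [rc, am_zero]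

lemma Uf_zero (c : Fin n → ℂ) (z : Fin (d + 1) → ℤ) (hz : z 0 ≤ 0) : Uf h φ lam c z = 0 := by
  rw [Uf, Int.toNat_of_nonpos hz, rc_zero, comb_zero]

lemma Uf_cons (c : Fin n → ℂ) (m : ℕ) (x : Fin d → ℤ) :
    Uf h φ lam c (Fin.cons (m : ℤ) x) = comb φ (rc h lam c m) x := by
  simp [Uf]

lemma cons_add_zero (m : ℤ) (x : Fin d → ℤ) : (Fin.cons m x + eZ 0 : Fin (d + 1) → ℤ) = Fin.cons (m + 1) x := by
  funext i; refine Fin.cases ?_ (fun i => ?_) i <;> simp [eZ]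

lemma cons_sub_zero (m : ℤ) (x : Fin d → ℤ) : (Fin.cons m x - eZ 0 : Fin (d + 1) → ℤ) = Fin.cons (m - 1) x := by
  funext i; refine Fin.cases ?_ (fun i => ?_) i <;> simp [eZ]

lemma cons_add_succ (m : ℤ) (x : Fin d → ℤ) (j : Fin d) : (Fin.cons m x + eZ j.succ : Fin (d + 1) → ℤ) = Fin.cons m (x + eZ j) := by
  funext i; refine Fin.cases ?_ (fun i => ?_) i <;> simp [eZ, Pi.single_apply]

lemma cons_sub_succ (m : ℤ) (x : Fin d → ℤ) (j : Fin d) : (Fin.cons m x - eZ j.succ : Fin (d + 1) → ℤ) = Fin.cons m (x - eZ j) := by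
  funext i; refine Fin.cases ?_ (fun i => ?_) i <;> simp [eZ, Pi.single_apply]

lemma cons_form (z : Fin (d + 1) → ℤ) (hz : 1 ≤ z 0) : ∃ m : ℕ, z = Fin.cons ((m + 1 : ℕ) : ℤ) (Fin.tail z) := by
  refine ⟨(z 0 - 1).toNat, ?_⟩
  funext i; refine Fin.cases ?_ (fun i => ?_) i
  · simp; omega
  · simp [Fin.tail]

lemma Uf_succ_cons (c : Fin n → ℂ) (m : ℕ) (x : Fin d → ℤ) :
    Uf h φ lam c (Fin.cons (((m + 1 : ℕ) : ℤ) + 1) x) = comb φ (rc h lam c (m + 2)) x := by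
  rw [← Uf_cons]; push_cast; congr 2

lemma Uf_pred_cons (c : Fin n → ℂ) (m : ℕ) (x : Fin d → ℤ) :
    Uf h φ lam c (Fin.cons (((m + 1 : ℕ) : ℤ) - 1) x) = comb φ (rc h lam c m) x := by
  rw [← Uf_cons]; push_cast; congr 2; ring

lemma Spec.Ueq (H : Spec d n h M W φ lam) (c : Fin n → ℂ) (z : Fin (d + 1) → ℤ) (hz : 1 ≤ z 0) :
    ∑ j, (Uf h φ lam c (z + eZ j) + Uf h φ lam c (z - eZ j) - 2 * Uf h φ lam c z)
      = ((h ^ 2 * W (Fin.tail z) : ℝ) : ℂ) * Uf h φ lam c z := by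
  obtain ⟨m, hm⟩ := cons_form z hz
  obtain ⟨x, hx⟩ : ∃ x, x = Fin.tail z := ⟨_, rfl⟩
  rw [← hx] at hm ⊢
  rw [hm, Fin.sum_univ_succ]
  simp only [cons_add_zero, cons_sub_zero, cons_add_succ, cons_sub_succ, Uf_succ_cons, Uf_pred_cons, Uf_cons]
  rw [H.ceq]
  have e : comb φ (rc h lam c (m + 2)) x + comb φ (rc h lam c m) x - 2 * comb φ (rc h lam c (m + 1)) x
      = ((h ^ 2 : ℝ) : ℂ) * comb φ (fun i => lam i * rc h lam c (m + 1) i) x := by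
    simp only [comb, mul_sum, ← sum_add_distrib, ← sum_sub_distrib]
    refine sum_congr rfl fun i _ => ?_
    have := congrArg (fun t : ℝ => (t : ℂ)) (am_rec h (lam i) m)
    push_cast at this
    simp only [rc]
    push_cast
    linear_combination (c i * φ i x) * this
  rw [e]; push_cast; ring

lemma cS_mul_le (c : Fin n → ℂ) (g : Fin n → ℝ) (B : ℝ) (hg : ∀ i, 0 ≤ g i) (hB : ∀ i, g i ≤ B) :
    cS (fun i => c i * (g i : ℂ)) ≤ B ^ 2 * cS c := by
  rw [cS, cS, mul_sum]
  refine sum_le_sum fun i _ => ?_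
  rw [norm_mul, mul_pow, Complex.norm_real, Real.norm_eq_abs, sq_abs, mul_comm]
  have := hg i; have := hB i
  gcongr

lemma le_cS_mul (c : Fin n → ℂ) (g : Fin n → ℝ) (B : ℝ) (hB0 : 0 ≤ B) (hB : ∀ i, B ≤ g i) :
    B ^ 2 * cS c ≤ cS (fun i => c i * (g i : ℂ)) := by
  rw [cS, cS, mul_sum]
  refine sum_le_sum fun i _ => ?_
  rw [norm_mul, mul_pow, Complex.norm_real, Real.norm_eq_abs, sq_abs, mul_comm (‖c i‖ ^ 2)]
  have := hB i
  gcongr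

lemma Spec.rc_lower (H : Spec d n h M W φ lam) (c : Fin n → ℂ) (m : ℕ) :
    (m * h) ^ 2 * cS c ≤ cS (rc h lam c m) :=
  le_cS_mul c _ _ (mul_nonneg (by positivity) H.hh.le) fun i => (ab_lower H.hh (H.lam_nonneg i) m).1

lemma comb_one (c : Fin n → ℂ) (x : Fin d → ℤ) : comb φ (rc h lam c 1) x = h * comb φ c x := by
  simp only [comb, rc, am_one, mul_sum]; exact sum_congr rfl fun i _ => by ring

lemma row_arith {h ℓ E S A B1 B2 D : ℝ} (hℓ : 1 ≤ ℓ) (hS : 0 ≤ S) (hh : 0 < h) (hA : A ≤ (E / ℓ) ^ 2 * S)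
    (hB1 : B1 ≤ (h * E) ^ 2 * S) (hB2 : B2 ≤ (h * E) ^ 2 * S) (hD : D ≤ h ^ 2 * (ℓ ^ 2 * A)) :
    h ^ 2 * A + (B1 + B2 + (D + D)) ≤ 5 * h ^ 2 * E ^ 2 * S := by
  have h1 : ℓ ^ 2 * A ≤ E ^ 2 * S := by
    calc ℓ ^ 2 * A ≤ ℓ ^ 2 * ((E / ℓ) ^ 2 * S) := by gcongr
      _ = _ := by field_simp
  have h0 : A ≤ E ^ 2 * S := by
    refine hA.trans ?_
    rw [div_pow]
    gcongr
    exact div_le_self (by positivity) (by nlinarith)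
  have := mul_le_mul_of_nonneg_left h1 (sq_nonneg h)
  have := mul_le_mul_of_nonneg_left h0 (sq_nonneg h)
  nlinarith

lemma Spec.row (H : Spec d n h M W φ lam) {ℓ : ℝ} (hℓ : 1 ≤ ℓ) (hM : M = ℓ ^ 2) (hℓh : ℓ * h ≤ 1) (c : Fin n → ℂ) (m : ℕ) :
    Summable (fun x => enrC h (Uf h φ lam c) (Fin.cons ((m + 1 : ℕ) : ℤ) x)) ∧
    ∑' x, enrC h (Uf h φ lam c) (Fin.cons ((m + 1 : ℕ) : ℤ) x)
      ≤ 5 * h ^ 2 * Real.exp (4 * ℓ * h * (m + 1 : ℕ)) * cS c := by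
  have e1 : ∀ x, enrC h (Uf h φ lam c) (Fin.cons ((m + 1 : ℕ) : ℤ) x) = h ^ 2 * ‖comb φ (rc h lam c (m + 1)) x‖ ^ 2 +
    ((‖comb φ (fun i => c i * ((h * bm h (lam i) (m + 1) : ℝ) : ℂ)) x‖ ^ 2 + ‖comb φ (fun i => c i * ((h * bm h (lam i) m : ℝ) : ℂ)) x‖ ^ 2)
     + ∑ j, (‖comb φ (rc h lam c (m + 1)) (x + eZ j) - comb φ (rc h lam c (m + 1)) x‖ ^ 2
        + ‖comb φ (rc h lam c (m + 1)) (x - eZ j) - comb φ (rc h lam c (m + 1)) x‖ ^ 2)) := fun x => by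
    rw [enrC, Fin.sum_univ_succ]
    simp only [cons_add_zero, cons_sub_zero, cons_add_succ, cons_sub_succ, Uf_succ_cons, Uf_pred_cons, Uf_cons]
    congr 4
    · congr 1
      simp only [comb, rc, ← sum_sub_distrib]
      exact sum_congr rfl fun i _ => by rw [am_succ _ _ (m + 1)]; push_cast; ring
    · rw [norm_sub_rev]
      congr 1
      simp only [comb, rc, ← sum_sub_distrib]
      exact sum_congr rfl fun i _ => by rw [am_succ _ _ m]; push_cast; ring
  obtain ⟨d1, d2, -⟩ := H.en (rc h lam c (m + 1))
  have hs := ((H.hasN (rc h lam c (m + 1))).mul_left (h ^ 2)).add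
    (((H.hasN (fun i => c i * ((h * bm h (lam i) (m + 1) : ℝ) : ℂ))).add (H.hasN (fun i => c i * ((h * bm h (lam i) m : ℝ) : ℂ)))).add
      (hasSum_sum (s := univ) fun j _ => (d1 j).add (d2 j)))
  simp only [← e1] at hs
  refine ⟨hs.summable, ?_⟩
  rw [hs.tsum_eq, sum_add_distrib]
  have hh := H.hh
  have up := fun i => ab_upper (m := m + 1) hh (H.lam_nonneg i) (by linarith : 0 ≤ ℓ) (hM ▸ H.le i) hℓh
  have up' := fun i => ab_upper (m := m) hh (H.lam_nonneg i) (by linarith : 0 ≤ ℓ) (hM ▸ H.le i) hℓh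
  have lo := fun i m => ab_lower hh (H.lam_nonneg i) m
  have a0 : ∀ i m, 0 ≤ am h (lam i) m := fun i m => le_trans (by positivity) (lo i m).1
  have b0 : ∀ i m, 0 ≤ bm h (lam i) m := fun i m => by linarith [(lo i m).2]
  have hE : Real.exp (2 * ℓ * h * (m : ℕ)) ≤ Real.exp (2 * ℓ * h * (m + 1 : ℕ)) := by
    apply Real.exp_le_exp.2; push_cast
    have : 0 ≤ 2 * ℓ * h := by positivity
    linarith
  have hE2 : Real.exp (4 * ℓ * h * (m + 1 : ℕ)) = Real.exp (2 * ℓ * h * (m + 1 : ℕ)) ^ 2 := by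
    rw [← Real.exp_nat_mul]; congr 1; push_cast; ring
  rw [hE2]
  refine row_arith hℓ (cS_nonneg c) hh ?_ ?_ ?_ (by rw [← hM]; exact H.pD_le _)
  · refine cS_mul_le c _ _ (fun i => a0 i _) fun i => ?_
    rw [le_div_iff₀ (by linarith)]
    linarith [up i, b0 i (m + 1)]
  · refine cS_mul_le c _ _ (fun i => mul_nonneg hh.le (b0 i _)) fun i => ?_
    have := mul_nonneg (by linarith : 0 ≤ ℓ) (a0 i (m + 1))
    have := up i
    gcongr; linarith
  · refine cS_mul_le c _ _ (fun i => mul_nonneg hh.le (b0 i _)) fun i => ?_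
    have := mul_nonneg (by linarith : 0 ≤ ℓ) (a0 i m)
    have := up' i
    gcongr; linarith
end
end Carl

namespace Carl
open Finset

lemma sum_overlap {α β : Type*} [DecidableEq α] (K : Finset β) (A : β → Finset α) (T : Finset α) (g : α → ℝ) (hg : ∀ z, 0 ≤ g z)
    (N : ℕ) (hT : ∀ k ∈ K, A k ⊆ T) (hN : ∀ z ∈ T, (K.filter fun k => z ∈ A k).card ≤ N) :
    ∑ k ∈ K, ∑ z ∈ A k, g z ≤ N * ∑ z ∈ T, g z := by
  have h1 : ∀ k ∈ K, ∑ z ∈ A k, g z = ∑ z ∈ T, if z ∈ A k then g z else 0 := fun k hk => by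
    rw [← sum_filter]
    refine sum_congr ?_ fun _ _ => rfl
    ext z; simp only [mem_filter]; exact ⟨fun h => ⟨hT k hk h, h⟩, fun h => h.2⟩
  rw [sum_congr rfl h1, sum_comm, mul_sum]
  refine sum_le_sum fun z hz => ?_
  rw [← sum_filter, sum_const, nsmul_eq_mul]
  have := hg z
  gcongr
  exact hN z hz

lemma sum_cover {α β : Type*} [DecidableEq α] (K : Finset β) (A : β → Finset α) (B : Finset α) (g : α → ℝ) (hg : ∀ z, 0 ≤ g z)
    (hB : ∀ z ∈ B, ∃ k ∈ K, z ∈ A k) : ∑ z ∈ B, g z ≤ ∑ k ∈ K, ∑ z ∈ A k, g z := by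
  have h1 : ∀ k ∈ K, ∑ z ∈ B, (if z ∈ A k then g z else 0) ≤ ∑ z ∈ A k, g z := fun k hk => by
    rw [← sum_filter]
    refine sum_le_sum_of_subset_of_nonneg ?_ fun _ _ _ => hg _
    intro z hz; exact (mem_filter.1 hz).2
  refine le_trans ?_ (sum_le_sum h1)
  rw [sum_comm]
  refine sum_le_sum fun z hz => ?_
  obtain ⟨k, hk, hz'⟩ := hB z hz
  have := single_le_sum (f := fun k => if z ∈ A k then g z else 0) (fun k _ => by split_ifs <;> simp [hg]) hk
  simpa [hz'] using this

lemma rows_le {d : ℕ} (s : Finset (Fin (d + 1) → ℤ)) (T : Finset ℕ) (g : (Fin (d + 1) → ℤ) → ℝ) (hg : ∀ z, 0 ≤ g z)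
    (hT : ∀ z ∈ s, ∃ m ∈ T, z 0 = (m : ℤ)) (hs : ∀ m ∈ T, Summable fun x : Fin d → ℤ => g (Fin.cons (m : ℤ) x)) :
    ∑ z ∈ s, g z ≤ ∑ m ∈ T, ∑' x : Fin d → ℤ, g (Fin.cons (m : ℤ) x) := by
  classical
  refine (sum_cover T (fun m => (s.image Fin.tail).image (fun x : Fin d → ℤ => (Fin.cons (m : ℤ) x : Fin (d + 1) → ℤ))) s g hg ?_).trans ?_
  · intro z hz
    obtain ⟨m, hm, e⟩ := hT z hz
    refine ⟨m, hm, mem_image.2 ⟨Fin.tail z, mem_image_of_mem _ hz, ?_⟩⟩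
    rw [← e]; exact Fin.cons_self_tail z
  · refine sum_le_sum fun m hm => ?_
    rw [sum_image]
    · exact (hs m hm).sum_le_tsum _ fun _ _ => hg _
    · intro x _ y _ hxy
      exact (Fin.cons_right_injective (α := fun _ => ℤ) (m : ℤ)) hxy

lemma card_overlap {d : ℕ} (K : Finset (Fin d → ℤ)) (y : Fin d → ℝ) {L ρ : ℝ} (hL : 0 < L) (P : (Fin d → ℤ) → Prop) [DecidablePred P]
    (hP : ∀ k, P k → ∀ i, |y i - L * k i| ≤ ρ) : (K.filter P).card ≤ (⌈2 * ρ / L⌉₊ + 1) ^ d := by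
  have hsub : K.filter P ⊆ Fintype.piFinset fun i => Finset.Icc ⌈(y i - ρ) / L⌉ ⌊(y i + ρ) / L⌋ := by
    intro k hk
    rw [Fintype.mem_piFinset]
    intro i
    have := abs_le.1 (hP k (mem_filter.1 hk).2 i)
    rw [Finset.mem_Icc, Int.ceil_le, Int.le_floor, div_le_iff₀ hL, le_div_iff₀ hL]
    constructor <;> nlinarith
  refine (card_le_card hsub).trans ?_
  rw [Fintype.card_piFinset]
  refine (Finset.prod_le_pow_card _ _ (⌈2 * ρ / L⌉₊ + 1) fun i _ => ?_).trans (by simp)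
  rw [Int.card_Icc]
  have h1 : (⌊(y i + ρ) / L⌋ : ℝ) ≤ (y i + ρ) / L := Int.floor_le _
  have h2 : (y i - ρ) / L ≤ ⌈(y i - ρ) / L⌉ := Int.le_ceil _
  have h3 : 2 * ρ / L ≤ ⌈2 * ρ / L⌉₊ := Nat.le_ceil _
  have h4 : (y i + ρ) / L = (y i - ρ) / L + 2 * ρ / L := by field_simp; ring
  have : ((⌊(y i + ρ) / L⌋ + 1 - ⌈(y i - ρ) / L⌉ : ℤ) : ℝ) ≤ ((⌈2 * ρ / L⌉₊ + 1 : ℕ) : ℤ) := by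
    push_cast; linarith
  have : ⌊(y i + ρ) / L⌋ + 1 - ⌈(y i - ρ) / L⌉ ≤ ((⌈2 * ρ / L⌉₊ + 1 : ℕ) : ℤ) := by exact_mod_cast this
  omega

section
variable {d n : ℕ} {h M : ℝ} {W : (Fin d → ℤ) → ℝ} {φ : Fin n → (Fin d → ℤ) → ℂ} {lam : Fin n → ℝ}

/-- lower bound over rows -/
lemma Spec.lower (H : Spec d n h M W φ lam) (hM : 0 < M) (hh4 : h ≤ 1 / 4) (c : Fin n → ℂ) (X : Finset (Fin d → ℤ))
    (hX : ∀ k, k ∉ X → 2 * M ≤ W k) :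
    cS c / (32 * h) ≤ ∑ m ∈ Finset.Ioc ⌊1 / (2 * h)⌋₊ (2 * ⌊1 / (2 * h)⌋₊), ∑ x ∈ X, ‖Uf h φ lam c (Fin.cons (m : ℤ) x)‖ ^ 2 := by
  have hh := H.hh
  obtain ⟨N, hN⟩ : ∃ N, N = ⌊1 / (2 * h)⌋₊ := ⟨_, rfl⟩
  rw [← hN]
  have hN1 : 1 / (2 * h) < N + 1 := by rw [hN]; exact Nat.lt_floor_add_one _
  have hS := cS_nonneg c
  have h1 : ∀ m ∈ Finset.Ioc N (2 * N), cS c / 8 ≤ ∑ x ∈ X, ‖Uf h φ lam c (Fin.cons (m : ℤ) x)‖ ^ 2 := fun m hm => by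
    simp only [Uf_cons]
    refine le_trans ?_ (H.conf hM _ X hX)
    have h2 := H.rc_lower c m
    have hm' : (N : ℝ) + 1 ≤ m := by exact_mod_cast (Finset.mem_Ioc.1 hm).1
    have h3 : 1 / 2 ≤ m * h := by
      rw [div_lt_iff₀ (by positivity)] at hN1
      nlinarith
    have h4 : (1 / 2 : ℝ) ^ 2 * cS c ≤ (m * h) ^ 2 * cS c := by gcongr
    linarith
  have h5 := card_nsmul_le_sum _ _ _ h1
  refine le_trans ?_ h5
  rw [Nat.card_Ioc, nsmul_eq_mul]
  have h6 : ((2 * N - N : ℕ) : ℝ) = N := by congr 1; omega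
  rw [h6]
  have h7 : 1 / (4 * h) ≤ N := by
    have e : 1 / (2 * h) = 1 / (4 * h) + 1 / (4 * h) := by field_simp; norm_num
    have : 1 ≤ 1 / (4 * h) := by rw [le_div_iff₀ (by positivity)]; linarith
    linarith
  calc cS c / (32 * h) = 1 / (4 * h) * (cS c / 8) := by field_simp; ring
    _ ≤ _ := by gcongr

/-- upper bound over rows -/
lemma Spec.upper (H : Spec d n h M W φ lam) {ℓ Rb : ℝ} (hℓ : 1 ≤ ℓ) (hM : M = ℓ ^ 2) (hℓh : ℓ * h ≤ 1) (hRb : 1 ≤ Rb) (hh1 : h ≤ 1) (c : Fin n → ℂ)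
    (T : Finset (Fin (d + 1) → ℤ)) (hT : ∀ z ∈ T, 1 ≤ z 0 ∧ h * z 0 ≤ Rb + 1) :
    ∑ z ∈ T, enrC h (Uf h φ lam c) z ≤ 5 * h * (Rb + 1) * Real.exp (4 * ℓ * (Rb + 1)) * cS c := by
  have hh := H.hh
  have hS := cS_nonneg c
  refine (rows_le T (Finset.Icc 1 ⌊(Rb + 1) / h⌋₊) _ (enrC_nonneg h _) ?_ ?_).trans ?_
  · intro z hz
    obtain ⟨h1, h2⟩ := hT z hz
    refine ⟨(z 0).toNat, ?_, by omega⟩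
    rw [Finset.mem_Icc]
    refine ⟨by omega, ?_⟩
    apply Nat.le_floor
    rw [le_div_iff₀ hh]
    have : (((z 0).toNat : ℤ) : ℝ) = z 0 := by congr 1; omega
    rw [Int.cast_natCast] at this
    rw [this]; linarith
  · intro m hm
    obtain ⟨m', rfl⟩ : ∃ m', m = m' + 1 := ⟨m - 1, by have := (Finset.mem_Icc.1 hm).1; omega⟩
    exact (H.row hℓ hM hℓh c m').1
  · have h1 : ∀ m ∈ Finset.Icc 1 ⌊(Rb + 1) / h⌋₊, ∑' x : Fin d → ℤ, enrC h (Uf h φ lam c) (Fin.cons (m : ℤ) x)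
        ≤ 5 * h ^ 2 * Real.exp (4 * ℓ * (Rb + 1)) * cS c := fun m hm => by
      have hm2 := (Nat.le_floor_iff (by positivity)).1 (Finset.mem_Icc.1 hm).2
      rw [le_div_iff₀ hh] at hm2
      obtain ⟨m', rfl⟩ : ∃ m', m = m' + 1 := ⟨m - 1, by have := (Finset.mem_Icc.1 hm).1; omega⟩
      refine (H.row hℓ hM hℓh c m').2.trans ?_
      gcongr 5 * h ^ 2 * Real.exp ?_ * cS c
      calc 4 * ℓ * h * ((m' + 1 : ℕ) : ℝ) = 4 * ℓ * (((m' + 1 : ℕ) : ℝ) * h) := by ring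
        _ ≤ _ := by gcongr
    refine (sum_le_card_nsmul _ _ _ h1).trans ?_
    rw [Nat.card_Icc, nsmul_eq_mul, Nat.add_sub_cancel]
    calc (⌊(Rb + 1) / h⌋₊ : ℝ) * (5 * h ^ 2 * Real.exp (4 * ℓ * (Rb + 1)) * cS c)
        ≤ ((Rb + 1) / h) * (5 * h ^ 2 * Real.exp (4 * ℓ * (Rb + 1)) * cS c) := by
          gcongr; exact Nat.floor_le (by positivity)
      _ = _ := by field_simp
end
end Carl

namespace Carl
open Finset

/-- cell data -/
structure CellHyp (d n : ℕ) (L r κ Rb h ℓ τ R : ℝ) (W V1 V2 : (Fin d → ℤ) → ℝ) (φ : Fin n → (Fin d → ℤ) → ℂ) (lam : Fin n → ℝ)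
    (zc : (Fin d → ℤ) → Fin d → ℝ) (O : Set (Fin d → ℤ)) : Prop where
  sp : Spec d n h (ℓ ^ 2) W φ lam
  hℓ : 1 ≤ ℓ
  hℓh : ℓ * h ≤ 1
  h4 : h ≤ 1 / 4
  hκ : h ≤ κ
  hτ : τ * h ≤ κ
  hκτ : 1 ≤ κ * τ
  hR : 0 ≤ R
  hz : ∀ k i, |zc k i - L * k i| ≤ L / 2
  cf : ∀ (k : Fin d → ℤ) i, R < |h * k i| → 2 * ℓ ^ 2 ≤ W k
  WV : ∀ k, W k = V1 k + V2 k
  v1 : ∀ k : Fin d → ℤ, (∀ i, |h * k i| ≤ R + (Rb + 3 * L)) → |V1 k| ≤ κ * τ ^ 2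
  v1d : ∀ k : Fin d → ℤ, (∀ i, |h * k i| ≤ R + (Rb + 3 * L)) → ∀ j, |V1 (k + eZ j) - V1 k| ≤ κ * τ ^ 2 * h
  v2 : ∀ k : Fin d → ℤ, (∀ i, |h * k i| ≤ R + (Rb + 3 * L)) → V2 k ^ 2 ≤ κ * τ ^ 3
  ob : ∀ k x : Fin d → ℤ, (∀ i, |h * x i - zc k i| ≤ r) → x ∈ O

section
variable {d n : ℕ} {L r κ Rb h ℓ τ R : ℝ} {W V1 V2 : (Fin d → ℤ) → ℝ} {φ : Fin n → (Fin d → ℤ) → ℂ} {lam : Fin n → ℝ}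
    {zc : (Fin d → ℤ) → Fin d → ℝ} {O : Set (Fin d → ℤ)}

/-- cell index bound -/
def NK (R L : ℝ) : ℕ := ⌈R / L⌉₊ + 1
/-- box size -/
def QQ (R Rb L h : ℝ) : ℕ := ⌈(R + Rb + 4 * L + 2) / h⌉₊

lemma cell_center (H : CellHyp d n L r κ Rb h ℓ τ R W V1 V2 φ lam zc O) (hL : 0 < L) (k : Fin d → ℤ)
    (hk : k ∈ boxZ (Fin d) (NK R L)) (i : Fin d) : |zc k i| ≤ R + 5 / 2 * L := by
  have h1 := H.hz k i
  have h2 : |(k i : ℝ)| ≤ NK R L := by exact_mod_cast (mem_boxZ.1 hk i)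
  have h3 : (NK R L : ℝ) ≤ R / L + 2 := by
    have := Nat.ceil_lt_add_one (div_nonneg H.hR hL.le)
    rw [NK]; push_cast; linarith
  have h4 : |L * (k i : ℝ)| ≤ R + 2 * L := by
    rw [abs_mul, abs_of_pos hL]
    calc L * |(k i : ℝ)| ≤ L * (R / L + 2) := by gcongr; linarith
      _ = _ := by field_simp
  have := abs_le.1 h1; have := abs_le.1 h4
  rw [abs_le]; constructor <;> linarith

lemma int_le_QQ (hh : 0 < h) (a : ℤ) (ha : |h * a| ≤ R + Rb + 4 * L + 2) : |a| ≤ (QQ R Rb L h : ℤ) := by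
  rw [abs_mul, abs_of_pos hh] at ha
  have h1 : |(a : ℝ)| ≤ (R + Rb + 4 * L + 2) / h := by rw [le_div_iff₀ hh]; linarith
  have h2 := h1.trans (Nat.le_ceil _)
  unfold QQ
  exact_mod_cast h2

lemma near_le (H : CellHyp d n L r κ Rb h ℓ τ R W V1 V2 φ lam zc O) (hL : 0 < L) (k : Fin d → ℤ)
    (hk : k ∈ boxZ (Fin d) (NK R L)) (z : Fin (d + 1) → ℤ) (hz : ‖xmap h (offs h (zc k)) z‖ ≤ Rb) :
    |h * z 0 - h / 2| ≤ Rb ∧ ∀ i : Fin d, |h * z i.succ - zc k i| ≤ Rb ∧ |h * z i.succ| ≤ R + (Rb + 3 * L) := by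
  have h0 := (norm_le_pi_norm (xmap h (offs h (zc k)) z) 0).trans hz
  rw [xm0, Real.norm_eq_abs] at h0
  refine ⟨h0, fun i => ?_⟩
  have h1 := (norm_le_pi_norm (xmap h (offs h (zc k)) z) i.succ).trans hz
  rw [xms, Real.norm_eq_abs] at h1
  refine ⟨h1, ?_⟩
  have := abs_le.1 h1; have := abs_le.1 (cell_center H hL k hk i)
  rw [abs_le]; constructor <;> linarith

lemma tail_add_zero (z : Fin (d + 1) → ℤ) : Fin.tail (z + eZ 0) = (Fin.tail z : Fin d → ℤ) := by
  funext i; simp [Fin.tail, eZ]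

lemma tail_add_succ (z : Fin (d + 1) → ℤ) (j : Fin d) : Fin.tail (z + eZ j.succ) = (Fin.tail z : Fin d → ℤ) + eZ j := by
  funext i; simp [Fin.tail, eZ, Pi.single_apply]

lemma CellHyp.loc (H : CellHyp d n L r κ Rb h ℓ τ R W V1 V2 φ lam zc O) (hL : 0 < L) (hκ0 : 0 < κ) (hRb : 1 ≤ Rb) (c : Fin n → ℂ) (k : Fin d → ℤ)
    (hk : k ∈ boxZ (Fin d) (NK R L)) :
    LocHypC d κ Rb h τ (zc k) (Uf h φ lam c) (fun z => V1 (Fin.tail z)) (fun z => V2 (Fin.tail z)) (QQ R Rb L h) where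
  hh := H.sp.hh
  hκ := H.hκ
  hτ := H.hτ
  hκτ := H.hκτ
  u0 := fun z hz => Uf_zero c z hz
  eq := fun z hz => by rw [H.sp.Ueq c z hz, H.WV]
  v1 := fun z hz => H.v1 _ fun i => ((near_le H hL k hk z hz).2 i).2
  v1d := fun z hz j => by
    refine Fin.cases ?_ (fun j => ?_) j
    · simp only [tail_add_zero, sub_self, abs_zero]
      have := H.sp.hh; positivity
    · simp only [tail_add_succ]
      exact H.v1d _ (fun i => ((near_le H hL k hk z hz).2 i).2) j
  v2 := fun z hz => H.v2 _ fun i => ((near_le H hL k hk z hz).2 i).2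
  hQ := fun z hz i => by
    have hR := H.hR
    have := near_le H hL k hk z hz
    have hh := H.sp.hh
    have h4 := H.h4
    apply int_le_QQ hh
    refine Fin.cases ?_ (fun i => ?_) i
    · have := abs_le.1 this.1
      rw [abs_le]; constructor <;> linarith
    · linarith [(this.2 i).2]

lemma cell_cover (H : CellHyp d n L r κ Rb h ℓ τ R W V1 V2 φ lam zc O) (hL : 0 < L) (hRb : 1 ≤ Rb) (x : Fin d → ℤ) (hx : ∀ i, |h * x i| ≤ R) :
    ∃ k ∈ boxZ (Fin d) (NK R L), ∀ i, |h * x i - zc k i| ≤ L := by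
  refine ⟨fun i => round (h * x i / L), mem_boxZ.2 fun i => ?_, fun i => ?_⟩
  · have h1 := abs_sub_round (h * x i / L)
    have h2 : |h * x i / L| ≤ R / L := by rw [abs_div, abs_of_pos hL]; gcongr; exact hx i
    have h3 := Nat.le_ceil (R / L)
    have : |((round (h * x i / L) : ℤ) : ℝ)| ≤ NK R L := by
      rw [NK]; push_cast
      have := abs_le.1 h1; have := abs_le.1 h2
      rw [abs_le]; constructor <;> linarith
    exact_mod_cast this
  · have h1 := abs_sub_round (h * x i / L)
    have h2 := H.hz (fun i => round (h * x i / L)) i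
    have h3 : |h * x i - L * (round (h * x i / L) : ℤ)| ≤ L / 2 := by
      have e : h * x i - L * (round (h * x i / L) : ℤ) = L * (h * x i / L - (round (h * x i / L) : ℤ)) := by field_simp
      rw [e, abs_mul, abs_of_pos hL]; nlinarith
    have := abs_le.1 h3; have := abs_le.1 h2
    rw [abs_le]; constructor <;> linarith

lemma cs_final {a b c' K1 K2 s1 s2 s3 S O' h : ℝ} (hh : 0 < h) (ha : 0 ≤ a) (hb : 0 ≤ b) (hc : 0 ≤ c')
    (h1 : a * h ^ 4 * s1 ≤ b * h ^ 2 * s2 + c' * h * s3) (e1 : S / (32 * h) ≤ s1) (e2 : s2 ≤ K1 * h * S) (e3 : s3 ≤ K2 * h ^ 2 * O') :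
    a / 32 * S ≤ b * K1 * S + c' * K2 * O' := by
  have f1 : a * h ^ 4 * (S / (32 * h)) ≤ a * h ^ 4 * s1 := by gcongr
  have f2 : b * h ^ 2 * s2 ≤ b * h ^ 2 * (K1 * h * S) := by gcongr
  have f3 : c' * h * s3 ≤ c' * h * (K2 * h ^ 2 * O') := by gcongr
  have e : a * h ^ 4 * (S / (32 * h)) = h ^ 3 * (a / 32 * S) := by field_simp
  have : h ^ 3 * (a / 32 * S) ≤ h ^ 3 * (b * K1 * S + c' * K2 * O') := by
    rw [← e]; nlinarith
  exact le_of_mul_le_mul_left this (by positivity)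

lemma cs_final' {a a' b b' c' c'' K1 K2 s1 s2 s3 S O' h : ℝ} (hh : 0 < h) (ha : 0 ≤ a * a') (hb : 0 ≤ b * b') (hc : 0 ≤ c' * c'')
    (h1 : a * h ^ 4 * a' * s1 ≤ b * h ^ 2 * b' * s2 + c' * h * c'' * s3) (e1 : S / (32 * h) ≤ s1) (e2 : s2 ≤ K1 * h * S) (e3 : s3 ≤ K2 * h ^ 2 * O') :
    a * a' / 32 * S ≤ b * b' * K1 * S + c' * c'' * K2 * O' :=
  cs_final hh ha hb hc (le_trans (le_of_eq (by ring)) (h1.trans (le_of_eq (by ring)))) e1 e2 e3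

open scoped Classical in
theorem cells (d : ℕ) (L r : ℝ) (hL : 0 < L) (hr : 0 < r) (hrL : r ≤ L / 2) : ∃ C c κ Pin Pout Rb Nov : ℝ,
    0 < C ∧ 0 < c ∧ 0 < κ ∧ κ ≤ 1 ∧ 0 < Pin ∧ Pout < Pin ∧ 1 ≤ Rb ∧ 1 ≤ Nov ∧
    ∀ (n : ℕ) (h ℓ τ R : ℝ) (W V1 V2 : (Fin d → ℤ) → ℝ) (φ : Fin n → (Fin d → ℤ) → ℂ) (lam : Fin n → ℝ)
      (zc : (Fin d → ℤ) → Fin d → ℝ) (O : Set (Fin d → ℤ)) (b : Fin n → ℂ),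
      CellHyp d n L r κ Rb h ℓ τ R W V1 V2 φ lam zc O →
      c * τ ^ 3 * Real.exp (2 * (τ * Pin)) / 32 * cS b
        ≤ C * Real.exp (2 * (τ * Pout)) * (Nov * (5 * (Rb + 1) * Real.exp (4 * ℓ * (Rb + 1)))) * cS b
          + C * τ * Real.exp (2 * τ) * Nov * ∑' x, Set.indicator O (fun x => ‖comb φ b x‖ ^ 2) x := by
  obtain ⟨C, c, κ, Pin, Pout, Rb, h1, h2, h3, h4, h5, h6, h7, Hloc⟩ := locC d L r hL hr
  refine ⟨C, c, κ, Pin, Pout, Rb, ((⌈2 * (Rb + L) / L⌉₊ + 1) ^ d : ℕ), h1, h2, h3, h4, h5, h6, h7, ?_, ?_⟩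
  · exact_mod_cast Nat.one_le_pow _ _ (by omega)
  intro n h ℓ τ R W V1 V2 φ lam zc O b H
  obtain ⟨Nov, hNov⟩ : ∃ N, N = (⌈2 * (Rb + L) / L⌉₊ + 1) ^ d := ⟨_, rfl⟩
  rw [← hNov]
  have hh := H.sp.hh
  have hS := cS_nonneg b
  have hτ0 : 0 < τ := by
    by_contra hcon
    have : κ * τ ≤ 0 := mul_nonpos_of_nonneg_of_nonpos h3.le (not_lt.1 hcon)
    linarith [H.hκτ]
  have hk := fun k (hk : k ∈ boxZ (Fin d) (NK R L)) => Hloc h τ (zc k) _ _ _ _ (H.loc hL h3 h7 b k hk)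
  have hsum := sum_le_sum hk
  rw [← mul_sum, sum_add_distrib, ← mul_sum, ← mul_sum] at hsum
  refine (cs_final' (K1 := Nov * (5 * (Rb + 1) * Real.exp (4 * ℓ * (Rb + 1)))) (K2 := Nov) (S := cS b)
    (O' := ∑' x, Set.indicator O (fun x => ‖comb φ b x‖ ^ 2) x) hh (by positivity) (by positivity) (by positivity) hsum ?_ ?_ ?_)
  · refine (H.sp.lower (by have := H.hℓ; positivity) H.h4 b (boxZ (Fin d) ⌊R / h⌋₊) ?_).trans ?_
    · intro k hk
      rw [mem_boxZ] at hk
      push Not at hk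
      obtain ⟨i, hi⟩ := hk
      refine H.cf k i ?_
      rw [abs_mul, abs_of_pos hh]
      have : ((⌊R / h⌋₊ + 1 : ℕ) : ℝ) ≤ |(k i : ℝ)| := by exact_mod_cast hi
      have h8 := Nat.lt_floor_add_one (R / h)
      rw [div_lt_iff₀ hh] at h8
      push_cast at this
      nlinarith
    · have e : ∑ m ∈ Finset.Ioc ⌊1 / (2 * h)⌋₊ (2 * ⌊1 / (2 * h)⌋₊), ∑ x ∈ boxZ (Fin d) ⌊R / h⌋₊, ‖Uf h φ lam b (Fin.cons (m : ℤ) x)‖ ^ 2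
        = ∑ z ∈ (Finset.Ioc ⌊1 / (2 * h)⌋₊ (2 * ⌊1 / (2 * h)⌋₊) ×ˢ boxZ (Fin d) ⌊R / h⌋₊).image
            (fun p => (Fin.cons (p.1 : ℤ) p.2 : Fin (d + 1) → ℤ)), ‖Uf h φ lam b z‖ ^ 2 := by
        rw [sum_image, sum_product]
        intro p _ q _ hpq
        have := Fin.cons_injective2 (α := fun _ => ℤ) hpq
        exact Prod.ext (by exact_mod_cast this.1) this.2
      rw [e]
      refine sum_cover _ _ _ _ (fun _ => by positivity) ?_
      intro z hz
      obtain ⟨⟨m, x⟩, hp, rfl⟩ := mem_image.1 hz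
      rw [mem_product, Finset.mem_Ioc, mem_boxZ] at hp
      obtain ⟨⟨hm1, hm2⟩, hx⟩ := hp
      simp only at hm1 hm2 hx ⊢
      have hx' : ∀ i, |h * x i| ≤ R := fun i => by
        rw [abs_mul, abs_of_pos hh]
        have a1 : |(x i : ℝ)| ≤ (⌊R / h⌋₊ : ℝ) := by exact_mod_cast hx i
        have a2 := a1.trans (Nat.floor_le (div_nonneg H.hR hh.le))
        rw [le_div_iff₀ hh] at a2; linarith
      have hmh : h * (m : ℝ) ≤ 1 := by
        have a1 : (m : ℝ) ≤ 2 * ⌊1 / (2 * h)⌋₊ := by exact_mod_cast hm2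
        have a2 : (⌊1 / (2 * h)⌋₊ : ℝ) ≤ 1 / (2 * h) := Nat.floor_le (by positivity)
        have a3 : (m : ℝ) ≤ 1 / h := by
          have : 2 * (1 / (2 * h)) = 1 / h := by field_simp
          linarith
        rw [le_div_iff₀ hh] at a3; linarith
      have hm1' : (1 : ℤ) ≤ m := by omega
      obtain ⟨k, hk, hkx⟩ := cell_cover H hL h7 x hx'
      refine ⟨k, hk, mem_filter.2 ⟨mem_boxZ.2 fun i => ?_, by simpa using hm1', by simpa using hmh, by simpa using hkx⟩⟩
      have hR := H.hR
      apply int_le_QQ hh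
      refine Fin.cases ?_ (fun i => ?_) i
      · simp only [Fin.cons_zero, Int.cast_natCast]
        rw [abs_of_nonneg (by positivity)]; linarith
      · simp only [Fin.cons_succ]; linarith [hx' i]
  · refine (sum_overlap _ _ ((boxZ (Fin (d + 1)) (QQ R Rb L h)).filter fun z => 1 ≤ z 0 ∧ h * z 0 ≤ Rb + 1) _ (enrC_nonneg h _) Nov ?_ ?_).trans ?_
    · intro k hk z hz
      rw [mem_filter] at hz ⊢
      refine ⟨hz.1, hz.2.1, ?_⟩
      have := abs_le.1 (near_le H hL k hk z hz.2.2).1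
      linarith [H.h4]
    · intro z hz
      rw [hNov]
      have : ((boxZ (Fin d) (NK R L)).filter fun k => z ∈ (boxZ (Fin (d + 1)) (QQ R Rb L h)).filter fun z => 1 ≤ z 0 ∧ ‖xmap h (offs h (zc k)) z‖ ≤ Rb)
        ⊆ (boxZ (Fin d) (NK R L)).filter fun k => ∀ i, |h * z i.succ - zc k i| ≤ Rb := by
        intro k hk
        rw [mem_filter] at hk ⊢
        exact ⟨hk.1, fun i => ((near_le H hL k hk.1 z (mem_filter.1 hk.2).2.2).2 i).1⟩
      refine (card_le_card this).trans (card_overlap _ (fun i => h * z i.succ) hL _ fun k hk i => ?_)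
      have := abs_le.1 (hk i); have := abs_le.1 (H.hz k i)
      rw [abs_le]; constructor <;> linarith
    · have := H.sp.upper H.hℓ rfl H.hℓh h7 (by linarith [H.h4]) b ((boxZ (Fin (d + 1)) (QQ R Rb L h)).filter fun z => 1 ≤ z 0 ∧ h * z 0 ≤ Rb + 1)
        (fun z hz => (mem_filter.1 hz).2)
      calc (Nov : ℝ) * _ ≤ Nov * (5 * h * (Rb + 1) * Real.exp (4 * ℓ * (Rb + 1)) * cS b) := by gcongr
        _ = _ := by ring
  · refine (sum_overlap _ _ ((boxZ (Fin (d + 1)) (QQ R Rb L h)).filter fun z : Fin (d + 1) → ℤ => z 0 = 0 ∧ (Fin.tail z : Fin d → ℤ) ∈ O) _ (fun _ => by positivity) Nov ?_ ?_).trans ?_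
    · intro k hk z hz
      rw [mem_filter] at hz ⊢
      refine ⟨hz.1, hz.2.1, H.ob k _ fun i => ?_⟩
      have a1 := single_le_sum (f := fun i : Fin d => (h * z i.succ - zc k i) ^ 2) (fun _ _ => by positivity) (mem_univ i)
      exact abs_le_of_sq_le_sq (a1.trans hz.2.2.le) hr.le
    · intro z hz
      rw [hNov]
      refine card_overlap _ (fun i => h * z i.succ) hL _ fun k hk i => ?_
      have a1 := single_le_sum (f := fun i : Fin d => (h * z i.succ - zc k i) ^ 2) (fun _ _ => by positivity) (mem_univ i)
      have a2 := abs_le.1 (abs_le_of_sq_le_sq (a1.trans (mem_filter.1 hk).2.2.le) hr.le)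
      have := abs_le.1 (H.hz k i)
      rw [abs_le]; constructor <;> linarith
    · have e1 : ∀ x : Fin d → ℤ, (O.indicator (fun x => ‖comb φ b x‖ ^ 2) x) ≤ ‖comb φ b x‖ ^ 2 := fun x =>
        Set.indicator_le_self' (fun _ _ => by positivity) x
      have e0 : ∀ x : Fin d → ℤ, 0 ≤ (O.indicator (fun x => ‖comb φ b x‖ ^ 2) x) := fun x =>
        Set.indicator_nonneg (fun _ _ => by positivity) x
      have hsm : Summable (O.indicator (fun x => ‖comb φ b x‖ ^ 2)) := (H.sp.csm b).indicator O
      have key : ∑ z ∈ (boxZ (Fin (d + 1)) (QQ R Rb L h)).filter (fun z : Fin (d + 1) → ℤ => z 0 = 0 ∧ (Fin.tail z : Fin d → ℤ) ∈ O), ‖Uf h φ lam b (z + eZ 0)‖ ^ 2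
          ≤ h ^ 2 * ∑' x, O.indicator (fun x => ‖comb φ b x‖ ^ 2) x := by
        have a1 : ∀ z ∈ (boxZ (Fin (d + 1)) (QQ R Rb L h)).filter (fun z : Fin (d + 1) → ℤ => z 0 = 0 ∧ (Fin.tail z : Fin d → ℤ) ∈ O),
            ‖Uf h φ lam b (z + eZ 0)‖ ^ 2 ≤ h ^ 2 * O.indicator (fun x => ‖comb φ b x‖ ^ 2) (Fin.tail z) := fun z hz => by
          obtain ⟨-, hz0, hzO⟩ := mem_filter.1 hz
          have : (z + eZ 0 : Fin (d + 1) → ℤ) = Fin.cons ((1 : ℕ) : ℤ) (Fin.tail z) := by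
            funext i; refine Fin.cases ?_ (fun i => ?_) i <;> simp [eZ, hz0, Fin.tail]
          rw [this, Uf_cons, comb_one, Set.indicator_of_mem hzO, norm_mul, mul_pow]
          simp
        refine (sum_le_sum a1).trans ?_
        rw [← tsum_mul_left]
        refine (rows_le _ {0} (fun z => h ^ 2 * O.indicator (fun x => ‖comb φ b x‖ ^ 2) (Fin.tail z)) (fun z => mul_nonneg (by positivity) (e0 _)) ?_ ?_).trans ?_
        · intro z hz; exact ⟨0, by simp, by simpa using (mem_filter.1 hz).2.1⟩
        · intro m _; simpa using hsm.mul_left (h ^ 2)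
        · simp
      calc (Nov : ℝ) * _ ≤ Nov * (h ^ 2 * ∑' x, O.indicator (fun x => ‖comb φ b x‖ ^ 2) x) := by gcongr
        _ = _ := by ring
end
end Carl

namespace Carl
open Finset

lemma eucNorm_le {d : ℕ} (x : Fin d → ℝ) {B : ℝ} (hB : 0 ≤ B) (hx : ∀ i, |x i| ≤ B) : eucNorm d x ≤ d * B := by
  rw [eucNorm]
  apply Real.sqrt_le_iff.2
  refine ⟨by positivity, ?_⟩
  have h1 : ∑ i, x i ^ 2 ≤ ∑ i : Fin d, B ^ 2 := sum_le_sum fun i _ => by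
    rw [← sq_abs]; have := hx i; gcongr
  have h2 : (d : ℝ) ≤ (d : ℝ) ^ 2 := by exact_mod_cast Nat.le_self_pow (by norm_num) d
  have h3 : (d : ℝ) * B ^ 2 ≤ (d : ℝ) ^ 2 * B ^ 2 := by gcongr
  simp at h1
  nlinarith

lemma le_eucNorm {d : ℕ} (x : Fin d → ℝ) (i : Fin d) : |x i| ≤ eucNorm d x := by
  rw [eucNorm]
  apply Real.le_sqrt_of_sq_le
  rw [sq_abs]
  exact single_le_sum (f := fun i => x i ^ 2) (fun _ _ => by positivity) (mem_univ i)

lemma eucNorm_nonneg {d : ℕ} (x : Fin d → ℝ) : 0 ≤ eucNorm d x := Real.sqrt_nonneg _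

/-- confinement radius -/
def RR (c₀ β ℓ : ℝ) : ℝ := (2 * ℓ ^ 2 / c₀) ^ (1 / β)

lemma RR_pow {c₀ β ℓ : ℝ} (hc : 0 < c₀) (hβ : 0 < β) : c₀ * (RR c₀ β ℓ) ^ β = 2 * ℓ ^ 2 := by
  rw [RR, ← Real.rpow_mul (by positivity), one_div_mul_cancel hβ.ne', Real.rpow_one]; field_simp

lemma RR_nonneg {c₀ β ℓ : ℝ} (hc : 0 < c₀) : 0 ≤ RR c₀ β ℓ := by rw [RR]; positivity

lemma pot_bound (d : ℕ) (c₀ c₂ β ρ : ℝ) (hc₀ : 0 < c₀) (hc₂ : 0 < c₂) (hβ : 0 < β) (hρ : 0 ≤ ρ) :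
    ∃ D : ℝ, 1 ≤ D ∧ ∀ ℓ : ℝ, 1 ≤ ℓ → ∀ x : Fin d → ℝ, (∀ i, |x i| ≤ RR c₀ β ℓ + ρ) →
      c₂ * eucNorm d x ^ β ≤ (D * ℓ) ^ 2 := by
  obtain ⟨A, hA⟩ : ∃ A, A = (2 / c₀) ^ (1 / β) + ρ := ⟨_, rfl⟩
  have hA0 : 0 ≤ A := by rw [hA]; positivity
  refine ⟨max 1 (c₂ * (d * A) ^ β), le_max_left _ _, fun ℓ hℓ x hx => ?_⟩
  obtain ⟨D, hD⟩ : ∃ D, D = max 1 (c₂ * (d * A) ^ β) := ⟨_, rfl⟩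
  rw [← hD]
  have hD1 : 1 ≤ D := by rw [hD]; exact le_max_left _ _
  have hD2 : c₂ * (d * A) ^ β ≤ D := by rw [hD]; exact le_max_right _ _
  have hM : (1 : ℝ) ≤ ℓ ^ 2 := by nlinarith
  have hR : RR c₀ β ℓ + ρ ≤ A * (ℓ ^ 2) ^ (1 / β) := by
    have e : RR c₀ β ℓ = (2 / c₀) ^ (1 / β) * (ℓ ^ 2) ^ (1 / β) := by
      rw [RR, ← Real.mul_rpow (by positivity) (by positivity)]; congr 1; ring
    have h1 : 1 ≤ (ℓ ^ 2) ^ (1 / β) := Real.one_le_rpow hM (by positivity)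
    have h2 : ρ * 1 ≤ ρ * (ℓ ^ 2) ^ (1 / β) := by gcongr
    rw [e, hA, add_mul]; linarith
  have h3 : eucNorm d x ≤ d * (A * (ℓ ^ 2) ^ (1 / β)) := eucNorm_le x (by positivity) fun i => (hx i).trans hR
  have h4 : eucNorm d x ^ β ≤ (d * A) ^ β * ℓ ^ 2 := by
    calc eucNorm d x ^ β ≤ (d * (A * (ℓ ^ 2) ^ (1 / β))) ^ β := Real.rpow_le_rpow (eucNorm_nonneg x) h3 hβ.le
      _ = (d * A) ^ β * ((ℓ ^ 2) ^ (1 / β)) ^ β := by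
        rw [← mul_assoc, Real.mul_rpow (by positivity) (by positivity)]
      _ = _ := by rw [← Real.rpow_mul (by positivity), one_div_mul_cancel hβ.ne', Real.rpow_one]
  calc c₂ * eucNorm d x ^ β ≤ c₂ * ((d * A) ^ β * ℓ ^ 2) := by gcongr
    _ = c₂ * (d * A) ^ β * ℓ ^ 2 := by ring
    _ ≤ D * ℓ ^ 2 := by gcongr
    _ ≤ D ^ 2 * ℓ ^ 2 := by gcongr; nlinarith
    _ = _ := by ring

lemma v2_arith {v K : ℝ} (hK : 0 ≤ K) (h : |v| ^ ((4 : ℝ) / 3) ≤ K ^ 2) : v ^ 2 ≤ K ^ 3 := by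
  have h1 : (|v| ^ ((4 : ℝ) / 3)) ^ ((3 : ℝ) / 2) ≤ (K ^ 2) ^ ((3 : ℝ) / 2) :=
    Real.rpow_le_rpow (by positivity) h (by norm_num)
  rw [← Real.rpow_mul (abs_nonneg v), ← Real.rpow_natCast K 2, ← Real.rpow_mul hK] at h1
  norm_num at h1
  rw [← Real.rpow_natCast K 3]
  norm_num
  linarith

lemma mvtV {d : ℕ} {V : (Fin d → ℝ) → ℝ} (hV : ContDiff ℝ 1 V) {B K h : ℝ} (hh : 0 < h) (hB : ∀ x : Fin d → ℝ, (∀ i, |x i| ≤ B + h) → ‖fderiv ℝ V x‖ ≤ K)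
    (k : Fin d → ℤ) (hk : ∀ i, |h * k i| ≤ B) (j : Fin d) : |V (pt d h (k + eZ j)) - V (pt d h k)| ≤ K * h := by
  have hcv : Convex ℝ {x : Fin d → ℝ | ∀ i, |x i| ≤ B + h} := by
    have : {x : Fin d → ℝ | ∀ i, |x i| ≤ B + h} = Set.pi Set.univ fun _ => Set.Icc (-(B + h)) (B + h) := by
      ext x; simp only [Set.mem_setOf_eq, Set.mem_univ_pi, Set.mem_Icc, abs_le]
    rw [this]
    exact convex_pi fun _ _ => convex_Icc _ _
  have h1 := hcv.norm_image_sub_le_of_norm_fderiv_le (f := V) (C := K) (x := pt d h k) (y := pt d h (k + eZ j)) (𝕜 := ℝ)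
    (fun x _ => (hV.differentiable (by norm_num)) x) (fun x hx => hB x hx) (fun i => ?_) (fun i => ?_)
  · have e : pt d h (k + eZ j) - pt d h k = Pi.single j h := by
      funext i; simp only [pt, eZ, Pi.sub_apply, Pi.add_apply, Pi.single_apply]
      split_ifs <;> push_cast <;> ring
    rw [e, Pi.norm_single, Real.norm_eq_abs, Real.norm_eq_abs, abs_of_pos hh] at h1
    exact h1
  · have := hk i; simp only [pt]; linarith
  · have h2 := abs_le.1 (hk i)
    have h3 := abs_le.1 (eZ_abs j i)
    have h4 : (-1 : ℝ) ≤ (eZ j i : ℤ) := by exact_mod_cast h3.1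
    have h5 : ((eZ j i : ℤ) : ℝ) ≤ 1 := by exact_mod_cast h3.2
    simp only [pt, Pi.add_apply, Int.cast_add]
    rw [abs_le]; constructor <;> nlinarith

lemma latE_eq (d : ℕ) (j : Fin d) : latE d j = eZ j := by
  funext i; simp [latE, eZ, Pi.single_apply]

lemma beta_eq {d : ℕ} (hd : 0 < d) {c₁ c₂ β₁ β₂ : ℝ} (hc₁ : 0 < c₁) (hc₂ : 0 < c₂) (hβ : β₁ < β₂) {F : (Fin d → ℝ) → ℝ}
    (h1 : ∀ x, c₁ * eucNorm d x ^ β₁ ≤ F x) (h2 : ∀ x, F x ≤ c₂ * eucNorm d x ^ β₂) : False := by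
  obtain ⟨t, ht⟩ : ∃ t : ℝ, t = (c₁ / (2 * c₂)) ^ (1 / (β₂ - β₁)) := ⟨_, rfl⟩
  have ht0 : 0 < t := by rw [ht]; positivity
  have hb : β₂ - β₁ ≠ 0 := by linarith
  have htp : t ^ (β₂ - β₁) = c₁ / (2 * c₂) := by
    rw [ht, ← Real.rpow_mul (by positivity), one_div_mul_cancel hb, Real.rpow_one]
  have hn : eucNorm d (Pi.single ⟨0, hd⟩ t) = t := by
    rw [eucNorm, sum_eq_single ⟨0, hd⟩]
    · simp [Real.sqrt_sq ht0.le]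
    · intro b _ hb; simp [hb]
    · simp
  have := (h1 (Pi.single ⟨0, hd⟩ t)).trans (h2 _)
  rw [hn] at this
  have e : t ^ β₂ = t ^ β₁ * t ^ (β₂ - β₁) := by rw [← Real.rpow_add ht0]; congr 1; ring
  rw [e, htp] at this
  have e2 : c₂ * (t ^ β₁ * (c₁ / (2 * c₂))) = c₁ * t ^ β₁ / 2 := by field_simp
  rw [e2] at this
  have : 0 < c₁ * t ^ β₁ := by positivity
  linarith

lemma fin_arith {c C Nov Rb Pin Pout τ ℓ S So C₁ : ℝ} (hc : 0 < c) (hC : 0 < C) (hN : 1 ≤ Nov) (hRb : 1 ≤ Rb) (hPin : 0 < Pin) (hP : Pout < Pin)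
    (hC1 : 1 ≤ C₁) (hℓ : 1 ≤ ℓ) (hτ : τ = C₁ * ℓ) (hC2 : 2 * (Rb + 1) ≤ C₁ * (Pin - Pout)) (hC3 : 320 * C * Nov * (Rb + 1) / c ≤ C₁) (hS : 0 ≤ S) (hSo : 0 ≤ So)
    (H : c * τ ^ 3 * Real.exp (2 * (τ * Pin)) / 32 * S
        ≤ C * Real.exp (2 * (τ * Pout)) * (Nov * (5 * (Rb + 1) * Real.exp (4 * ℓ * (Rb + 1)))) * S
          + C * τ * Real.exp (2 * τ) * Nov * So) : S ≤ 64 * C * Nov / c * Real.exp (2 * τ) * So := by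
  have hτ1 : C₁ ≤ τ := by rw [hτ]; exact le_mul_of_one_le_right (by linarith) hℓ
  have hτ1' : 1 ≤ τ := by linarith
  have hτ3 : τ ≤ τ ^ 3 := le_self_pow₀ hτ1' (by norm_num)
  have e1 : Real.exp (2 * (τ * Pout)) * Real.exp (4 * ℓ * (Rb + 1)) ≤ Real.exp (2 * (τ * Pin)) := by
    rw [← Real.exp_add]
    apply Real.exp_le_exp.2
    have : ℓ * (2 * (Rb + 1)) ≤ ℓ * (C₁ * (Pin - Pout)) := by gcongr
    rw [hτ]; nlinarith
  rw [div_le_iff₀ hc] at hC3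
  have e2 : 320 * C * Nov * (Rb + 1) ≤ c * τ ^ 3 := by
    have : C₁ * c ≤ τ ^ 3 * c := by gcongr; linarith
    linarith
  have e3 : C * Real.exp (2 * (τ * Pout)) * (Nov * (5 * (Rb + 1) * Real.exp (4 * ℓ * (Rb + 1)))) ≤ c * τ ^ 3 * Real.exp (2 * (τ * Pin)) / 64 := by
    calc C * Real.exp (2 * (τ * Pout)) * (Nov * (5 * (Rb + 1) * Real.exp (4 * ℓ * (Rb + 1))))
        = (320 * C * Nov * (Rb + 1)) * (Real.exp (2 * (τ * Pout)) * Real.exp (4 * ℓ * (Rb + 1))) / 64 := by ring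
      _ ≤ (c * τ ^ 3) * Real.exp (2 * (τ * Pin)) / 64 := by gcongr
  have e4 := mul_le_mul_of_nonneg_right e3 hS
  have e5 : 1 ≤ Real.exp (2 * (τ * Pin)) := Real.one_le_exp (by positivity)
  have e6 : c * τ * 1 / 64 * S ≤ c * τ ^ 3 * Real.exp (2 * (τ * Pin)) / 64 * S := by gcongr
  have e7 : τ * (c / 64 * S) ≤ τ * (C * Nov * Real.exp (2 * τ) * So) := by linarith
  have e8 := le_of_mul_le_mul_left e7 (by linarith : 0 < τ)
  calc S = 64 / c * (c / 64 * S) := by field_simp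
    _ ≤ 64 / c * (C * Nov * Real.exp (2 * τ) * So) := by gcongr
    _ = _ := by ring
end Carl

namespace Carl
open Finset

lemma eig_bridge {d : ℕ} {h lam V : ℝ} (hh : 0 < h) (f : (Fin d → ℤ) → ℂ) (k : Fin d → ℤ)
    (e : -discLap d h f k + (V : ℂ) * f k = (lam : ℂ) * f k) :
    ∑ j, (f (k + eZ j) + f (k - eZ j) - 2 * f k) = ((h ^ 2 * (V - lam) : ℝ) : ℂ) * f k := by
  simp only [discLap, latE_eq, ← sum_div] at e
  have hc : (h : ℂ) ≠ 0 := by exact_mod_cast hh.ne'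
  have e2 : (∑ j, (f (k + eZ j) + f (k - eZ j) - 2 * f k)) / (h : ℂ) ^ 2 = (V - lam) * f k := by
    linear_combination -e
  rw [div_eq_iff (pow_ne_zero 2 hc)] at e2
  rw [e2]; push_cast; ring

lemma small_arith {κ C₁ h μ : ℝ} (hκ : 0 < κ) (hC : 1 ≤ C₁) (hh : 0 < h) (h1 : h ≤ κ / (2 * C₁))
    (hμ : 0 < μ) (h2 : μ < (κ / (2 * C₁)) ^ 2 * h ^ (-2 : ℝ)) : C₁ * (Real.sqrt μ + 1) * h ≤ κ := by
  have e : h ^ (-2 : ℝ) = (h⁻¹) ^ 2 := by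
    rw [Real.rpow_neg hh.le, inv_pow]; norm_num
  rw [e, ← mul_pow] at h2
  have h3 : Real.sqrt μ ≤ κ / (2 * C₁) * h⁻¹ := Real.sqrt_le_iff.2 ⟨by positivity, h2.le⟩
  have h4 : Real.sqrt μ * h ≤ κ / (2 * C₁) := by
    calc Real.sqrt μ * h ≤ κ / (2 * C₁) * h⁻¹ * h := by gcongr
      _ = _ := by field_simp
  have h5 : (Real.sqrt μ + 1) * h ≤ κ / C₁ := by
    have : κ / C₁ = κ / (2 * C₁) + κ / (2 * C₁) := by field_simp; ring
    linarith
  calc C₁ * (Real.sqrt μ + 1) * h = C₁ * ((Real.sqrt μ + 1) * h) := by ring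
    _ ≤ C₁ * (κ / C₁) := by gcongr
    _ = κ := by field_simp

lemma kap_arith {κ D C₁ ℓ K τ : ℝ} (hκ : 0 < κ) (hκ1 : κ ≤ 1) (hD : 1 ≤ D) (hℓ : 1 ≤ ℓ) (hC : D / κ ≤ C₁) (hK : K = D * ℓ) (hτ : τ = C₁ * ℓ) :
    0 ≤ K ∧ 1 ≤ κ * τ ∧ K ^ 2 ≤ κ * τ ^ 2 ∧ K ^ 3 ≤ κ * τ ^ 3 := by
  rw [div_le_iff₀ hκ] at hC
  have hK0 : 1 ≤ K := by rw [hK]; nlinarith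
  have h1 : K ≤ κ * τ := by
    rw [hK, hτ]
    calc D * ℓ ≤ (C₁ * κ) * ℓ := by gcongr
      _ = _ := by ring
  have hτ0 : 0 < τ := by
    by_contra hc
    have := mul_nonpos_of_nonneg_of_nonpos hκ.le (not_lt.1 hc)
    linarith
  have p2 : κ ^ 2 ≤ κ := pow_le_of_le_one hκ.le hκ1 (by norm_num)
  have p3 : κ ^ 3 ≤ κ := pow_le_of_le_one hκ.le hκ1 (by norm_num)
  refine ⟨by linarith, by linarith, ?_, ?_⟩
  · calc K ^ 2 ≤ (κ * τ) ^ 2 := by gcongr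
      _ = κ ^ 2 * τ ^ 2 := by ring
      _ ≤ _ := by gcongr
  · calc K ^ 3 ≤ (κ * τ) ^ 3 := by gcongr
      _ = κ ^ 3 * τ ^ 3 := by ring
      _ ≤ _ := by gcongr

theorem main_case (d : ℕ) (L γ c₀ c₂ β : ℝ) (hc₀ : 0 < c₀) (hc₂ : 0 < c₂) (hβ : 0 < β) (hL : 0 < L) (hγ : 0 < γ) (hγ1 : γ ≤ 1) :
    ∃ C > (0:ℝ), ∃ ε₀ > (0:ℝ), ∃ h₀ > (0:ℝ),
      ∀ ω : Set (Fin d → ℝ), Equidistributed d L γ ω →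
      ∀ V V₁ V₂ : (Fin d → ℝ) → ℝ, (∀ x, 0 ≤ V x) → (∀ x, V x = V₁ x + V₂ x) → ContDiff ℝ 1 V₁ →
        (∀ x, c₀ * eucNorm d x ^ β ≤ V x) →
        (∀ x, ‖fderiv ℝ V₁ x‖ + |V₁ x| + |V₂ x| ^ ((4:ℝ)/3) ≤ c₂ * eucNorm d x ^ β) →
      ∀ h : ℝ, 0 < h → h < h₀ →
      ∀ μ : ℝ, 0 < μ → μ < ε₀ * h ^ (-2 : ℝ) →
      ∀ (n : ℕ) (φ : Fin n → (Fin d → ℤ) → ℂ) (lam : Fin n → ℝ),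
        (∀ i, Summable fun k => ‖φ i k‖ ^ 2) →
        (∀ i j : Fin n, ∑' k, (starRingEnd ℂ) (φ i k) * φ j k = if i = j then 1 else 0) →
        (∀ (i : Fin n) (k : Fin d → ℤ),
          -discLap d h (φ i) k + (V (pt d h k) : ℂ) * φ i k = (lam i : ℂ) * φ i k) →
        (∀ i, lam i ≤ μ) →
      ∀ coef : Fin n → ℂ,
        ∑' k, ‖∑ i, coef i * φ i k‖ ^ 2
          ≤ C * Real.exp (C * Real.sqrt μ) *
            ∑' k, Set.indicator ω (fun _ => ‖∑ i, coef i * φ i k‖ ^ 2) (pt d h k) := by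
  obtain ⟨C, c, κ, Pin, Pout, Rb, Nov, h1, h2, h3, h4, h5, h6, h7, h8, Hc⟩ := cells d L (γ * L / 2) hL (by positivity)
    (by have : γ * L ≤ 1 * L := by gcongr
        linarith)
  obtain ⟨D, hD1, hD⟩ := pot_bound d c₀ c₂ β (Rb + 3 * L + 1) hc₀ hc₂ hβ (by positivity)
  obtain ⟨C₁, hC₁⟩ : ∃ C₁, C₁ = 1 + D / κ + 2 * (Rb + 1) / (Pin - Pout) + 320 * C * Nov * (Rb + 1) / c := ⟨_, rfl⟩
  have hPP : 0 < Pin - Pout := by linarith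
  have q1 : 0 < D / κ := by positivity
  have q2 : 0 < 2 * (Rb + 1) / (Pin - Pout) := by positivity
  have q3 : 0 < 320 * C * Nov * (Rb + 1) / c := by positivity
  have g1 : 1 ≤ C₁ := by linarith
  have g2 : D / κ ≤ C₁ := by linarith
  have g3 : 2 * (Rb + 1) ≤ C₁ * (Pin - Pout) := by rw [← div_le_iff₀ hPP]; linarith
  have g4 : 320 * C * Nov * (Rb + 1) / c ≤ C₁ := by linarith
  have hK0 : 0 < 64 * C * Nov / c := by positivity
  refine ⟨64 * C * Nov / c * Real.exp (2 * C₁) + 2 * C₁, by positivity, (κ / (2 * C₁)) ^ 2, by positivity,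
    min (1 / 4) (κ / (2 * C₁)), by positivity, ?_⟩
  intro ω hω V V₁ V₂ hV0 hV hV1 hVl hVu h hh hh0 μ hμ hμh n φ lam hsm horth heig hlam coef
  obtain ⟨-, -, -, zc, hzc⟩ := hω
  obtain ⟨hh4, hhκ⟩ := lt_min_iff.1 hh0
  obtain ⟨ℓ, hℓ⟩ : ∃ ℓ, ℓ = Real.sqrt μ + 1 := ⟨_, rfl⟩
  have hs0 := Real.sqrt_nonneg μ
  have hℓ1 : 1 ≤ ℓ := by linarith
  have hμℓ : μ ≤ ℓ ^ 2 := by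
    have := Real.sq_sqrt hμ.le
    rw [hℓ]; nlinarith
  obtain ⟨k0, k1, k2, k3⟩ := kap_arith h3 h4 hD1 hℓ1 g2 rfl (rfl : C₁ * ℓ = C₁ * ℓ)
  have hτh : C₁ * ℓ * h ≤ κ := by rw [hℓ]; exact small_arith h3 g1 hh hhκ.le hμ hμh
  have hℓh : ℓ * h ≤ 1 := by
    have : 1 * (ℓ * h) ≤ C₁ * (ℓ * h) := by gcongr
    nlinarith
  have hκle : h ≤ κ := by
    have : h * 1 ≤ h * (C₁ * ℓ) := by gcongr; nlinarith
    linarith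
  have hz : ∀ k i, |zc k i - L * (k i : ℝ)| ≤ L / 2 := fun k i =>
    (hzc k (by intro i; simp; positivity)).2 i
  have hob : ∀ k x : Fin d → ℤ, (∀ i, |h * (x i : ℝ) - zc k i| ≤ γ * L / 2) → x ∈ {x | pt d h x ∈ ω} := fun k x hx =>
    (hzc k (fun i => hx i)).1
  have hb : ∀ x : Fin d → ℝ, (∀ i, |x i| ≤ RR c₀ β ℓ + (Rb + 3 * L + 1)) → ‖fderiv ℝ V₁ x‖ + |V₁ x| + |V₂ x| ^ ((4:ℝ)/3) ≤ (D * ℓ) ^ 2 :=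
    fun x hx => (hVu x).trans (hD ℓ hℓ1 x hx)
  have hpt : ∀ k : Fin d → ℤ, (∀ i, |h * (k i : ℝ)| ≤ RR c₀ β ℓ + (Rb + 3 * L)) →
      ∀ i, |pt d h k i| ≤ RR c₀ β ℓ + (Rb + 3 * L + 1) := fun k hk i => by
    have := hk i; simp only [pt]; linarith
  have CH : CellHyp d n L (γ * L / 2) κ Rb h ℓ (C₁ * ℓ) (RR c₀ β ℓ) (fun k => V (pt d h k)) (fun k => V₁ (pt d h k)) (fun k => V₂ (pt d h k))
      φ lam zc {x | pt d h x ∈ ω} :=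
    { sp := ⟨hh, fun k => hV0 _, hsm, horth, fun i k => eig_bridge hh _ k (heig i k), fun i => (hlam i).trans hμℓ⟩
      hℓ := hℓ1
      hℓh := hℓh
      h4 := hh4.le
      hκ := hκle
      hτ := hτh
      hκτ := k1
      hR := RR_nonneg hc₀
      hz := hz
      cf := fun k i hi => by
        have e1 : RR c₀ β ℓ ≤ eucNorm d (pt d h k) := hi.le.trans (le_eucNorm (pt d h k) i)
        have e2 : (RR c₀ β ℓ) ^ β ≤ eucNorm d (pt d h k) ^ β := Real.rpow_le_rpow (RR_nonneg hc₀) e1 hβ.le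
        rw [← RR_pow (ℓ := ℓ) hc₀ hβ]
        exact (mul_le_mul_of_nonneg_left e2 hc₀.le).trans (hVl _)
      WV := fun k => hV _
      v1 := fun k hk => by
        have a := hb _ (hpt k hk)
        have b1 := norm_nonneg (fderiv ℝ V₁ (pt d h k))
        have b2 : 0 ≤ |V₂ (pt d h k)| ^ ((4:ℝ)/3) := by positivity
        linarith
      v1d := fun k hk j => by
        refine (mvtV hV1 (K := (D * ℓ) ^ 2) hh (fun x hx => ?_) k hk j).trans (by gcongr)
        have a := hb x (fun i => (hx i).trans (by linarith))
        have b1 := abs_nonneg (V₁ x)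
        have b2 : 0 ≤ |V₂ x| ^ ((4:ℝ)/3) := by positivity
        linarith
      v2 := fun k hk => by
        have a := hb _ (hpt k hk)
        have b1 := norm_nonneg (fderiv ℝ V₁ (pt d h k))
        have b2 := abs_nonneg (V₁ (pt d h k))
        exact (v2_arith k0 (by linarith)).trans k3
      ob := hob }
  have res := Hc n h ℓ (C₁ * ℓ) _ _ _ _ φ lam zc _ coef CH
  obtain ⟨So, hSo⟩ : ∃ So, So = ∑' k, Set.indicator ω (fun _ => ‖∑ i, coef i * φ i k‖ ^ 2) (pt d h k) := ⟨_, rfl⟩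
  have eSo : ∑' x, Set.indicator {x | pt d h x ∈ ω} (fun x => ‖comb φ coef x‖ ^ 2) x = So := by
    rw [hSo]; refine tsum_congr fun x => ?_
    by_cases hx : pt d h x ∈ ω
    · rw [Set.indicator_of_mem (by exact hx), Set.indicator_of_mem hx]; rfl
    · rw [Set.indicator_of_notMem (by exact hx), Set.indicator_of_notMem hx]
  have hSo0 : 0 ≤ So := by rw [hSo]; exact tsum_nonneg fun k => Set.indicator_nonneg (fun _ _ => by positivity) _
  have eS : ∑' k, ‖∑ i, coef i * φ i k‖ ^ 2 = cS coef := (CH.sp.hasN coef).tsum_eq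
  rw [eSo] at res
  have fin := fin_arith h2 h1 h8 h7 h5 h6 g1 hℓ1 rfl g3 g4 (cS_nonneg coef) hSo0 res
  rw [eS, ← hSo]
  refine fin.trans ?_
  gcongr ?_ * So
  have e1 : Real.exp (2 * (C₁ * ℓ)) = Real.exp (2 * C₁) * Real.exp (2 * C₁ * Real.sqrt μ) := by
    rw [← Real.exp_add, hℓ]; congr 1; ring
  rw [e1, ← mul_assoc]
  have e2 : 0 < 64 * C * Nov / c * Real.exp (2 * C₁) := by positivity
  gcongr
  · linarith
  · linarith
end Carl


namespace Carl
lemma d0_case (L γ : ℝ) (ω : Set (Fin 0 → ℝ)) (hω : Equidistributed 0 L γ ω) (x : Fin 0 → ℝ) : x ∈ ω := by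
  obtain ⟨-, -, -, z, hz⟩ := hω
  exact (hz 0 (fun i => i.elim0)).1

lemma exp_conv {μ β : ℝ} (hβ : 0 < β) : μ ^ (β / (2 * β)) = Real.sqrt μ := by
  rw [Real.sqrt_eq_rpow]; congr 1; field_simp
end Carl

/-- Spectral inequality for discrete Schrödinger operators with power-growth
potentials over equidistributed sets: for linear combinations `v` of eigenfunctions of
`−Δ_h+V` with eigenvalues `≤ μ`, one has
`‖v‖²_{ℓ²(hℤ^d)} ≤ C·e^{Cμ^{β₂/(2β₁)}}·‖v‖²_{ℓ²(ω)}`. -/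
theorem stmt_6 (d : ℕ) (L γ c₀ c₁ c₂ β₁ β₂ : ℝ)
    (hc₀ : 0 < c₀) (hc₁ : 0 < c₁) (hc₂ : 0 < c₂) (hβ₁ : 0 < β₁) (hβ : β₁ ≤ β₂) :
    ∃ C > (0:ℝ), ∃ ε₀ > (0:ℝ), ∃ h₀ > (0:ℝ),
      ∀ ω : Set (Fin d → ℝ), Equidistributed d L γ ω →
      ∀ V V₁ V₂ : (Fin d → ℝ) → ℝ,
        Continuous V → (∀ x, 0 ≤ V x) → (∀ x, V x = V₁ x + V₂ x) →
        ContDiff ℝ 1 V₁ → Continuous V₂ →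
        (∀ x, c₀ * eucNorm d x ^ β₁ ≤ V x) →
        (∀ x, c₁ * eucNorm d x ^ β₁
            ≤ ‖fderiv ℝ V₁ x‖ + |V₁ x| + |V₂ x| ^ ((4:ℝ)/3)) →
        (∀ x, ‖fderiv ℝ V₁ x‖ + |V₁ x| + |V₂ x| ^ ((4:ℝ)/3)
            ≤ c₂ * eucNorm d x ^ β₂) →
      ∀ h : ℝ, 0 < h → h < h₀ →
      ∀ μ : ℝ, 0 < μ → μ < ε₀ * h ^ (-(2 * β₂ / β₁)) →
      ∀ (n : ℕ) (φ : Fin n → (Fin d → ℤ) → ℂ) (lam : Fin n → ℝ),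
        (∀ i, Summable fun k => ‖φ i k‖ ^ 2) →
        (∀ i j : Fin n, ∑' k, (starRingEnd ℂ) (φ i k) * φ j k
            = if i = j then 1 else 0) →
        (∀ (i : Fin n) (k : Fin d → ℤ),
          -discLap d h (φ i) k + (V (pt d h k) : ℂ) * φ i k = (lam i : ℂ) * φ i k) →
        (∀ i, lam i ≤ μ) →
      ∀ coef : Fin n → ℂ,
        ∑' k, ‖∑ i, coef i * φ i k‖ ^ 2
          ≤ C * Real.exp (C * μ ^ (β₂ / (2 * β₁))) *
            ∑' k, Set.indicator ω (fun _ => ‖∑ i, coef i * φ i k‖ ^ 2) (pt d h k) := by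
  rcases Nat.eq_zero_or_pos d with rfl | hd
  · refine ⟨1, one_pos, 1, one_pos, 1, one_pos, ?_⟩
    intro ω hω V V₁ V₂ _ _ _ _ _ _ _ _ h _ _ μ hμ _ n φ lam _ _ _ _ coef
    have e : ∑' k, Set.indicator ω (fun _ => ‖∑ i, coef i * φ i k‖ ^ 2) (pt 0 h k) = ∑' k, ‖∑ i, coef i * φ i k‖ ^ 2 :=
      tsum_congr fun k => Set.indicator_of_mem (Carl.d0_case L γ ω hω _) _
    rw [e]
    refine le_mul_of_one_le_left (tsum_nonneg fun _ => by positivity) ?_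
    rw [one_mul, one_mul]
    exact Real.one_le_exp (by positivity)
  by_cases hg : 0 < L ∧ 0 < γ ∧ γ ≤ 1
  swap
  · refine ⟨1, one_pos, 1, one_pos, 1, one_pos, ?_⟩
    intro ω hω
    exact absurd ⟨hω.1, hω.2.1, hω.2.2.1⟩ hg
  rcases hβ.lt_or_eq with hlt | rfl
  · refine ⟨1, one_pos, 1, one_pos, 1, one_pos, ?_⟩
    intro ω hω V V₁ V₂ _ _ _ _ _ _ ha hb
    exact (Carl.beta_eq hd hc₁ hc₂ hlt ha hb).elim
  obtain ⟨C, hC, ε, hε, h₀, hh₀, H⟩ := Carl.main_case d L γ c₀ c₂ β₁ hc₀ hc₂ hβ₁ hg.1 hg.2.1 hg.2.2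
  refine ⟨C, hC, ε, hε, h₀, hh₀, ?_⟩
  intro ω hω V V₁ V₂ _ hV0 hV hV1 _ hl _ hu h hh hhh μ hμ hμh n φ lam hsm ho he hlam coef
  rw [Carl.exp_conv hβ₁]
  refine H ω hω V V₁ V₂ hV0 hV hV1 hl hu h hh hhh μ hμ ?_ n φ lam hsm ho he hlam coef
  have e : (2 * β₁ / β₁) = 2 := by field_simp
  rw [e] at hμh
  exact hμh
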